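/- Let n ≥ 2 be an integer, let Γ ∈ 𝒰, and let K be a homogeneous Calderón–Zygmund kernel on ℝ^n. Suppose 2 ≤ r < ∞ and 2(n+1)/(n−1) < p < ∞. Then there exist constants ε > 0 and C such that for every integer l ≥ 1, every m ∈ ℤ, and every Schwartz function f on ℝ^n one has ‖𝓗_{j,l}f‖_{W_{r,p}(j∈S_{l,m})} ≤ C · 2^{−(m+l)ε} ‖f‖_{L^p(ℝ^n)}, with ε, C independent of m and l. -/

import Mathlib

open MeasureTheory Filter Set
open scoped ENNReal NNReal FourierTransform Topology

noncomputable section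

/-- `ℝⁿ` as a Euclidean space. -/
abbrev Rn (n : ℕ) := EuclideanSpace ℝ (Fin n)

/-- The class `𝒰` of phase functions: `Γ` is continuous on `[0,∞)`, smooth on `(0,∞)`,
`Γ(0) = 0`, `Γ′ > 0` on `(0,∞)`, with the bounds `c_{1,j} ≤ |s^j Γ^{(j)}(s)/Γ(s)|` for
`j = 1, 2` and `|s^j Γ^{(j)}(s)/Γ(s)| ≤ c_{2,j}` for all `j ≥ 1`. -/
structure IsGammaU (Γ : ℝ → ℝ) : Prop where
  continuousOn : ContinuousOn Γ (Set.Ici 0)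
  smooth : ContDiffOn ℝ (⊤ : ℕ∞) Γ (Set.Ioi 0)
  map_zero : Γ 0 = 0
  deriv_pos : ∀ s > (0 : ℝ), 0 < deriv Γ s
  lower : ∀ j ∈ ({1, 2} : Set ℕ), ∃ c > (0 : ℝ), ∀ s > (0 : ℝ),
    c ≤ |s ^ j * iteratedDeriv j Γ s / Γ s|
  upper : ∀ j : ℕ, 1 ≤ j → ∃ c > (0 : ℝ), ∀ s > (0 : ℝ),
    |s ^ j * iteratedDeriv j Γ s / Γ s| ≤ c

/-- `K` is a homogeneous Calderón–Zygmund kernel on `ℝⁿ`: `K(t) = Ω(t)/‖t‖ⁿ` with `Ω` smooth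
away from the origin, homogeneous of degree `0`, and of mean value zero on the unit sphere. -/
def IsHomCZKernel (n : ℕ) (K : Rn n → ℝ) : Prop :=
  ∃ Ω : Rn n → ℝ,
    ContDiffOn ℝ (⊤ : ℕ∞) Ω {x : Rn n | x ≠ 0} ∧
    (∀ c : ℝ, 0 < c → ∀ t : Rn n, Ω (c • t) = Ω t) ∧
    (∫ θ : Metric.sphere (0 : Rn n) 1, Ω θ ∂((volume : Measure (Rn n)).toSphere) = 0) ∧
    (∀ t : Rn n, t ≠ 0 → K t = Ω t / ‖t‖ ^ n)

/-- The `r`-variation of a family `(a_u)_{u ∈ 𝒦}`. -/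
def variation {ι : Type*} [LinearOrder ι] (r : ℝ) (𝒦 : Set ι) (a : ι → ℂ) : ℝ≥0∞ :=
  ⨆ (J : ℕ) (u : Fin (J + 1) → ι) (_ : StrictMono u) (_ : ∀ i, u i ∈ 𝒦),
    (∑ i : Fin J, (‖a (u i.succ) - a (u i.castSucc)‖₊ : ℝ≥0∞) ^ r) ^ (1 / r)

/-- The `λ`-jump counting function of a family `(a_u)_{u ∈ 𝒦}`. -/
def jumpCount {ι : Type*} [LinearOrder ι] (lam : ℝ) (𝒦 : Set ι) (a : ι → ℂ) : ℝ≥0∞ :=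
  ⨆ (J : ℕ) (s : Fin J → ι) (t : Fin J → ι) (_ : ∀ i, s i ∈ 𝒦) (_ : ∀ i, t i ∈ 𝒦)
    (_ : ∀ i, s i < t i) (_ : ∀ i j : Fin J, i < j → t i < s j)
    (_ : ∀ i, lam < ‖a (t i) - a (s i)‖), (J : ℝ≥0∞)

/-- The `L^p` norm of an `ℝ≥0∞`-valued function. -/
def lpNormENN {α : Type*} [MeasurableSpace α] (p : ℝ) (g : α → ℝ≥0∞) (μ : Measure α) : ℝ≥0∞ :=
  (∫⁻ x, g x ^ p ∂μ) ^ (1 / p)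

/-- The fixed Littlewood–Paley cutoff `ψ : ℝ → [0,1]`, supported in `{1/2 ≤ |s| ≤ 2}`,
with `∑_{l ∈ ℤ} ψ(2^{-l} s) = 1` for `s ≠ 0`. -/
def IsLPCutoff (ψ : ℝ → ℝ) : Prop :=
  ContDiff ℝ (⊤ : ℕ∞) ψ ∧ (∀ s, ψ s ∈ Set.Icc (0 : ℝ) 1) ∧
    (∀ s, ψ s ≠ 0 → |s| ∈ Set.Icc (1/2 : ℝ) 2) ∧
    (∀ s : ℝ, s ≠ 0 → HasSum (fun l : ℤ => ψ ((2 : ℝ) ^ (-l) * s)) 1)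

/-- `k_* = sup{ m ∈ ℤ : 2^k Γ(2^m) ≤ 1 }`. -/
def kstar (Γ : ℝ → ℝ) (k : ℤ) : ℤ :=
  sSup {m : ℤ | (2 : ℝ) ^ k * Γ ((2 : ℝ) ^ m) ≤ 1}

/-- The localized modulated integral `H_l^{(u)} f(x) = ∫ f(x−t) e^{iuΓ(|t|)} ψ_l(t) K(t) dt`. -/
def Hloc {n : ℕ} (Γ : ℝ → ℝ) (K : Rn n → ℝ) (ψ : ℝ → ℝ) (u : ℝ) (l : ℤ)
    (f : Rn n → ℂ) (x : Rn n) : ℂ :=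
  ∫ t : Rn n, f (x - t) * Complex.exp (Complex.I * Complex.ofReal (u * Γ ‖t‖)) *
    Complex.ofReal (ψ ((2 : ℝ) ^ (-l) * ‖t‖) * K t)

/-- The fixed cutoff `χ : ℝ → [0,1]`, supported in `[1/2, 4]` and equal to `1` on `[1,2]`. -/
def IsChiCutoff (χ : ℝ → ℝ) : Prop :=
  ContDiff ℝ (⊤ : ℕ∞) χ ∧ (∀ u, χ u ∈ Set.Icc (0 : ℝ) 1) ∧
    (∀ u, χ u ≠ 0 → u ∈ Set.Icc (1/2 : ℝ) 4) ∧ (∀ u ∈ Set.Icc (1 : ℝ) 2, χ u = 1)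

/-- The Littlewood–Paley piece `Δ_i g` (`i ≥ 0`) on `ℝ`. -/
def deltaHigh (ψ : ℝ → ℝ) (i : ℕ) (g : ℝ → ℂ) : ℝ → ℂ :=
  𝓕⁻ fun τ : ℝ => Complex.ofReal (ψ ((2 : ℝ) ^ (-(i : ℤ)) * |τ|)) * 𝓕 g τ

/-- The low-frequency piece `Δ_{-1} g` on `ℝ`. -/
def deltaLow (ψ : ℝ → ℝ) (g : ℝ → ℂ) : ℝ → ℂ :=
  𝓕⁻ fun τ : ℝ => Complex.ofReal (1 - ∑' i : ℕ, ψ ((2 : ℝ) ^ (-(i : ℤ)) * |τ|)) * 𝓕 g τ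

/-- The Besov norm `‖g‖_{B_{r,1}^{1/r}(ℝ)} = ‖Δ_{-1}g‖_{L^r} + ∑_{i≥0} 2^{i/r} ‖Δ_i g‖_{L^r}`. -/
def besovNorm (ψ : ℝ → ℝ) (r : ℝ) (g : ℝ → ℂ) : ℝ≥0∞ :=
  eLpNorm (deltaLow ψ g) (ENNReal.ofReal r) volume +
    ∑' i : ℕ, ENNReal.ofReal ((2 : ℝ) ^ ((i : ℝ) / r)) *
      eLpNorm (deltaHigh ψ i g) (ENNReal.ofReal r) volume

/-- The index set `S_{l,m} = { j ∈ ℤ : 2^{m+l} ≤ Γ(2^{l+j_*})/Γ(2^{j_*}) < 2^{m+l+1} }`. -/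
def Slm (Γ : ℝ → ℝ) (l m : ℤ) : Set ℤ :=
  {j : ℤ | (2 : ℝ) ^ (m + l) ≤ Γ ((2 : ℝ) ^ (l + kstar Γ j)) / Γ ((2 : ℝ) ^ (kstar Γ j)) ∧
    Γ ((2 : ℝ) ^ (l + kstar Γ j)) / Γ ((2 : ℝ) ^ (kstar Γ j)) < (2 : ℝ) ^ (m + l + 1)}


/-! ### A Garsia-type inequality for adapted majorants -/

lemma ennreal_add_rpow_le {q : ℝ} (hq : 1 ≤ q) (x a : ℝ≥0∞) :
    (x + a) ^ q ≤ x ^ q + ENNReal.ofReal q * a * (x + a) ^ (q - 1) := by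
  have hq0 : 0 < q := by linarith
  rcases eq_or_ne x ⊤ with rfl | hx
  · simp [ENNReal.top_rpow_of_pos hq0]
  rcases eq_or_ne a ⊤ with rfl | ha
  · rcases hq.eq_or_lt with rfl | hq1
    · simp
    · simp [ENNReal.top_rpow_of_pos hq0, ENNReal.top_rpow_of_pos (sub_pos.2 hq1), ENNReal.mul_top,
        hq0]
  lift x to ℝ≥0 using hx
  lift a to ℝ≥0 using ha
  have hq1 : 0 ≤ q - 1 := by linarith
  rw [← ENNReal.coe_add, ← ENNReal.coe_rpow_of_nonneg _ hq0.le,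
    ← ENNReal.coe_rpow_of_nonneg _ hq0.le, ← ENNReal.coe_rpow_of_nonneg _ hq1, ENNReal.ofReal,
    ← ENNReal.coe_mul, ← ENNReal.coe_mul, ← ENNReal.coe_add, ENNReal.coe_le_coe]
  rw [← NNReal.coe_le_coe]
  push_cast
  rw [Real.coe_toNNReal _ hq0.le]
  have hx : (0 : ℝ) ≤ x := x.2
  have ha : (0 : ℝ) ≤ a := a.2
  generalize (x : ℝ) = x at *
  generalize (a : ℝ) = a at *
  rcases (add_nonneg hx ha).eq_or_lt with h | h
  · have hx0 : x = 0 := by linarith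
    have ha0 : a = 0 := by linarith
    simp [hx0, ha0]
  · have h1 := one_add_mul_self_le_rpow_one_add (s := -(a / (x + a))) (p := q) (by
      rw [neg_le_neg_iff, div_le_one h]; linarith) hq
    have h2 : 1 + -(a / (x + a)) = x / (x + a) := by field_simp; ring
    rw [h2, Real.div_rpow hx h.le, le_div_iff₀ (Real.rpow_pos_of_pos h q)] at h1
    have h3 : (x + a) ^ q = (x + a) ^ (q - 1) * (x + a) := by
      rw [← Real.rpow_add_one h.ne']; ring_nf
    have h4 : (1 + q * -(a / (x + a))) * (x + a) ^ q = (x + a) ^ q - q * a * (x + a) ^ (q - 1) := by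
      rw [h3]; field_simp; ring
    linarith

lemma sum_range_tsub_pow {c : ℕ → ℝ≥0∞} (hc : Monotone c) (h0 : c 0 = 0) (N : ℕ) :
    ∑ i ∈ Finset.range N, (c (i + 1) - c i) = c N := by
  induction N with
  | zero => simp [h0]
  | succ k ih =>
    rw [Finset.sum_range_succ, ih, add_comm]
    exact tsub_add_cancel_of_le (hc (Nat.le_succ k))

lemma rpow_sum_le_abel {q : ℝ} (hq : 1 < q) {a b : ℕ → ℝ≥0∞} (hab : ∀ i, a i ≤ b i) (N : ℕ) :
    (∑ i ∈ Finset.range N, a i) ^ q ≤ ENNReal.ofReal q * ∑ i ∈ Finset.range N,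
      ((∑ k ∈ Finset.range (i + 1), b k) ^ (q - 1) - (∑ k ∈ Finset.range i, b k) ^ (q - 1)) *
        ∑ k ∈ Finset.Ico i N, a k := by
  have hq1 : 0 < q - 1 := by linarith
  set c : ℕ → ℝ≥0∞ := fun i => (∑ k ∈ Finset.range i, b k) ^ (q - 1) with hc
  have hmono : Monotone c := by
    apply monotone_nat_of_le_succ
    intro i
    apply ENNReal.rpow_le_rpow _ hq1.le
    rw [Finset.sum_range_succ]; exact le_self_add
  have h0 : c 0 = 0 := by simp [hc, hq1]
  have h1 : ∀ M, (∑ i ∈ Finset.range M, a i) ^ q ≤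
      ENNReal.ofReal q * ∑ i ∈ Finset.range M, a i * c (i + 1) := by
    intro M
    induction M with
    | zero => simp [show 0 < q by linarith]
    | succ k ih =>
      rw [Finset.sum_range_succ, Finset.sum_range_succ]
      refine (ennreal_add_rpow_le hq.le _ _).trans ?_
      rw [mul_add, ← mul_assoc (ENNReal.ofReal q) (a k)]
      gcongr
      rw [← Finset.sum_range_succ]
      exact ENNReal.rpow_le_rpow (Finset.sum_le_sum fun i _ => hab i) hq1.le
  refine (h1 N).trans ?_
  refine mul_le_mul_right (le_of_eq ?_) _
  calc ∑ i ∈ Finset.range N, a i * c (i + 1)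
      = ∑ i ∈ Finset.range N, ∑ k ∈ Finset.range (i + 1), (c (k + 1) - c k) * a i := by
        refine Finset.sum_congr rfl fun i _ => ?_
        rw [← Finset.sum_mul, sum_range_tsub_pow hmono h0, mul_comm]
    _ = ∑ k ∈ Finset.range N, ∑ i ∈ Finset.Ico k N, (c (k + 1) - c k) * a i := by
        apply Finset.sum_comm'
        intro x y
        simp only [Finset.mem_range, Finset.mem_Ico]
        omega
    _ = _ := by
        refine Finset.sum_congr rfl fun i _ => ?_
        rw [Finset.mul_sum]

/-- If the tails of `∑ a i` are controlled by `A • Y` when tested against functions measurable with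
respect to `m i`, and `a i` is dominated by an `m i`-measurable function `b i`, then the `q`-th
moment of `∑ a i` is controlled by `Y` and the moments of `∑ b i`. -/
lemma lintegral_rpow_sum_le_of_adapted {α : Type*} [m0 : MeasurableSpace α] (μ : Measure α)
    {q : ℝ} (hq : 1 < q) {m : ℕ → MeasurableSpace α} (hm : Monotone m) (hm0 : ∀ i, m i ≤ m0)
    {a b : ℕ → α → ℝ≥0∞} {Y : α → ℝ≥0∞} {A : ℝ≥0∞} (N : ℕ)
    (ha : ∀ i, Measurable (a i)) (hb : ∀ i, Measurable[m i] (b i)) (hab : ∀ i x, a i x ≤ b i x)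
    (hY : Measurable Y)
    (H : ∀ i < N, ∀ D : α → ℝ≥0∞, Measurable[m i] D →
      ∫⁻ x, D x * ∑ k ∈ Finset.Ico i N, a k x ∂μ ≤ A * ∫⁻ x, D x * Y x ∂μ) :
    ∫⁻ x, (∑ i ∈ Finset.range N, a i x) ^ q ∂μ ≤
      ENNReal.ofReal q * A * ∫⁻ x, Y x * (∑ i ∈ Finset.range N, b i x) ^ (q - 1) ∂μ := by
  have hq1 : 0 < q - 1 := by linarith
  set c : ℕ → α → ℝ≥0∞ := fun i x => (∑ k ∈ Finset.range i, b k x) ^ (q - 1) with hc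
  have hD : ∀ i, Measurable[m i] fun x => c (i + 1) x - c i x := by
    intro i
    have h1 : ∀ M ≤ i + 1, Measurable[m i] (c M) := by
      intro M hM
      refine Measurable.pow_const ?_ _
      refine Finset.measurable_fun_sum (m := m i) _ fun k hk => ?_
      exact (hb k).mono (hm (by have := Finset.mem_range.1 hk; omega)) le_rfl
    exact (h1 _ le_rfl).sub (h1 _ (by omega))
  have hD0 : ∀ i, Measurable fun x => c (i + 1) x - c i x := fun i => (hD i).mono (hm0 i) le_rfl
  have hmono : ∀ x, Monotone fun i => c i x := by
    intro x
    apply monotone_nat_of_le_succ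
    intro i
    apply ENNReal.rpow_le_rpow _ hq1.le
    rw [Finset.sum_range_succ]; exact le_self_add
  calc ∫⁻ x, (∑ i ∈ Finset.range N, a i x) ^ q ∂μ
      ≤ ∫⁻ x, ENNReal.ofReal q * ∑ i ∈ Finset.range N,
          (c (i + 1) x - c i x) * ∑ k ∈ Finset.Ico i N, a k x ∂μ :=
        lintegral_mono fun x => rpow_sum_le_abel hq (fun i => hab i x) N
    _ = ENNReal.ofReal q * ∑ i ∈ Finset.range N,
          ∫⁻ x, (c (i + 1) x - c i x) * ∑ k ∈ Finset.Ico i N, a k x ∂μ := by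
        rw [lintegral_const_mul', lintegral_finsetSum]
        · intro i _
          exact (hD0 i).mul (Finset.measurable_fun_sum _ fun k _ => ha k)
        · simp
    _ ≤ ENNReal.ofReal q * ∑ i ∈ Finset.range N, A * ∫⁻ x, (c (i + 1) x - c i x) * Y x ∂μ := by
        gcongr with i hi
        exact H i (Finset.mem_range.1 hi) _ (hD i)
    _ = ENNReal.ofReal q * A * ∫⁻ x, Y x * (∑ i ∈ Finset.range N, b i x) ^ (q - 1) ∂μ := by
        rw [← Finset.mul_sum, mul_assoc]
        congr 2
        refine (lintegral_finsetSum _ fun i _ => (show Measurable fun x =>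
          (c (i + 1) x - c i x) * Y x from (hD0 i).mul hY)).symm.trans ?_
        refine lintegral_congr fun x => ?_
        rw [← Finset.sum_mul, sum_range_tsub_pow (hmono x) (by simp [hc, hq1]), mul_comm]

/-- Hölder form of the adapted inequality. -/
lemma lintegral_rpow_sum_le_of_adapted_Lp {α : Type*} [m0 : MeasurableSpace α] (μ : Measure α)
    {q : ℝ} (hq : 1 < q) {m : ℕ → MeasurableSpace α} (hm : Monotone m) (hm0 : ∀ i, m i ≤ m0)
    {a b : ℕ → α → ℝ≥0∞} {Y : α → ℝ≥0∞} {A B : ℝ≥0∞} (N : ℕ)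
    (ha : ∀ i, Measurable (a i)) (hb : ∀ i, Measurable[m i] (b i)) (hab : ∀ i x, a i x ≤ b i x)
    (hY : Measurable Y)
    (hfin : ∫⁻ x, (∑ i ∈ Finset.range N, b i x) ^ q ∂μ ≠ ⊤)
    (Ha : ∀ i < N, ∀ D : α → ℝ≥0∞, Measurable[m i] D →
      ∫⁻ x, D x * ∑ k ∈ Finset.Ico i N, a k x ∂μ ≤ A * ∫⁻ x, D x * Y x ∂μ)
    (Hb : ∀ i < N, ∀ D : α → ℝ≥0∞, Measurable[m i] D →
      ∫⁻ x, D x * ∑ k ∈ Finset.Ico i N, b k x ∂μ ≤ B * ∫⁻ x, D x * Y x ∂μ) :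
    ∫⁻ x, (∑ i ∈ Finset.range N, a i x) ^ q ∂μ ≤
      ENNReal.ofReal q * A * (ENNReal.ofReal q * B) ^ (q - 1) * ∫⁻ x, Y x ^ q ∂μ := by
  have hq0 : 0 < q := by linarith
  have hq1 : 0 < q - 1 := by linarith
  have hb0 : ∀ i, Measurable (b i) := fun i => (hb i).mono (hm0 i) le_rfl
  set X : α → ℝ≥0∞ := fun x => ∑ i ∈ Finset.range N, b i x with hX
  have hXm : Measurable X := Finset.measurable_fun_sum _ fun k _ => hb0 k
  set I : ℝ≥0∞ := ∫⁻ x, X x ^ q ∂μ with hI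
  set J : ℝ≥0∞ := ∫⁻ x, Y x ^ q ∂μ with hJ
  have hconj : q.HolderConjugate (q / (q - 1)) := Real.HolderConjugate.conjExponent hq
  have hold : ∫⁻ x, Y x * X x ^ (q - 1) ∂μ ≤ J ^ (1 / q) * I ^ ((q - 1) / q) := by
    have := ENNReal.lintegral_mul_le_Lp_mul_Lq μ hconj hY.aemeasurable
      (hXm.pow_const (q - 1)).aemeasurable
    refine this.trans (le_of_eq ?_)
    congr 1
    · simp only [one_div_div]
      congr 1
      refine lintegral_congr fun x => ?_
      rw [← ENNReal.rpow_mul]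
      congr 1
      field_simp
  have h1 := (lintegral_rpow_sum_le_of_adapted μ hq hm hm0 N ha hb hab hY Ha).trans
    (mul_le_mul_right hold _)
  have h2 := (lintegral_rpow_sum_le_of_adapted μ hq hm hm0 N hb0 hb (fun _ _ => le_rfl) hY Hb).trans
    (mul_le_mul_right hold _)
  have hI2 : I ^ (1 / q) ≤ ENNReal.ofReal q * B * J ^ (1 / q) := by
    rcases eq_or_ne I 0 with h0 | h0
    · rw [h0, ENNReal.zero_rpow_of_pos (by positivity)]; exact zero_le
    have hsplit : I = I ^ (1 / q) * I ^ ((q - 1) / q) := by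
      rw [← ENNReal.rpow_add _ _ h0 hfin]
      have : 1 / q + (q - 1) / q = 1 := by field_simp; ring
      rw [this, ENNReal.rpow_one]
    have h3 : I ^ (1 / q) * I ^ ((q - 1) / q) ≤
        ENNReal.ofReal q * B * J ^ (1 / q) * I ^ ((q - 1) / q) := by
      rw [← hsplit, mul_assoc _ (J ^ (1 / q))]; exact h2
    have hne : I ^ ((q - 1) / q) ≠ 0 := by
      simp [ENNReal.rpow_eq_zero_iff, h0, hfin]
    have hne' : I ^ ((q - 1) / q) ≠ ⊤ := by
      apply ENNReal.rpow_ne_top_of_nonneg (by positivity) hfin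
    exact (ENNReal.mul_le_mul_iff_left hne hne').1 h3
  have hI3 : I ^ ((q - 1) / q) ≤ (ENNReal.ofReal q * B) ^ (q - 1) * J ^ ((q - 1) / q) := by
    have := ENNReal.rpow_le_rpow hI2 hq1.le
    rw [← ENNReal.rpow_mul, ENNReal.mul_rpow_of_nonneg _ _ hq1.le, ← ENNReal.rpow_mul] at this
    convert this using 2 <;> (congr 1; ring)
  refine h1.trans ?_
  calc _ ≤ ENNReal.ofReal q * A * (J ^ (1 / q) *
        ((ENNReal.ofReal q * B) ^ (q - 1) * J ^ ((q - 1) / q))) := by gcongr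
    _ = ENNReal.ofReal q * A * (ENNReal.ofReal q * B) ^ (q - 1) *
        (J ^ (1 / q) * J ^ ((q - 1) / q)) := by ring
    _ = _ := by
      rw [← ENNReal.rpow_add_of_nonneg _ _ (by positivity) (by positivity)]
      have : 1 / q + (q - 1) / q = 1 := by field_simp; ring
      rw [this, ENNReal.rpow_one]

/-! ### Normalized ball averages and a truncated dyadic maximal function -/

/-- The mass of `w` on the ball of radius `ρ`, divided by `ρ ^ n`. -/
def ballAvg {n : ℕ} (ρ : ℝ) (w : Rn n → ℝ≥0∞) (x : Rn n) : ℝ≥0∞ :=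
  ENNReal.ofReal (ρ ^ n)⁻¹ * ∫⁻ y in Metric.closedBall x ρ, w y

/-- The supremum of the averages over the radii `R * 2 ^ k`, `k ≤ N`. -/
def dyadicMax {n : ℕ} (R : ℝ) (N : ℤ) (w : Rn n → ℝ≥0∞) (x : Rn n) : ℝ≥0∞ :=
  ⨆ (k : ℤ) (_ : k ≤ N), ballAvg (R * 2 ^ k) w x

/-- The volume of the unit ball of `ℝⁿ`. -/
def unitVol (n : ℕ) : ℝ≥0∞ := volume (Metric.ball (0 : Rn n) 1)

lemma unitVol_ne_top (n : ℕ) : unitVol n ≠ ⊤ := measure_ball_lt_top.ne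

lemma volume_closedBall_Rn {n : ℕ} (x : Rn n) {ρ : ℝ} (hρ : 0 ≤ ρ) :
    volume (Metric.closedBall x ρ) = ENNReal.ofReal (ρ ^ n) * unitVol n := by
  rw [Measure.addHaar_closedBall _ _ hρ, finrank_euclideanSpace_fin, unitVol]

lemma setLIntegral_ball_eq {n : ℕ} {ρ : ℝ} (hρ : 0 < ρ) (w : Rn n → ℝ≥0∞) (x : Rn n) :
    ∫⁻ y in Metric.closedBall x ρ, w y = ENNReal.ofReal (ρ ^ n) * ballAvg ρ w x := by
  rw [ballAvg, ← mul_assoc, ← ENNReal.ofReal_mul (by positivity),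
    mul_inv_cancel₀ (by positivity), ENNReal.ofReal_one, one_mul]

lemma setLIntegral_ball_indicator {n : ℕ} (ρ : ℝ) (w : Rn n → ℝ≥0∞) (x : Rn n) :
    ∫⁻ y in Metric.closedBall x ρ, w y =
      ∫⁻ y, {p : Rn n × Rn n | dist p.2 p.1 ≤ ρ}.indicator (fun p => w p.2) (x, y) := by
  rw [← lintegral_indicator measurableSet_closedBall]
  rfl

lemma measurable_dist_indicator {n : ℕ} (ρ : ℝ) {w : Rn n → ℝ≥0∞} (hw : Measurable w) :
    Measurable ({p : Rn n × Rn n | dist p.2 p.1 ≤ ρ}.indicator fun p => w p.2) :=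
  (hw.comp measurable_snd).indicator
    (isClosed_le (by fun_prop) continuous_const).measurableSet

lemma measurable_ballAvg {n : ℕ} (ρ : ℝ) {w : Rn n → ℝ≥0∞} (hw : Measurable w) :
    Measurable (ballAvg ρ w) := by
  unfold ballAvg
  simp_rw [setLIntegral_ball_indicator]
  exact (measurable_dist_indicator ρ hw).lintegral_prod_right'.const_mul _

lemma lintegral_ballAvg {n : ℕ} {ρ : ℝ} (hρ : 0 < ρ) {w : Rn n → ℝ≥0∞} (hw : Measurable w) :
    ∫⁻ x, ballAvg ρ w x = unitVol n * ∫⁻ x, w x := by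
  unfold ballAvg
  simp_rw [setLIntegral_ball_indicator]
  rw [lintegral_const_mul' _ _ ENNReal.ofReal_ne_top,
    lintegral_lintegral_swap (f := fun x y =>
      {p : Rn n × Rn n | dist p.2 p.1 ≤ ρ}.indicator (fun p => w p.2) (x, y))
      (measurable_dist_indicator ρ hw).aemeasurable]
  have : ∀ y, ∫⁻ x, {p : Rn n × Rn n | dist p.2 p.1 ≤ ρ}.indicator (fun p => w p.2) (x, y) =
      w y * (ENNReal.ofReal (ρ ^ n) * unitVol n) := by
    intro y
    rw [← volume_closedBall_Rn y hρ.le, ← lintegral_indicator_const measurableSet_closedBall]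
    refine lintegral_congr fun x => ?_
    simp only [Set.indicator, Set.mem_ofPred_eq, Metric.mem_closedBall, dist_comm y x]
  simp_rw [this]
  rw [lintegral_mul_const _ hw, mul_comm (∫⁻ x, w x), ← mul_assoc, ← mul_assoc,
    ← ENNReal.ofReal_mul (by positivity), inv_mul_cancel₀ (by positivity), ENNReal.ofReal_one,
    one_mul]

lemma ballAvg_add {n : ℕ} (ρ : ℝ) {w w' : Rn n → ℝ≥0∞} (hw : Measurable w) (x : Rn n) :
    ballAvg ρ (fun y => w y + w' y) x = ballAvg ρ w x + ballAvg ρ w' x := by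
  rw [ballAvg, lintegral_add_left hw, mul_add]; rfl

lemma ballAvg_mono {n : ℕ} (ρ : ℝ) {w w' : Rn n → ℝ≥0∞} (h : ∀ x, w x ≤ w' x) (x : Rn n) :
    ballAvg ρ w x ≤ ballAvg ρ w' x := by
  unfold ballAvg
  gcongr with y
  exact h y

lemma ballAvg_const {n : ℕ} {ρ : ℝ} (hρ : 0 < ρ) (c : ℝ≥0∞) (x : Rn n) :
    ballAvg ρ (fun _ => c) x = unitVol n * c := by
  rw [ballAvg, lintegral_const, Measure.restrict_apply_univ, volume_closedBall_Rn x hρ.le,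
    mul_comm c, ← mul_assoc, ← mul_assoc,
    ← ENNReal.ofReal_mul (by positivity), inv_mul_cancel₀ (by positivity), ENNReal.ofReal_one,
    one_mul]

lemma measurable_dyadicMax {n : ℕ} (R : ℝ) (N : ℤ) {w : Rn n → ℝ≥0∞} (hw : Measurable w) :
    Measurable (dyadicMax R N w) :=
  Measurable.iSup fun _ => Measurable.iSup fun _ => measurable_ballAvg _ hw

lemma dyadicMax_le_const {n : ℕ} {R : ℝ} (hR : 0 < R) (N : ℤ) {w : Rn n → ℝ≥0∞} {c : ℝ≥0∞}
    (h : ∀ x, w x ≤ c) (x : Rn n) : dyadicMax R N w x ≤ unitVol n * c := by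
  refine iSup₂_le fun k _ => ?_
  rw [← ballAvg_const (n := n) (show 0 < R * 2 ^ k by positivity) c x]
  exact ballAvg_mono _ h x

lemma volume_lt_dyadicMax_le {n : ℕ} {R : ℝ} (hR : 0 < R) (N : ℤ) {w : Rn n → ℝ≥0∞} {α : ℝ≥0∞}
    (hα : α ≠ 0) (hα' : α ≠ ⊤) :
    volume {x | α < dyadicMax R N w x} ≤
      ENNReal.ofReal (5 ^ n) * unitVol n * α⁻¹ * ∫⁻ x, w x := by
  set S : Set (Rn n) := {x | α < dyadicMax R N w x}
  have h1 : ∀ x : Rn n, ∃ k : ℤ, x ∈ S → k ≤ N ∧ α < ballAvg (R * 2 ^ k) w x := by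
    intro x
    by_cases hx : x ∈ S
    · simp only [S, mem_ofPred_eq, dyadicMax, lt_iSup_iff] at hx
      obtain ⟨k, hk, h⟩ := hx
      exact ⟨k, fun _ => ⟨hk, h⟩⟩
    · exact ⟨0, fun h => absurd h hx⟩
  choose k hk using h1
  have hpos : ∀ x, 0 < R * (2 : ℝ) ^ k x := fun x => by positivity
  obtain ⟨u, huS, hdisj, hcov⟩ := Vitali.exists_disjoint_subfamily_covering_enlargement_closedBall
    S (fun x : Rn n => x) (fun x => R * 2 ^ k x) (R * 2 ^ N) (fun x hx => by
      have := (hk x hx).1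
      gcongr; norm_num) 5 (by norm_num)
  have hcount : u.Countable := by
    refine hdisj.countable_of_nonempty_interior fun x _ => ?_
    rw [interior_closedBall _ (hpos x).ne']
    exact ⟨x, Metric.mem_ball_self (hpos x)⟩
  have hsub : S ⊆ ⋃ x ∈ u, Metric.closedBall x (5 * (R * 2 ^ k x)) := by
    intro x hx
    obtain ⟨b, hb, h⟩ := hcov x hx
    exact mem_biUnion hb (h (Metric.mem_closedBall_self (hpos x).le))
  have : Countable u := hcount.to_subtype
  calc volume S ≤ volume (⋃ x ∈ u, Metric.closedBall x (5 * (R * 2 ^ k x))) := measure_mono hsub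
    _ ≤ ∑' x : u, volume (Metric.closedBall (x : Rn n) (5 * (R * 2 ^ k x))) :=
        measure_biUnion_le _ hcount _
    _ ≤ ∑' x : u, ENNReal.ofReal (5 ^ n) * unitVol n * α⁻¹ *
          ∫⁻ y in Metric.closedBall (x : Rn n) (R * 2 ^ k x), w y := by
        refine ENNReal.tsum_le_tsum fun x => ?_
        rw [volume_closedBall_Rn _ (by have := hpos x; positivity), mul_pow,
          ENNReal.ofReal_mul (by positivity), setLIntegral_ball_eq (hpos x)]
        have h3 := (hk x (huS x.2)).2.le
        have h4 : 1 ≤ α⁻¹ * ballAvg (R * 2 ^ k x) w x := by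
          rw [← ENNReal.inv_mul_cancel hα hα']; gcongr
        calc _ = ENNReal.ofReal (5 ^ n) * unitVol n * ENNReal.ofReal ((R * 2 ^ k x) ^ n) * 1 := by
              ring
          _ ≤ ENNReal.ofReal (5 ^ n) * unitVol n * ENNReal.ofReal ((R * 2 ^ k x) ^ n) *
              (α⁻¹ * ballAvg (R * 2 ^ k x) w x) := by gcongr
          _ = _ := by ring
    _ = ENNReal.ofReal (5 ^ n) * unitVol n * α⁻¹ *
          ∫⁻ y in ⋃ x ∈ u, Metric.closedBall x (R * 2 ^ k x), w y := by
        rw [ENNReal.tsum_mul_left, lintegral_biUnion hcount (fun _ _ => measurableSet_closedBall)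
          hdisj]
    _ ≤ _ := by
        gcongr
        exact Measure.restrict_le_self

/-- `L^q` boundedness of the dyadic maximal function, for bounded `w`. -/
lemma exists_lintegral_dyadicMax_rpow_le (n : ℕ) {q : ℝ} (hq : 1 < q) :
    ∃ C : ℝ≥0∞, C ≠ ⊤ ∧ ∀ (R : ℝ) (_ : 0 < R) (N : ℤ) (w : Rn n → ℝ≥0∞), Measurable w →
      (∃ c : ℝ≥0∞, c ≠ ⊤ ∧ ∀ x, w x ≤ c) →
      ∫⁻ x, dyadicMax R N w x ^ q ≤ C * ∫⁻ x, w x ^ q := by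
  have hq0 : 0 < q := by linarith
  have hq1 : 0 < q - 1 := by linarith
  set v : ℝ := (unitVol n).toReal with hv
  have hv0 : 0 < v := ENNReal.toReal_pos (Metric.measure_ball_pos _ _ one_pos).ne'
    (unitVol_ne_top n)
  have hvE : unitVol n = ENNReal.ofReal v := (ENNReal.ofReal_toReal (unitVol_ne_top n)).symm
  set C₁ : ℝ≥0∞ := ENNReal.ofReal (5 ^ n) * unitVol n * 2 with hC₁
  have hC₁t : C₁ ≠ ⊤ := by
    simp [hC₁, ENNReal.mul_eq_top, unitVol_ne_top]
  refine ⟨ENNReal.ofReal q * C₁ * (ENNReal.ofReal (q - 1))⁻¹ * ENNReal.ofReal ((2 * v) ^ (q - 1)),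
    ?_, ?_⟩
  · refine ENNReal.mul_ne_top (ENNReal.mul_ne_top (ENNReal.mul_ne_top ENNReal.ofReal_ne_top hC₁t)
      ?_) ENNReal.ofReal_ne_top
    simp [hq]
  intro R hR N w hw ⟨c, hc, hwc⟩
  have hMt : ∀ x, dyadicMax R N w x ≠ ⊤ := fun x =>
    ((dyadicMax_le_const hR N hwc x).trans_lt
      (ENNReal.mul_lt_top (unitVol_ne_top n).lt_top hc.lt_top)).ne
  have hwt : ∀ x, w x ≠ ⊤ := fun x => ((hwc x).trans_lt hc.lt_top).ne
  have hMm := measurable_dyadicMax R N hw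
  have key : ∀ t : ℝ, 0 < t → volume {x | t < (dyadicMax R N w x).toReal} ≤
      C₁ * ENNReal.ofReal t⁻¹ * (volume.withDensity w) {x | t < 2 * v * (w x).toReal} := by
    intro t ht
    set A : Set (Rn n) := {x | t < 2 * v * (w x).toReal} with hA
    have hAm : MeasurableSet A :=
      measurableSet_lt measurable_const (hw.ennreal_toReal.const_mul _)
    have hle : ∀ x, w x ≤ A.indicator w x + ENNReal.ofReal (t / (2 * v)) := by
      intro x
      by_cases hx : x ∈ A
      · rw [indicator_of_mem hx]; exact le_self_add
      · rw [indicator_of_notMem hx, zero_add]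
        rw [ENNReal.le_ofReal_iff_toReal_le (hwt x) (by positivity), le_div_iff₀ (by positivity)]
        have : ¬ t < 2 * v * (w x).toReal := hx
        linarith
    have hsub : {x | t < (dyadicMax R N w x).toReal} ⊆
        {x | ENNReal.ofReal (t / 2) < dyadicMax R N (A.indicator w) x} := by
      intro x hx
      simp only [mem_ofPred_eq] at hx ⊢
      have h1 : dyadicMax R N w x ≤ dyadicMax R N (A.indicator w) x + ENNReal.ofReal (t / 2) := by
        refine iSup₂_le fun k hk => ?_
        refine (ballAvg_mono _ hle x).trans ?_
        rw [ballAvg_add _ (hw.indicator hAm), ballAvg_const (by positivity), hvE,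
          ← ENNReal.ofReal_mul hv0.le, show v * (t / (2 * v)) = t / 2 by field_simp]
        gcongr
        exact le_iSup₂ (f := fun (k : ℤ) (_ : k ≤ N) => ballAvg (R * 2 ^ k) (A.indicator w) x) k hk
      rw [← ENNReal.ofReal_lt_iff_lt_toReal ht.le (hMt x)] at hx
      by_contra hcon
      rw [not_lt] at hcon
      have h2 := hx.trans_le (h1.trans (add_le_add_left hcon _))
      rw [← ENNReal.ofReal_add (by positivity) (by positivity), add_halves] at h2
      exact lt_irrefl _ h2
    refine (measure_mono hsub).trans ((volume_lt_dyadicMax_le hR N (by simpa using ht)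
      ENNReal.ofReal_ne_top).trans (le_of_eq ?_))
    rw [lintegral_indicator hAm, withDensity_apply _ hAm, ← ENNReal.ofReal_inv_of_pos (by positivity),
      hC₁, show (t / 2)⁻¹ = 2 * t⁻¹ by field_simp, ENNReal.ofReal_mul (by norm_num)]
    simp only [ENNReal.ofReal_ofNat]
    ring
  have lhs : ∫⁻ x, dyadicMax R N w x ^ q =
      ENNReal.ofReal q * ∫⁻ t in Ioi (0 : ℝ), volume {x | t < (dyadicMax R N w x).toReal} *
        ENNReal.ofReal (t ^ (q - 1)) := by
    rw [← lintegral_rpow_eq_lintegral_meas_lt_mul volume (ae_of_all _ fun _ =>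
      ENNReal.toReal_nonneg) hMm.ennreal_toReal.aemeasurable hq0]
    refine lintegral_congr fun x => ?_
    rw [← ENNReal.ofReal_rpow_of_nonneg ENNReal.toReal_nonneg hq0.le, ENNReal.ofReal_toReal (hMt x)]
  have rhs : ENNReal.ofReal ((2 * v) ^ (q - 1)) * ∫⁻ x, w x ^ q =
      ENNReal.ofReal (q - 1) * ∫⁻ t in Ioi (0 : ℝ),
        (volume.withDensity w) {x | t < 2 * v * (w x).toReal} *
        ENNReal.ofReal (t ^ (q - 1 - 1)) := by
    rw [← lintegral_rpow_eq_lintegral_meas_lt_mul (volume.withDensity w) (ae_of_all _ fun _ =>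
      mul_nonneg (by positivity) ENNReal.toReal_nonneg)
      (hw.ennreal_toReal.const_mul _).aemeasurable hq1,
      lintegral_withDensity_eq_lintegral_mul _ hw
        (((hw.ennreal_toReal.const_mul _).pow_const _).ennreal_ofReal),
      ← lintegral_const_mul' _ _ ENNReal.ofReal_ne_top]
    refine lintegral_congr fun x => ?_
    have h1 : ENNReal.ofReal ((w x).toReal ^ (q - 1)) = w x ^ (q - 1) := by
      rw [← ENNReal.ofReal_rpow_of_nonneg ENNReal.toReal_nonneg hq1.le,
        ENNReal.ofReal_toReal (hwt x)]
    rw [Pi.mul_apply, Real.mul_rpow (x := 2 * v) (by positivity) ENNReal.toReal_nonneg,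
      ENNReal.ofReal_mul (p := (2 * v) ^ (q - 1)) (by positivity), h1]
    have : w x ^ q = w x * w x ^ (q - 1) := by
      conv_lhs => rw [show q = 1 + (q - 1) by ring]
      rw [ENNReal.rpow_add_of_nonneg _ _ (by norm_num) hq1.le, ENNReal.rpow_one]
    rw [this]; ring
  calc ∫⁻ x, dyadicMax R N w x ^ q
      ≤ ENNReal.ofReal q * ∫⁻ t in Ioi (0 : ℝ), C₁ * ((volume.withDensity w)
          {x | t < 2 * v * (w x).toReal} * ENNReal.ofReal (t ^ (q - 1 - 1))) := by
        rw [lhs]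
        refine mul_le_mul_right ?_ _
        refine setLIntegral_mono' measurableSet_Ioi fun t ht => ?_
        have ht : 0 < t := ht
        refine (mul_le_mul_left (key t ht) _).trans (le_of_eq ?_)
        rw [show t ^ (q - 1 - 1) = t⁻¹ * t ^ (q - 1) by
          rw [Real.rpow_sub_one ht.ne']; field_simp, ENNReal.ofReal_mul (by positivity)]
        ring
    _ = ENNReal.ofReal q * C₁ * (ENNReal.ofReal (q - 1))⁻¹ * (ENNReal.ofReal (q - 1) *
        ∫⁻ t in Ioi (0 : ℝ), (volume.withDensity w)
          {x | t < 2 * v * (w x).toReal} * ENNReal.ofReal (t ^ (q - 1 - 1))) := by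
        rw [lintegral_const_mul' _ _ hC₁t]
        generalize C₁ = C₁'
        rw [mul_assoc _ _ (_ * _), ← mul_assoc _⁻¹, ENNReal.inv_mul_cancel (by simpa using hq)
          ENNReal.ofReal_ne_top, one_mul, mul_assoc]
    _ = _ := by rw [← rhs]; ring

/-! ### Dyadic cells -/

/-- The index of the dyadic cube of side `2 ^ K` containing `x`. -/
def cell {n : ℕ} (K : ℤ) (x : Rn n) : Fin n → ℤ := fun i => ⌊x i / 2 ^ K⌋

lemma measurable_cell {n : ℕ} (K : ℤ) : Measurable (cell (n := n) K) := by
  refine measurable_pi_lambda _ fun i => Int.measurable_floor.comp ?_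
  fun_prop

lemma cell_eq_of_le {n : ℕ} {K K' : ℤ} (h : K ≤ K') (x : Rn n) :
    cell K' x = fun i => cell K x i / ((2 ^ (K' - K).toNat : ℕ) : ℤ) := by
  funext i
  simp only [cell]
  rw [← Int.floor_div_natCast]
  congr 1
  have : ((2 ^ (K' - K).toNat : ℕ) : ℝ) = 2 ^ (K' - K) := by
    push_cast
    rw [← zpow_natCast, Int.toNat_of_nonneg (by omega)]
  rw [this, div_div, ← zpow_add₀ (by norm_num)]
  congr 2; ring

lemma comap_cell_le {n : ℕ} {K K' : ℤ} (h : K ≤ K') :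
    MeasurableSpace.comap (cell (n := n) K') inferInstance ≤
      MeasurableSpace.comap (cell (n := n) K) inferInstance := by
  have : cell (n := n) K' =
      (fun z i => z i / ((2 ^ (K' - K).toNat : ℕ) : ℤ)) ∘ cell K := funext fun x => cell_eq_of_le h x
  rw [this, ← MeasurableSpace.comap_comp]
  exact MeasurableSpace.comap_mono (measurable_iff_comap_le.1 (measurable_of_countable _))

lemma dist_le_of_cell_eq {n : ℕ} {K : ℤ} {x y : Rn n} (h : cell K x = cell K y) :
    dist x y ≤ n * 2 ^ K := by
  have h1 : ∀ i, |x i - y i| ≤ 2 ^ K := by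
    intro i
    have h2 : ⌊x i / 2 ^ K⌋ = ⌊y i / 2 ^ K⌋ := congrFun h i
    have h3 := Int.abs_sub_lt_one_of_floor_eq_floor h2
    rw [← sub_div, abs_div, abs_of_pos (show (0 : ℝ) < 2 ^ K by positivity),
      div_lt_one (by positivity)] at h3
    exact h3.le
  rw [EuclideanSpace.dist_eq]
  refine Real.sqrt_le_iff.2 ⟨by positivity, ?_⟩
  calc ∑ i, dist (x i) (y i) ^ 2 ≤ ∑ _i : Fin n, ((2 : ℝ) ^ K) ^ 2 := by
        gcongr with i
        rw [Real.dist_eq]; exact h1 i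
    _ = n * ((2 : ℝ) ^ K) ^ 2 := by simp
    _ ≤ (n * 2 ^ K) ^ 2 := by
        rw [mul_pow]
        gcongr
        exact_mod_cast Nat.le_self_pow (by norm_num) n

lemma volume_cell_eq {n : ℕ} (K : ℤ) (x : Rn n) :
    volume {y : Rn n | cell K y = cell K x} = ENNReal.ofReal ((2 ^ K) ^ n) := by
  have h2 : (0 : ℝ) < 2 ^ K := by positivity
  have : {y : Rn n | cell K y = cell K x} = (@WithLp.ofLp 2 (Fin n → ℝ)) ⁻¹'
      (Set.pi univ fun i => Ico ((cell K x i : ℝ) * 2 ^ K) ((cell K x i : ℝ) * 2 ^ K + 2 ^ K)) := by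
    ext y
    simp only [mem_ofPred_eq, mem_preimage, Set.mem_pi, mem_univ, true_imp_iff, mem_Ico]
    rw [funext_iff]
    refine forall_congr' fun i => ?_
    simp only [cell]
    rw [Int.floor_eq_iff, le_div_iff₀ h2, div_lt_iff₀ h2, add_mul, one_mul]
  rw [this, (PiLp.volume_preserving_ofLp (Fin n)).measure_preimage
    (MeasurableSet.univ_pi fun _ => measurableSet_Ico).nullMeasurableSet, Real.volume_pi_Ico]
  simp [ENNReal.ofReal_pow h2.le]

/-- A function measurable with respect to the cells integrates `F` like `Y`, provided that the mass
of `F` on each cell is dominated by the values of `Y` on this cell. -/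
lemma lintegral_mul_le_of_cell {n : ℕ} (K : ℤ) {D F Y : Rn n → ℝ≥0∞} {A : ℝ≥0∞} (hA : A ≠ ⊤)
    (hD : Measurable[MeasurableSpace.comap (cell (n := n) K) inferInstance] D)
    (hF : Measurable F)
    (h : ∀ y, ∫⁻ x in {x | cell K x = cell K y}, F x ≤ A * ENNReal.ofReal ((2 ^ K) ^ n) * Y y) :
    ∫⁻ x, D x * F x ≤ A * ∫⁻ x, D x * Y x := by
  obtain ⟨g, hg, rfl⟩ := hD.exists_eq_measurable_comp
  have hcm := measurable_cell (n := n) K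
  have hDm : Measurable (g ∘ cell (n := n) K) := hg.comp hcm
  set V : ℝ≥0∞ := ENNReal.ofReal ((2 ^ K) ^ n) with hV
  have hV0 : V ≠ 0 := by
    rw [hV, Ne, ENNReal.ofReal_eq_zero, not_le]; positivity
  have hVt : V ≠ ⊤ := ENNReal.ofReal_ne_top
  have hS : MeasurableSet {p : Rn n × Rn n | cell K p.1 = cell K p.2} :=
    measurableSet_eq_fun (hcm.comp measurable_fst) (hcm.comp measurable_snd)
  have hSy : ∀ y, MeasurableSet {x : Rn n | cell K x = cell K y} := fun y =>
    measurableSet_eq_fun hcm measurable_const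
  have h1 : V * ∫⁻ x, (g ∘ cell K) x * F x =
      ∫⁻ x, ∫⁻ y, {p : Rn n × Rn n | cell K p.1 = cell K p.2}.indicator
        (fun p => (g ∘ cell K) p.2 * F p.1) (x, y) := by
    rw [← lintegral_const_mul' _ _ hVt]
    refine lintegral_congr fun x => ?_
    have : ∀ y, {p : Rn n × Rn n | cell K p.1 = cell K p.2}.indicator
        (fun p => (g ∘ cell K) p.2 * F p.1) (x, y) =
        {y | cell K y = cell K x}.indicator (fun _ => (g ∘ cell K) x * F x) y := by
      intro y
      simp only [indicator, mem_ofPred_eq, Function.comp_apply]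
      by_cases hxy : cell K x = cell K y
      · simp [hxy]
      · rw [if_neg hxy, if_neg (fun h => hxy h.symm)]
    simp_rw [this]
    rw [lintegral_indicator_const (hSy x), volume_cell_eq, mul_comm]
  have h2 : V * ∫⁻ x, (g ∘ cell K) x * F x ≤ V * (A * ∫⁻ x, (g ∘ cell K) x * Y x) := by
    rw [h1, lintegral_lintegral_swap (f := fun x y =>
      {p : Rn n × Rn n | cell K p.1 = cell K p.2}.indicator
        (fun p => (g ∘ cell K) p.2 * F p.1) (x, y)) (Measurable.aemeasurable (Measurable.indicator
        ((hDm.comp measurable_snd).mul (hF.comp measurable_fst)) hS)),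
      ← lintegral_const_mul' _ _ hA, ← lintegral_const_mul' _ _ hVt]
    refine lintegral_mono fun y => ?_
    have : ∀ x, {p : Rn n × Rn n | cell K p.1 = cell K p.2}.indicator
        (fun p => (g ∘ cell K) p.2 * F p.1) (x, y) =
        (g ∘ cell K) y * {x | cell K x = cell K y}.indicator F x := by
      intro x
      simp only [indicator, mem_ofPred_eq, Function.comp_apply]
      split_ifs <;> simp
    simp_rw [this]
    rw [lintegral_const_mul _ (hF.indicator (hSy y)), lintegral_indicator (hSy y)]
    calc _ ≤ (g ∘ cell K) y * (A * V * Y y) := by gcongr; exact h y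
      _ = _ := by ring
  exact (ENNReal.mul_le_mul_iff_right hV0 hVt).1 h2

/-! ### Plancherel on `L¹ ∩ L²` and convolutions -/

section Plancherel

variable {V : Type*} [NormedAddCommGroup V] [InnerProductSpace ℝ V] [FiniteDimensional ℝ V]
  [MeasurableSpace V] [BorelSpace V]

lemma continuous_fourier_of_integrable {h : V → ℂ} (h1 : Integrable h) : Continuous (𝓕 h) :=
  VectorFourier.fourierIntegral_continuous Real.continuous_fourierChar
    (by exact continuous_inner) h1

lemma fourier_toLp_ae_eq {h : V → ℂ} (h1 : Integrable h) (h2 : MemLp h 2) :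
    ((𝓕 (h2.toLp h) : Lp (α := V) ℂ 2 volume) : V → ℂ) =ᵐ[volume] 𝓕 h := by
  have hc : Continuous (𝓕 h) := continuous_fourier_of_integrable h1
  refine ae_eq_of_integral_contDiff_smul_eq
    ((Lp.memLp (𝓕 (h2.toLp h) : Lp (α := V) ℂ 2 volume)).locallyIntegrable (by norm_num))
    (hc.locallyIntegrable (μ := volume)) ?_
  intro g hg hgc
  set φ : SchwartzMap V ℂ := (hgc.comp_left (g := Complex.ofReal) rfl).toSchwartzMap
    (Complex.ofRealCLM.contDiff.comp hg) with hφ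
  have hφa : ∀ x, φ x = (g x : ℂ) := fun x => rfl
  have e1 : ∫ x, φ x • ((𝓕 (h2.toLp h) : Lp (α := V) ℂ 2 volume) : V → ℂ) x =
      ∫ x, (𝓕 φ) x • ((h2.toLp h : Lp (α := V) ℂ 2 volume) : V → ℂ) x := by
    have := congrArg (fun T => T φ) (Lp.fourier_toTemperedDistribution_eq (h2.toLp h))
    simp only [TemperedDistribution.fourier_apply, Lp.toTemperedDistribution_apply] at this
    exact this.symm
  have e2 : ∫ x, (𝓕 φ) x • ((h2.toLp h : Lp (α := V) ℂ 2 volume) : V → ℂ) x = ∫ x, 𝓕 (φ : V → ℂ) x * h x := by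
    refine integral_congr_ae ?_
    filter_upwards [h2.coeFn_toLp] with x hx
    rw [hx, SchwartzMap.fourier_coe, smul_eq_mul]
  have e3 : ∫ x, 𝓕 (φ : V → ℂ) x * h x = ∫ x, φ x * 𝓕 h x := by
    have := VectorFourier.integral_bilin_fourierIntegral_eq_flip (μ := (volume : Measure V))
      (ν := (volume : Measure V)) (L := innerₗ V) (ContinuousLinearMap.mul ℂ ℂ)
      Real.continuous_fourierChar (by exact continuous_inner) φ.integrable h1
    rw [flip_innerₗ] at this
    exact this
  have e4 := e1.trans (e2.trans e3)
  simp only [hφa] at e4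
  simpa only [Complex.real_smul, smul_eq_mul] using e4

/-- Plancherel's theorem on `L¹ ∩ L²`. -/
lemma lintegral_enorm_fourier_sq {h : V → ℂ} (h1 : Integrable h) (h2 : MemLp h 2) :
    ∫⁻ ξ, ‖𝓕 h ξ‖ₑ ^ 2 = ∫⁻ x, ‖h x‖ₑ ^ 2 := by
  have key : ∀ f : V → ℂ, ∫⁻ x, ‖f x‖ₑ ^ 2 = eLpNorm f 2 volume ^ 2 := by
    intro f
    rw [eLpNorm_eq_lintegral_rpow_enorm_toReal (by norm_num) (by norm_num)]
    simp only [ENNReal.toReal_ofNat, ENNReal.rpow_ofNat]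
    rw [← ENNReal.rpow_ofNat, ← ENNReal.rpow_mul]
    norm_num
  have e := Lp.norm_fourier_eq (h2.toLp h)
  rw [Lp.norm_def, Lp.norm_def, eLpNorm_congr_ae (fourier_toLp_ae_eq h1 h2),
    eLpNorm_congr_ae h2.coeFn_toLp] at e
  have hfin : eLpNorm (𝓕 h) 2 volume ≠ ⊤ := by
    rw [← eLpNorm_congr_ae (fourier_toLp_ae_eq h1 h2)]; exact Lp.eLpNorm_ne_top _
  rw [key, key, (ENNReal.toReal_eq_toReal_iff' hfin h2.eLpNorm_ne_top).1 e]

lemma lintegral_enorm_fourierInv_sq {h : V → ℂ} (h1 : Integrable h) (h2 : MemLp h 2) :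
    ∫⁻ ξ, ‖𝓕⁻ h ξ‖ₑ ^ 2 = ∫⁻ x, ‖h x‖ₑ ^ 2 := by
  rw [← lintegral_enorm_fourier_sq h1 h2, ← lintegral_neg_eq_self]
  refine lintegral_congr fun x => ?_
  rw [Real.fourierInv_eq_fourier_neg, neg_neg]

end Plancherel

/-- The convolution `f * κ`. -/
def cv {n : ℕ} (f κ : Rn n → ℂ) (x : Rn n) : ℂ := ∫ t, f (x - t) * κ t

/-- Bounded measurable integrable functions. -/
structure BddInt {n : ℕ} (f : Rn n → ℂ) : Prop where
  meas : Measurable f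
  bdd : ∃ C : ℝ, ∀ x, ‖f x‖ ≤ C
  int : Integrable f

lemma cv_eq_convolution {n : ℕ} (f κ : Rn n → ℂ) :
    cv f κ = convolution κ f (ContinuousLinearMap.mul ℂ ℂ) volume := by
  funext x
  simp only [cv, convolution, ContinuousLinearMap.mul_apply']
  exact integral_congr_ae (ae_of_all _ fun t => mul_comm _ _)

lemma BddInt.memLp_two {n : ℕ} {f : Rn n → ℂ} (hf : BddInt f) : MemLp f 2 := by
  obtain ⟨C, hC⟩ := hf.bdd
  rw [memLp_two_iff_integrable_sq_norm hf.meas.aestronglyMeasurable]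
  simp_rw [sq]
  exact hf.int.norm.bdd_mul (c := C) hf.meas.norm.aestronglyMeasurable
    (ae_of_all _ fun x => by rw [norm_norm]; exact hC x)

lemma BddInt.sub {n : ℕ} {f g : Rn n → ℂ} (hf : BddInt f) (hg : BddInt g) :
    BddInt fun x => f x - g x := by
  obtain ⟨C, hC⟩ := hf.bdd
  obtain ⟨C', hC'⟩ := hg.bdd
  exact ⟨hf.meas.sub hg.meas, ⟨C + C', fun x => (norm_sub_le _ _).trans (add_le_add (hC x) (hC' x))⟩,
    hf.int.sub hg.int⟩

lemma BddInt.add {n : ℕ} {f g : Rn n → ℂ} (hf : BddInt f) (hg : BddInt g) :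
    BddInt fun x => f x + g x := by
  obtain ⟨C, hC⟩ := hf.bdd
  obtain ⟨C', hC'⟩ := hg.bdd
  exact ⟨hf.meas.add hg.meas, ⟨C + C', fun x => (norm_add_le _ _).trans (add_le_add (hC x) (hC' x))⟩,
    hf.int.add hg.int⟩

lemma BddInt.indicator {n : ℕ} {f : Rn n → ℂ} (hf : BddInt f) {S : Set (Rn n)}
    (hS : MeasurableSet S) : BddInt (S.indicator f) := by
  obtain ⟨C, hC⟩ := hf.bdd
  exact ⟨hf.meas.indicator hS, ⟨C, fun x => (norm_indicator_le_norm_self f x).trans (hC x)⟩,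
    hf.int.indicator hS⟩

lemma measurable_cv {n : ℕ} {f κ : Rn n → ℂ} (hf : Measurable f) (hκ : Measurable κ) :
    Measurable (cv f κ) := by
  have : Measurable (Function.uncurry fun (x t : Rn n) => f (x - t) * κ t) :=
    (hf.comp (measurable_fst.sub measurable_snd)).mul (hκ.comp measurable_snd)
  exact (this.stronglyMeasurable.integral_prod_right).measurable

lemma norm_cv_le {n : ℕ} {f κ : Rn n → ℂ} {C : ℝ} (hC : ∀ x, ‖f x‖ ≤ C) (hκ : Integrable κ)
    (x : Rn n) : ‖cv f κ x‖ ≤ C * ∫ t, ‖κ t‖ := by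
  unfold cv
  rw [← integral_const_mul]
  refine norm_integral_le_of_norm_le (hκ.norm.const_mul C) (ae_of_all _ fun t => ?_)
  rw [norm_mul]
  exact mul_le_mul_of_nonneg_right (hC _) (norm_nonneg _)

lemma BddInt.cv {n : ℕ} {f κ : Rn n → ℂ} (hf : BddInt f) (hκ : BddInt κ) : BddInt (cv f κ) := by
  obtain ⟨C, hC⟩ := hf.bdd
  refine ⟨measurable_cv hf.meas hκ.meas, ⟨_, fun x => norm_cv_le hC hκ.int x⟩, ?_⟩
  rw [cv_eq_convolution]
  exact hκ.int.integrable_convolution _ hf.int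

lemma BddInt.comp_sub_mul {n : ℕ} {f κ : Rn n → ℂ} (hf : BddInt f) (hκ : Integrable κ)
    (x : Rn n) : Integrable fun t => f (x - t) * κ t := by
  obtain ⟨C, hC⟩ := hf.bdd
  exact hκ.bdd_mul (c := C) (hf.meas.comp (measurable_const.sub measurable_id)).aestronglyMeasurable
    (ae_of_all _ fun t => hC _)

lemma fourier_cv {n : ℕ} {f κ : Rn n → ℂ} (hf : Integrable f) (hκ : Integrable κ) (ξ : Rn n) :
    𝓕 (cv f κ) ξ = 𝓕 κ ξ * 𝓕 f ξ := by
  rw [cv_eq_convolution, Real.fourier_mul_convolution_eq hκ hf]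

lemma lintegral_enorm_cv_sq {n : ℕ} {f κ : Rn n → ℂ} (hf : BddInt f) (hκ : BddInt κ) :
    ∫⁻ x, ‖cv f κ x‖ₑ ^ 2 = ∫⁻ ξ, ‖𝓕 κ ξ‖ₑ ^ 2 * ‖𝓕 f ξ‖ₑ ^ 2 := by
  rw [← lintegral_enorm_fourier_sq (hf.cv hκ).int (hf.cv hκ).memLp_two]
  refine lintegral_congr fun ξ => ?_
  rw [fourier_cv hf.int hκ.int, enorm_mul, mul_pow]

/-- If `κ` is supported in a ball, `f * κ` only depends on nearby values of `f`. -/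
lemma cv_congr_of_support {n : ℕ} {f g κ : Rn n → ℂ} {ρ : ℝ} (hκ : ∀ t, ρ < ‖t‖ → κ t = 0)
    {x : Rn n} (h : ∀ y, dist y x ≤ ρ → f y = g y) : cv f κ x = cv g κ x := by
  unfold cv
  congr 1
  funext t
  rcases lt_or_ge ρ ‖t‖ with ht | ht
  · simp [hκ t ht]
  · rw [h (x - t) (by simpa [dist_eq_norm] using ht)]

/-- A Cauchy-Schwarz bound: convolution with a bounded compactly supported kernel is controlled by
a square average. -/
lemma enorm_cv_sq_le_ballAvg_aux {n : ℕ} {f κ : Rn n → ℂ} {ρ : ℝ} {B : ℝ≥0∞}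
    (hf : Measurable f) (hB : ∀ t, ‖κ t‖ₑ ≤ B) (hκ : ∀ t, ρ < ‖t‖ → κ t = 0) (x : Rn n) :
    ‖cv f κ x‖ₑ ^ 2 ≤ B ^ 2 * volume (Metric.closedBall x ρ) *
      ∫⁻ y in Metric.closedBall x ρ, ‖f y‖ₑ ^ 2 := by
  have h1 : ‖cv f κ x‖ₑ ≤ B * ∫⁻ y in Metric.closedBall x ρ, ‖f y‖ₑ := by
    have hm : Measurable ((Metric.closedBall x ρ).indicator fun y => ‖f y‖ₑ) :=
      hf.enorm.indicator measurableSet_closedBall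
    calc ‖cv f κ x‖ₑ ≤ ∫⁻ t, ‖f (x - t) * κ t‖ₑ := enorm_integral_le_lintegral_enorm _
      _ ≤ ∫⁻ t, B * (Metric.closedBall x ρ).indicator (fun y => ‖f y‖ₑ) (x - t) := by
          refine lintegral_mono fun t => ?_
          rw [enorm_mul, mul_comm]
          rcases lt_or_ge ρ ‖t‖ with ht | ht
          · simp [hκ t ht]
          · rw [indicator_of_mem (by simpa [dist_eq_norm] using ht)]
            gcongr
            exact hB t
      _ = ∫⁻ y, B * (Metric.closedBall x ρ).indicator (fun y => ‖f y‖ₑ) y :=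
          lintegral_sub_left_eq_self
            (fun y => B * (Metric.closedBall x ρ).indicator (fun y => ‖f y‖ₑ) y) x
      _ = _ := by rw [lintegral_const_mul _ hm, lintegral_indicator measurableSet_closedBall]
  have h2 : (∫⁻ y in Metric.closedBall x ρ, ‖f y‖ₑ) ^ 2 ≤
      volume (Metric.closedBall x ρ) * ∫⁻ y in Metric.closedBall x ρ, ‖f y‖ₑ ^ 2 := by
    have := ENNReal.lintegral_mul_le_Lp_mul_Lq (volume.restrict (Metric.closedBall x ρ))
      Real.HolderConjugate.two_two (f := fun _ => 1) (g := fun y => ‖f y‖ₑ) aemeasurable_const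
      hf.enorm.aemeasurable
    simp only [Pi.mul_apply, one_mul, lintegral_const,
      Measure.restrict_apply_univ, ENNReal.rpow_ofNat] at this
    refine (pow_le_pow_left' this 2).trans (le_of_eq ?_)
    have h3 : ∀ z : ℝ≥0∞, (z ^ (1 / 2 : ℝ)) ^ 2 = z := by
      intro z
      rw [← ENNReal.rpow_ofNat, ← ENNReal.rpow_mul]
      norm_num
    rw [mul_pow, h3, h3, one_pow, one_mul]
  calc ‖cv f κ x‖ₑ ^ 2 ≤ (B * ∫⁻ y in Metric.closedBall x ρ, ‖f y‖ₑ) ^ 2 := by gcongr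
    _ = B ^ 2 * (∫⁻ y in Metric.closedBall x ρ, ‖f y‖ₑ) ^ 2 := mul_pow _ _ _
    _ ≤ _ := by rw [mul_assoc]; gcongr

/-! ### Dilations, bump functions and a Littlewood–Paley decomposition -/

/-- The `L¹`-normalized dilation of `h` to scale `s`. -/
def dil {n : ℕ} (s : ℝ) (h : Rn n → ℂ) (t : Rn n) : ℂ := ((s ^ n)⁻¹ : ℝ) * h (s⁻¹ • t)

lemma integral_comp_inv_smul {n : ℕ} {s : ℝ} (hs : 0 < s) (F : Rn n → ℂ) :
    ∫ t, F (s⁻¹ • t) = (s ^ n : ℝ) * ∫ t, F t := by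
  have := Measure.integral_comp_inv_smul_of_nonneg (volume : Measure (Rn n)) F hs.le
  rw [this, finrank_euclideanSpace_fin, Complex.real_smul]

lemma BddInt.dil {n : ℕ} {h : Rn n → ℂ} (hh : BddInt h) {s : ℝ} (hs : 0 < s) :
    BddInt (dil s h) := by
  obtain ⟨C, hC⟩ := hh.bdd
  refine ⟨(hh.meas.comp (measurable_const_smul _)).const_mul _, ⟨(s ^ n)⁻¹ * C, fun t => ?_⟩, ?_⟩
  · rw [_root_.dil, norm_mul, Complex.norm_real, Real.norm_of_nonneg (by positivity)]
    gcongr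
    exact hC _
  · exact ((integrable_comp_smul_iff volume h (inv_ne_zero hs.ne')).2 hh.int).const_mul _

lemma integral_dil {n : ℕ} {s : ℝ} (hs : 0 < s) (h : Rn n → ℂ) : ∫ t, dil s h t = ∫ t, h t := by
  unfold dil
  rw [integral_const_mul, integral_comp_inv_smul hs, ← mul_assoc, ← Complex.ofReal_mul,
    inv_mul_cancel₀ (by positivity), Complex.ofReal_one, one_mul]

lemma fourier_dil {n : ℕ} {s : ℝ} (hs : 0 < s) (h : Rn n → ℂ) (ξ : Rn n) :
    𝓕 (dil s h) ξ = 𝓕 h (s • ξ) := by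
  rw [Real.fourier_eq, Real.fourier_eq,
    ← integral_dil hs (fun v => Real.fourierChar (-inner ℝ v (s • ξ)) • h v)]
  congr 1
  funext t
  have : inner ℝ (s⁻¹ • t) (s • ξ) = inner ℝ t ξ := by
    rw [real_inner_smul_left, real_inner_smul_right, ← mul_assoc, inv_mul_cancel₀ hs.ne', one_mul]
  simp only [dil, this, Circle.smul_def, smul_eq_mul]
  ring

lemma dil_eq_zero {n : ℕ} {s : ℝ} (hs : 0 < s) {h : Rn n → ℂ} {ρ : ℝ}
    (hh : ∀ t, ρ < ‖t‖ → h t = 0) (t : Rn n) (ht : s * ρ < ‖t‖) : dil s h t = 0 := by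
  rw [dil, hh, mul_zero]
  rw [norm_smul, norm_inv, Real.norm_of_nonneg hs.le, ← div_eq_inv_mul, lt_div_iff₀ hs, mul_comm]
  exact ht

/-- A smooth bump of integral one supported in the unit ball. -/
def bumpFn (n : ℕ) (t : Rn n) : ℂ :=
  (((⟨1 / 2, 1, by norm_num, by norm_num⟩ : ContDiffBump (0 : Rn n)).normed volume t : ℝ) : ℂ)

lemma bumpFn_eq_zero {n : ℕ} (t : Rn n) (ht : 1 < ‖t‖) : bumpFn n t = 0 := by
  set φ : ContDiffBump (0 : Rn n) := ⟨1 / 2, 1, by norm_num, by norm_num⟩ with hφ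
  have h : t ∉ Function.support (φ.normed volume) := by
    rw [φ.support_normed_eq]
    simp only [Metric.mem_ball, dist_zero_right, not_lt]
    exact ht.le
  rw [bumpFn, Function.notMem_support.1 h, Complex.ofReal_zero]

lemma contDiff_bumpFn (n : ℕ) : ContDiff ℝ (⊤ : ℕ∞) (bumpFn n) :=
  Complex.ofRealCLM.contDiff.comp (ContDiffBump.contDiff_normed _)

lemma hasCompactSupport_bumpFn (n : ℕ) : HasCompactSupport (bumpFn n) :=
  (ContDiffBump.hasCompactSupport_normed _).comp_left (g := Complex.ofReal) rfl

lemma bddInt_bumpFn (n : ℕ) : BddInt (bumpFn n) := by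
  have hc := (contDiff_bumpFn n).continuous
  exact ⟨hc.measurable, (hasCompactSupport_bumpFn n).exists_bound_of_continuous hc,
    hc.integrable_of_hasCompactSupport (hasCompactSupport_bumpFn n)⟩

lemma integral_bumpFn (n : ℕ) : ∫ t, bumpFn n t = 1 := by
  unfold bumpFn
  rw [integral_complex_ofReal, ContDiffBump.integral_normed, Complex.ofReal_one]

lemma integral_norm_bumpFn (n : ℕ) : ∫ t, ‖bumpFn n t‖ = 1 := by
  have : ∀ t, ‖bumpFn n t‖ = (⟨1 / 2, 1, by norm_num, by norm_num⟩ :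
      ContDiffBump (0 : Rn n)).normed volume t := by
    intro t
    rw [bumpFn, Complex.norm_real, Real.norm_of_nonneg (ContDiffBump.nonneg_normed _ _)]
  simp_rw [this]
  exact ContDiffBump.integral_normed _

lemma norm_fourier_bumpFn_le (n : ℕ) (ξ : Rn n) : ‖𝓕 (bumpFn n) ξ‖ ≤ 1 := by
  rw [← integral_norm_bumpFn n]
  exact VectorFourier.norm_fourierIntegral_le_integral_norm _ _ _ _ _

lemma exists_norm_fourier_bumpFn_mul_le (n : ℕ) : ∃ C, ∀ ξ, ‖ξ‖ * ‖𝓕 (bumpFn n) ξ‖ ≤ C := by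
  set φ : SchwartzMap (Rn n) ℂ := (hasCompactSupport_bumpFn n).toSchwartzMap (contDiff_bumpFn n)
  refine ⟨SchwartzMap.seminorm ℝ 1 0 (𝓕 φ), fun ξ => ?_⟩
  have := SchwartzMap.le_seminorm ℝ 1 0 (𝓕 φ) ξ
  rw [pow_one, norm_iteratedFDeriv_zero, SchwartzMap.fourier_coe] at this
  exact this

lemma norm_fourier_bumpFn_sub_one_le (n : ℕ) (ξ : Rn n) :
    ‖𝓕 (bumpFn n) ξ - 1‖ ≤ 2 * Real.pi * ‖ξ‖ := by
  have h_intg := (bddInt_bumpFn n).int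
  have h1 : 𝓕 (bumpFn n) ξ - 1 =
      ∫ t, ((Real.fourierChar (-inner ℝ t ξ) : ℂ) - 1) * bumpFn n t := by
    have h0 : 𝓕 (bumpFn n) ξ - 1 = 𝓕 (bumpFn n) ξ - ∫ t, bumpFn n t := by rw [integral_bumpFn]
    rw [h0, Real.fourier_eq, ← integral_sub _ h_intg]
    · congr 1
      funext t
      rw [Circle.smul_def, smul_eq_mul]; ring
    · exact (Real.fourierIntegral_convergent_iff ξ).2 h_intg
  have h2 : 2 * Real.pi * ‖ξ‖ = ∫ t, 2 * Real.pi * ‖ξ‖ * ‖bumpFn n t‖ := by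
    rw [integral_const_mul, integral_norm_bumpFn, mul_one]
  rw [h1, h2]
  refine norm_integral_le_of_norm_le (h_intg.norm.const_mul _) (ae_of_all _ fun t => ?_)
  rw [norm_mul]
  rcases lt_or_ge 1 ‖t‖ with ht | ht
  · simp [bumpFn_eq_zero t ht]
  · gcongr
    rw [Real.fourierChar_apply, mul_comm _ Complex.I]
    refine (Real.norm_exp_I_mul_ofReal_sub_one_le).trans ?_
    rw [Real.norm_eq_abs, abs_mul, abs_neg, abs_of_pos (show 0 < 2 * Real.pi by positivity)]
    have := abs_real_inner_le_norm t ξ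
    have h3 : ‖t‖ * ‖ξ‖ ≤ 1 * ‖ξ‖ := by gcongr
    have := Real.pi_pos
    nlinarith

/-- `min x x⁻¹`. -/
def mm (x : ℝ) : ℝ := min x x⁻¹

lemma mm_nonneg {x : ℝ} (hx : 0 ≤ x) : 0 ≤ mm x := le_min hx (inv_nonneg.2 hx)

lemma mm_le_one (x : ℝ) : mm x ≤ 1 := by
  rcases le_total x 1 with h | h
  · exact (min_le_left _ _).trans h
  · exact (min_le_right _ _).trans (inv_le_one_of_one_le₀ h)

lemma mm_mul_le {x : ℝ} (hx : 0 < x) (k : ℤ) : mm x * mm (2 ^ k * x) ≤ (2 : ℝ) ^ (-|k|) := by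
  have h2 : (0 : ℝ) < 2 ^ k := by positivity
  have hy : 0 < 2 ^ k * x := by positivity
  rcases le_total 0 k with hk | hk
  · rw [abs_of_nonneg hk]
    calc mm x * mm (2 ^ k * x) ≤ x * (2 ^ k * x)⁻¹ :=
          mul_le_mul (min_le_left _ _) (min_le_right _ _) (mm_nonneg hy.le) hx.le
      _ = 2 ^ (-k) := by rw [zpow_neg]; field_simp
  · rw [abs_of_nonpos hk, neg_neg]
    calc mm x * mm (2 ^ k * x) ≤ x⁻¹ * (2 ^ k * x) :=
          mul_le_mul (min_le_right _ _) (min_le_left _ _) (mm_nonneg hy.le) (by positivity)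
      _ = 2 ^ k := by field_simp

lemma tsum_two_rpow_neg_abs_ne_top {c : ℝ} (hc : 0 < c) :
    ∑' k : ℤ, ENNReal.ofReal ((2 : ℝ) ^ (-(c * |(k : ℝ)|))) ≠ ⊤ := by
  have h1 : (2 : ℝ) ^ (-c) < 1 := Real.rpow_lt_one_of_one_lt_of_neg (by norm_num) (by linarith)
  have hs : Summable fun k : ℕ => ((2 : ℝ) ^ (-c)) ^ k :=
    summable_geometric_of_lt_one (by positivity) h1
  have e : ∀ k : ℕ, (2 : ℝ) ^ (-(c * |(k : ℝ)|)) = ((2 : ℝ) ^ (-c)) ^ k := by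
    intro k
    rw [← Real.rpow_natCast, ← Real.rpow_mul (by norm_num), abs_of_nonneg (by positivity)]
    ring_nf
  have hS : Summable fun k : ℤ => (2 : ℝ) ^ (-(c * |(k : ℝ)|)) := by
    refine Summable.of_nat_of_neg ?_ ?_
    · refine hs.congr fun k => ?_
      rw [← e]; simp
    · refine hs.congr fun k => ?_
      rw [← e]; simp
  exact hS.tsum_ofReal_ne_top

lemma exists_tsum_mm_le {c : ℝ} (hc : 0 < c) :
    ∃ C : ℝ≥0∞, C ≠ ⊤ ∧ ∀ x : ℝ, 0 < x →
      ∑' k : ℤ, ENNReal.ofReal (mm (2 ^ k * x) ^ c) ≤ C := by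
  refine ⟨ENNReal.ofReal (2 ^ c) * ∑' k : ℤ, ENNReal.ofReal ((2 : ℝ) ^ (-(c * |(k : ℝ)|))),
    ENNReal.mul_ne_top ENNReal.ofReal_ne_top (tsum_two_rpow_neg_abs_ne_top hc), fun x hx => ?_⟩
  obtain ⟨m, hm1, hm2⟩ := exists_mem_Ico_zpow hx (one_lt_two)
  rw [← ENNReal.tsum_mul_left, ← (Equiv.addRight (-m)).tsum_eq]
  refine ENNReal.tsum_le_tsum fun k => ?_
  rw [← ENNReal.ofReal_mul (by positivity)]
  apply ENNReal.ofReal_le_ofReal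
  have h0 : 0 < (2 : ℝ) ^ (k + -m) * x := by positivity
  have hk : mm ((2 : ℝ) ^ (k + -m) * x) ≤ 2 * 2 ^ (-|(k : ℝ)|) := by
    have e1 : (2 : ℝ) ^ (k + -m) * 2 ^ m = 2 ^ k := by
      rw [← zpow_add₀ (by norm_num)]; congr 1; ring
    rcases le_total 0 k with hk | hk
    · refine (min_le_right _ _).trans ?_
      rw [abs_of_nonneg (by exact_mod_cast hk), Real.rpow_neg (by norm_num), Real.rpow_intCast]
      have : (2 : ℝ) ^ k ≤ 2 ^ (k + -m) * x := by rw [← e1]; gcongr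
      calc _ ≤ ((2 : ℝ) ^ k)⁻¹ := inv_anti₀ (by positivity) this
        _ ≤ _ := by
          have : 0 < ((2 : ℝ) ^ k)⁻¹ := by positivity
          linarith
    · refine (min_le_left _ _).trans ?_
      rw [abs_of_nonpos (by exact_mod_cast hk), neg_neg, Real.rpow_intCast, ← e1, mul_comm 2,
        mul_assoc, ← zpow_add_one₀ (by norm_num)]
      gcongr
  calc mm ((2 : ℝ) ^ (k + -m) * x) ^ c ≤ (2 * 2 ^ (-|(k : ℝ)|)) ^ c :=
        Real.rpow_le_rpow (mm_nonneg h0.le) hk hc.le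
    _ = _ := by
      rw [Real.mul_rpow (by norm_num) (by positivity), ← Real.rpow_mul (by norm_num)]
      ring_nf


lemma cv_sub_right {n : ℕ} {f a b : Rn n → ℂ} (hf : BddInt f) (ha : Integrable a)
    (hb : Integrable b) (x : Rn n) : cv f (fun t => a t - b t) x = cv f a x - cv f b x := by
  unfold cv
  rw [← integral_sub (hf.comp_sub_mul ha x) (hf.comp_sub_mul hb x)]
  congr 1; funext t; ring

lemma cv_add_right {n : ℕ} {f a b : Rn n → ℂ} (hf : BddInt f) (ha : Integrable a)
    (hb : Integrable b) (x : Rn n) : cv f (fun t => a t + b t) x = cv f a x + cv f b x := by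
  unfold cv
  rw [← integral_add (hf.comp_sub_mul ha x) (hf.comp_sub_mul hb x)]
  congr 1; funext t; ring

lemma cv_sub_left {n : ℕ} {f g a : Rn n → ℂ} (hf : BddInt f) (hg : BddInt g)
    (ha : Integrable a) (x : Rn n) : cv (fun t => f t - g t) a x = cv f a x - cv g a x := by
  unfold cv
  rw [← integral_sub (hf.comp_sub_mul ha x) (hg.comp_sub_mul ha x)]
  congr 1; funext t; ring

lemma cv_cv_comm {n : ℕ} {f a b : Rn n → ℂ} (hf : BddInt f) (ha : BddInt a)
    (hb : BddInt b) (x : Rn n) : cv (cv f a) b x = cv (cv f b) a x := by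
  obtain ⟨C, hC⟩ := hf.bdd
  have e1 : cv (cv f a) b x = ∫ t, ∫ s, f (x - t - s) * a s * b t := by
    simp only [cv, ← integral_mul_const]
  have e2 : cv (cv f b) a x = ∫ s, ∫ t, f (x - t - s) * a s * b t := by
    simp only [cv, ← integral_mul_const]
    congr 1; funext s; congr 1; funext t
    rw [show x - s - t = x - t - s by abel]; ring
  rw [e1, e2]
  apply integral_integral_swap
  have h1 : Integrable (fun z : Rn n × Rn n => b z.1 * a z.2) (volume.prod volume) :=
    hb.int.mul_prod ha.int
  refine (h1.norm.const_mul C).mono' ?_ (ae_of_all _ fun z => ?_)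
  · apply Measurable.aestronglyMeasurable
    have := hf.meas; have := ha.meas; have := hb.meas
    unfold Function.uncurry
    fun_prop
  · simp only [Function.uncurry, norm_mul]
    have := hC (x - z.1 - z.2)
    calc ‖f (x - z.1 - z.2)‖ * ‖a z.2‖ * ‖b z.1‖ ≤ C * ‖a z.2‖ * ‖b z.1‖ := by gcongr
      _ = _ := by ring

/-- The averaging kernel at scale `2 ^ i`. -/
def etaK (n : ℕ) (i : ℤ) : Rn n → ℂ := dil ((2 : ℝ) ^ i) (bumpFn n)

/-- The difference of consecutive averaging kernels. -/
def dk (n : ℕ) (i : ℤ) (t : Rn n) : ℂ := etaK n i t - etaK n (i + 1) t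

/-- The sum of consecutive averaging kernels. -/
def pk (n : ℕ) (i : ℤ) (t : Rn n) : ℂ := etaK n i t + etaK n (i + 1) t

/-- The Littlewood–Paley difference at scale `2 ^ i`. -/
def Dop {n : ℕ} (i : ℤ) (f : Rn n → ℂ) : Rn n → ℂ := cv f (dk n i)

/-- The Littlewood–Paley piece at scale `2 ^ i`. -/
def Gop {n : ℕ} (i : ℤ) (f : Rn n → ℂ) : Rn n → ℂ := cv (Dop i f) (pk n i)

lemma bddInt_etaK (n : ℕ) (i : ℤ) : BddInt (etaK n i) := (bddInt_bumpFn n).dil (by positivity)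

lemma bddInt_dk (n : ℕ) (i : ℤ) : BddInt (dk n i) := (bddInt_etaK n i).sub (bddInt_etaK n _)

lemma bddInt_pk (n : ℕ) (i : ℤ) : BddInt (pk n i) := (bddInt_etaK n i).add (bddInt_etaK n _)

lemma BddInt.Dop {n : ℕ} {f : Rn n → ℂ} (hf : BddInt f) (i : ℤ) : BddInt (Dop i f) :=
  hf.cv (bddInt_dk n i)

lemma BddInt.Gop {n : ℕ} {f : Rn n → ℂ} (hf : BddInt f) (i : ℤ) : BddInt (Gop i f) :=
  (hf.Dop i).cv (bddInt_pk n i)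

lemma etaK_eq_zero {n : ℕ} (i : ℤ) (t : Rn n) (ht : 2 ^ i < ‖t‖) : etaK n i t = 0 :=
  dil_eq_zero (by positivity) bumpFn_eq_zero t (by rwa [mul_one])

lemma dk_eq_zero {n : ℕ} (i : ℤ) (t : Rn n) (ht : 2 * 2 ^ i < ‖t‖) : dk n i t = 0 := by
  have h : (0 : ℝ) < 2 ^ i := by positivity
  rw [dk, etaK_eq_zero i t (by linarith), etaK_eq_zero (i + 1) t, sub_zero]
  rw [zpow_add_one₀ (by norm_num)]; linarith

lemma pk_eq_zero {n : ℕ} (i : ℤ) (t : Rn n) (ht : 2 * 2 ^ i < ‖t‖) : pk n i t = 0 := by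
  have h : (0 : ℝ) < 2 ^ i := by positivity
  rw [pk, etaK_eq_zero i t (by linarith), etaK_eq_zero (i + 1) t, add_zero]
  rw [zpow_add_one₀ (by norm_num)]; linarith

lemma fourier_etaK (n : ℕ) (i : ℤ) (ξ : Rn n) :
    𝓕 (etaK n i) ξ = 𝓕 (bumpFn n) ((2 : ℝ) ^ i • ξ) :=
  fourier_dil (by positivity) _ _

lemma fourier_sub_of_integrable {n : ℕ} {a b : Rn n → ℂ} (ha : Integrable a) (hb : Integrable b)
    (ξ : Rn n) : 𝓕 (fun t => a t - b t) ξ = 𝓕 a ξ - 𝓕 b ξ := by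
  simp only [Real.fourier_eq]
  rw [← integral_sub ((Real.fourierIntegral_convergent_iff ξ).2 ha)
    ((Real.fourierIntegral_convergent_iff ξ).2 hb)]
  congr 1; funext t; rw [smul_sub]

lemma fourier_add_of_integrable {n : ℕ} {a b : Rn n → ℂ} (ha : Integrable a) (hb : Integrable b)
    (ξ : Rn n) : 𝓕 (fun t => a t + b t) ξ = 𝓕 a ξ + 𝓕 b ξ := by
  simp only [Real.fourier_eq]
  rw [← integral_add ((Real.fourierIntegral_convergent_iff ξ).2 ha)
    ((Real.fourierIntegral_convergent_iff ξ).2 hb)]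
  congr 1; funext t; rw [smul_add]

lemma norm_fourier_pk_le (n : ℕ) (i : ℤ) (ξ : Rn n) : ‖𝓕 (pk n i) ξ‖ ≤ 2 := by
  have : 𝓕 (pk n i) ξ = _ :=
    fourier_add_of_integrable (bddInt_etaK n i).int (bddInt_etaK n (i + 1)).int ξ
  rw [this, fourier_etaK, fourier_etaK]
  refine (norm_add_le _ _).trans ?_
  linarith [norm_fourier_bumpFn_le n ((2 : ℝ) ^ i • ξ),
    norm_fourier_bumpFn_le n ((2 : ℝ) ^ (i + 1) • ξ)]

lemma exists_norm_fourier_dk_le (n : ℕ) :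
    ∃ C, 0 < C ∧ ∀ i ξ, ‖𝓕 (dk n i) ξ‖ ≤ C * mm (2 ^ i * ‖ξ‖) := by
  obtain ⟨C, hC⟩ := exists_norm_fourier_bumpFn_mul_le n
  refine ⟨max (6 * Real.pi) (2 * C), lt_max_of_lt_left (by positivity), fun i ξ => ?_⟩
  have : 𝓕 (dk n i) ξ = _ :=
    fourier_sub_of_integrable (bddInt_etaK n i).int (bddInt_etaK n (i + 1)).int ξ
  rw [this, fourier_etaK, fourier_etaK]
  have h2 : (0 : ℝ) < 2 ^ i := by positivity
  have e1 : ‖(2 : ℝ) ^ i • ξ‖ = 2 ^ i * ‖ξ‖ := by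
    rw [norm_smul, Real.norm_of_nonneg h2.le]
  have e2 : ‖(2 : ℝ) ^ (i + 1) • ξ‖ = 2 * (2 ^ i * ‖ξ‖) := by
    rw [norm_smul, Real.norm_of_nonneg (by positivity), zpow_add_one₀ (by norm_num)]; ring
  have a1 := norm_fourier_bumpFn_sub_one_le n ((2 : ℝ) ^ i • ξ)
  have a2 := norm_fourier_bumpFn_sub_one_le n ((2 : ℝ) ^ (i + 1) • ξ)
  have b1 := hC ((2 : ℝ) ^ i • ξ)
  have b2 := hC ((2 : ℝ) ^ (i + 1) • ξ)
  rw [e1] at a1 b1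
  rw [e2] at a2 b2
  set A := 𝓕 (bumpFn n) ((2 : ℝ) ^ i • ξ)
  set B := 𝓕 (bumpFn n) ((2 : ℝ) ^ (i + 1) • ξ)
  set y := 2 ^ i * ‖ξ‖ with hy
  have hy0 : 0 ≤ y := by positivity
  have t1 : ‖A - B‖ ≤ ‖A - 1‖ + ‖B - 1‖ := by
    rw [show A - B = (A - 1) - (B - 1) by ring]; exact norm_sub_le _ _
  have t2 : ‖A - B‖ ≤ ‖A‖ + ‖B‖ := norm_sub_le _ _
  have p := Real.pi_pos
  have c1 := le_max_left (6 * Real.pi) (2 * C)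
  have c2 := le_max_right (6 * Real.pi) (2 * C)
  set M := max (6 * Real.pi) (2 * C)
  have u1 : ‖A - B‖ ≤ M * y := by
    have : 6 * Real.pi * y ≤ M * y := by gcongr
    linarith
  rcases hy0.eq_or_lt with h | h
  · rw [← h] at u1 ⊢
    simpa [mm] using u1
  · unfold mm
    rw [mul_min_of_nonneg _ _ (by linarith)]
    refine le_min u1 ?_
    rw [← div_eq_mul_inv, le_div_iff₀ h]
    have : ‖A - B‖ * y ≤ (‖A‖ + ‖B‖) * y := by gcongr
    have := norm_nonneg B
    nlinarith [mul_nonneg hy0 this]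

lemma exists_tsum_lintegral_Dop_le (n : ℕ) : ∃ C : ℝ≥0∞, C ≠ ⊤ ∧ ∀ g : Rn n → ℂ, BddInt g →
    ∑' i : ℤ, ∫⁻ x, ‖Dop i g x‖ₑ ^ 2 ≤ C * ∫⁻ x, ‖g x‖ₑ ^ 2 := by
  obtain ⟨C, hC0, hC⟩ := exists_norm_fourier_dk_le n
  obtain ⟨S, hS, hSm⟩ := exists_tsum_mm_le (c := 2) (by norm_num)
  refine ⟨ENNReal.ofReal (C ^ 2) * S, ENNReal.mul_ne_top ENNReal.ofReal_ne_top hS, fun g hg => ?_⟩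
  have m1 : ∀ i, Measurable (𝓕 (dk n i)) := fun i =>
    (continuous_fourier_of_integrable (bddInt_dk n i).int).measurable
  have m2 : Measurable (𝓕 g) := (continuous_fourier_of_integrable hg.int).measurable
  calc _ = ∑' i : ℤ, ∫⁻ ξ, ‖𝓕 (dk n i) ξ‖ₑ ^ 2 * ‖𝓕 g ξ‖ₑ ^ 2 := by
        congr 1; funext i; exact lintegral_enorm_cv_sq hg (bddInt_dk n i)
    _ = ∫⁻ ξ, ∑' i : ℤ, ‖𝓕 (dk n i) ξ‖ₑ ^ 2 * ‖𝓕 g ξ‖ₑ ^ 2 := by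
        rw [lintegral_tsum]
        intro i
        exact (((m1 i).enorm.pow_const _).mul (m2.enorm.pow_const _)).aemeasurable
    _ ≤ ∫⁻ ξ, ENNReal.ofReal (C ^ 2) * S * ‖𝓕 g ξ‖ₑ ^ 2 := by
        refine lintegral_mono fun ξ => ?_
        rw [ENNReal.tsum_mul_right]
        gcongr
        have h1 : ∀ i : ℤ, ‖𝓕 (dk n i) ξ‖ₑ ^ 2 ≤
            ENNReal.ofReal (C ^ 2) * ENNReal.ofReal (mm (2 ^ i * ‖ξ‖) ^ (2 : ℝ)) := by
          intro i
          rw [← ENNReal.ofReal_mul (by positivity), ← ofReal_norm,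
            ← ENNReal.ofReal_pow (norm_nonneg _), Real.rpow_two, ← mul_pow]
          gcongr
          exact hC i ξ
        refine (ENNReal.tsum_le_tsum h1).trans ?_
        rw [ENNReal.tsum_mul_left]
        gcongr
        rcases (norm_nonneg ξ).eq_or_lt with h | h
        · rw [← h]; simp [mm]
        · exact hSm _ h
    _ = _ := by
        rw [lintegral_const_mul _ (m2.enorm.pow_const _), lintegral_enorm_fourier_sq hg.int
          hg.memLp_two]

lemma exists_norm_etaK_le (n : ℕ) : ∃ C, 0 ≤ C ∧ ∀ i t, ‖etaK n i t‖ ≤ C * (((2 : ℝ) ^ i) ^ n)⁻¹ := by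
  obtain ⟨C, hC⟩ := (bddInt_bumpFn n).bdd
  have hC0 : 0 ≤ C := (norm_nonneg _).trans (hC 0)
  refine ⟨C, hC0, fun i t => ?_⟩
  rw [etaK, dil, norm_mul, Complex.norm_real, Real.norm_of_nonneg (by positivity), mul_comm]
  gcongr
  exact hC _

lemma exists_enorm_Gop_sq_le (n : ℕ) : ∃ C : ℝ≥0∞, C ≠ ⊤ ∧ ∀ (f : Rn n → ℂ), BddInt f →
    ∀ i y, ‖Gop i f y‖ₑ ^ 2 ≤ C * ballAvg (2 * 2 ^ i) (fun x => ‖Dop i f x‖ₑ ^ 2) y := by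
  obtain ⟨C, hC0, hC⟩ := exists_norm_etaK_le n
  refine ⟨ENNReal.ofReal ((2 * C) ^ 2 * 2 ^ n * 2 ^ n) * unitVol n, ENNReal.mul_ne_top
    ENNReal.ofReal_ne_top (unitVol_ne_top n), fun f hf i y => ?_⟩
  have h2 : (0 : ℝ) < 2 ^ i := by positivity
  have hB : ∀ t, ‖pk n i t‖ₑ ≤ ENNReal.ofReal (2 * C * (((2 : ℝ) ^ i) ^ n)⁻¹) := by
    intro t
    rw [← ofReal_norm]
    apply ENNReal.ofReal_le_ofReal
    refine (norm_add_le _ _).trans ?_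
    have h1 := hC i t
    have h3 := hC (i + 1) t
    have h4 : (((2 : ℝ) ^ (i + 1)) ^ n)⁻¹ ≤ (((2 : ℝ) ^ i) ^ n)⁻¹ := by
      gcongr
      · norm_num
      · linarith
    have h5 : C * (((2 : ℝ) ^ (i + 1)) ^ n)⁻¹ ≤ C * (((2 : ℝ) ^ i) ^ n)⁻¹ := by gcongr
    linarith
  refine (enorm_cv_sq_le_ballAvg_aux (hf.Dop i).meas hB (pk_eq_zero i) y).trans (le_of_eq ?_)
  rw [volume_closedBall_Rn y (by positivity), setLIntegral_ball_eq (by positivity),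
    ← ENNReal.ofReal_pow (by positivity)]
  rw [show ∀ a b c d e : ℝ≥0∞, a * (b * c) * (d * e) = (a * b * d) * c * e by intros; ring,
    ← ENNReal.ofReal_mul (by positivity), ← ENNReal.ofReal_mul (by positivity)]
  congr 3
  field_simp
  ring

lemma cv_Gop_eq {n : ℕ} {f : Rn n → ℂ} (hf : BddInt f) (i : ℤ) (x : Rn n) :
    Gop i f x = cv (cv f (etaK n i)) (etaK n i) x -
      cv (cv f (etaK n (i + 1))) (etaK n (i + 1)) x := by
  have b := bddInt_etaK n
  have h1 : Dop i f = fun y => cv f (etaK n i) y - cv f (etaK n (i + 1)) y := by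
    funext y; exact cv_sub_right hf (b i).int (b (i + 1)).int y
  have h2 : Gop i f x = _ := cv_add_right (hf.Dop i) (b i).int (b (i + 1)).int x
  rw [h2, h1, cv_sub_left (hf.cv (b _)) (hf.cv (b _)) (b _).int,
    cv_sub_left (hf.cv (b _)) (hf.cv (b _)) (b _).int, cv_cv_comm hf (b i) (b (i + 1))]
  ring

lemma norm_sub_cv_etaK_le {n : ℕ} {f : Rn n → ℂ} (hf : BddInt f) {i : ℤ} {ε : ℝ}
    (h : ∀ x y, dist x y ≤ 2 ^ i → ‖f x - f y‖ ≤ ε) (x : Rn n) :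
    ‖f x - cv f (etaK n i) x‖ ≤ ε := by
  have b := bddInt_etaK n i
  have hI : ∫ t, etaK n i t = 1 := (integral_dil (by positivity) _).trans (integral_bumpFn n)
  have hN : ∫ t, ‖etaK n i t‖ = 1 := by
    have e : ∀ t, ((‖etaK n i t‖ : ℝ) : ℂ) = etaK n i t := by
      intro t
      rw [etaK, dil, bumpFn, ← Complex.ofReal_mul, Complex.norm_real, Real.norm_of_nonneg]
      exact mul_nonneg (by positivity) (ContDiffBump.nonneg_normed _ _)
    have := congrArg Complex.re (integral_complex_ofReal (μ := (volume : Measure (Rn n)))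
      (f := fun t => ‖etaK n i t‖))
    simp only [e, hI, Complex.ofReal_re, Complex.one_re] at this
    exact this.symm
  have e : f x - cv f (etaK n i) x = ∫ t, (f x - f (x - t)) * etaK n i t := by
    have : f x = ∫ t, f x * etaK n i t := by rw [integral_const_mul, hI, mul_one]
    nth_rw 1 [this]
    unfold cv
    rw [← integral_sub (b.int.const_mul _) (hf.comp_sub_mul b.int x)]
    congr 1; funext t; ring
  rw [e, ← mul_one ε, ← hN, ← integral_const_mul]
  refine norm_integral_le_of_norm_le (b.int.norm.const_mul _) (ae_of_all _ fun t => ?_)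
  rw [norm_mul]
  rcases lt_or_ge (2 ^ i) ‖t‖ with ht | ht
  · simp [etaK_eq_zero i t ht]
  · gcongr
    apply h
    rw [dist_eq_norm]
    simpa using ht

lemma integral_norm_etaK_le (n : ℕ) (i : ℤ) : ∫ t, ‖etaK n i t‖ ≤ 1 := by
  have hs : (0 : ℝ) < 2 ^ i := by positivity
  have h := Measure.integral_comp_inv_smul_of_nonneg (volume : Measure (Rn n))
    (fun t => ‖bumpFn n t‖) hs.le
  rw [finrank_euclideanSpace_fin, integral_norm_bumpFn, smul_eq_mul, mul_one] at h
  have e : ∀ t, ‖etaK n i t‖ = ((2 ^ i : ℝ) ^ n)⁻¹ * ‖bumpFn n ((2 ^ i : ℝ)⁻¹ • t)‖ := by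
    intro t
    rw [etaK, dil, norm_mul, Complex.norm_real, Real.norm_of_nonneg (by positivity)]
  simp_rw [e]
  rw [integral_const_mul, h, inv_mul_cancel₀ (by positivity)]

/-- Pointwise Littlewood–Paley decomposition of a convolution. -/
theorem enorm_cv_le_tsum_Gop {n : ℕ} (hn : 0 < n) {f κ : Rn n → ℂ} (hf : BddInt f)
    (hfu : UniformContinuous f) (hκ : BddInt κ) (x : Rn n) :
    ‖cv f κ x‖ₑ ≤ ∑' k : ℤ, ‖cv (Gop k f) κ x‖ₑ := by
  have b := bddInt_etaK n
  set I := ∫ t, ‖κ t‖ with hI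
  have hI0 : 0 ≤ I := integral_nonneg fun _ => norm_nonneg _
  obtain ⟨CE, hCE0, hCE⟩ := exists_norm_etaK_le n
  set F : ℤ → Rn n → ℂ := fun i => cv (cv f (etaK n i)) (etaK n i) with hF
  have bF : ∀ i, BddInt (F i) := fun i => (hf.cv (b i)).cv (b i)
  refine ENNReal.le_of_forall_pos_le_add fun ε hε _ => ?_
  set ε' : ℝ := ε / (3 * (I + 1)) with hε'
  have hε'0 : 0 < ε' := by have : (0 : ℝ) < ε := hε; positivity
  obtain ⟨δ, hδ, hδf⟩ := Metric.uniformContinuous_iff.1 hfu ε' hε'0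
  have t1 : Tendsto (fun N : ℕ => ((2 : ℝ)⁻¹) ^ N) atTop (𝓝 0) :=
    tendsto_pow_atTop_nhds_zero_of_lt_one (by norm_num) (by norm_num)
  obtain ⟨N, hN1, hN2⟩ : ∃ N : ℕ, ((2 : ℝ)⁻¹) ^ N < δ ∧
      (CE * ∫ t, ‖f t‖) * ((2 : ℝ)⁻¹) ^ N < ε' := by
    have t2 := (t1.const_mul (CE * ∫ t, ‖f t‖))
    rw [mul_zero] at t2
    exact ((t1.eventually_lt_const hδ).and (t2.eventually_lt_const hε'0)).exists
  have e1 : ∀ x, ‖f x - F (-N) x‖ ≤ 2 * ε' := by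
    intro x
    have hd : ∀ x y, dist x y ≤ (2 : ℝ) ^ (-(N : ℤ)) → ‖f x - f y‖ ≤ ε' := by
      intro x y h
      rw [← dist_eq_norm]
      refine (hδf (h.trans_lt ?_)).le
      rwa [zpow_neg, zpow_natCast, ← inv_pow]
    have h1 := norm_sub_cv_etaK_le hf hd
    have h2 : cv f (etaK n (-N)) x - F (-N) x =
        cv (fun y => f y - cv f (etaK n (-N)) y) (etaK n (-N)) x :=
      (cv_sub_left hf (hf.cv (b _)) (b _).int x).symm
    have h3 := norm_cv_le h1 (b (-N)).int x
    have h4 := integral_norm_etaK_le n (-N)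
    have h5 : ε' * ∫ t, ‖etaK n (-N) t‖ ≤ ε' * 1 := by gcongr
    rw [← h2] at h3
    calc ‖f x - F (-N) x‖ = ‖(f x - cv f (etaK n (-N)) x) + (cv f (etaK n (-N)) x - F (-N) x)‖ := by
          congr 1; ring
      _ ≤ _ := norm_add_le _ _
      _ ≤ 2 * ε' := by linarith [h1 x]
  have e2 : ∀ x, ‖F N x‖ ≤ ε' := by
    intro x
    have h1 : ∀ y, ‖cv f (etaK n N) y‖ ≤ ε' := by
      intro y
      have : cv f (etaK n N) y = cv (etaK n N) f y := by
        unfold cv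
        rw [← integral_sub_left_eq_self _ volume y]
        congr 1; funext t; rw [sub_sub_cancel, mul_comm]
      rw [this]
      refine (norm_cv_le (hCE N) hf.int y).trans (le_trans ?_ hN2.le)
      have : (((2 : ℝ) ^ (N : ℤ)) ^ n)⁻¹ ≤ 2⁻¹ ^ N := by
        rw [zpow_natCast, inv_pow]
        gcongr
        exact le_self_pow₀ (one_le_pow₀ (by norm_num)) hn.ne'
      have h0 : 0 ≤ ∫ t, ‖f t‖ := integral_nonneg fun _ => norm_nonneg _
      calc CE * (((2 : ℝ) ^ (N : ℤ)) ^ n)⁻¹ * ∫ t, ‖f t‖ ≤ CE * 2⁻¹ ^ N * ∫ t, ‖f t‖ := by gcongr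
        _ = _ := by ring
    have h3 := norm_cv_le h1 (b N).int x
    have h4 := integral_norm_etaK_le n N
    have h5 : ε' * ∫ t, ‖etaK n N t‖ ≤ ε' * 1 := by gcongr
    exact h3.trans (by linarith)
  have tel : ∀ M : ℕ, cv (F (-(N : ℤ))) κ x - cv (F (-(N : ℤ) + M)) κ x =
      ∑ k ∈ Finset.range M, cv (Gop (-(N : ℤ) + k) f) κ x := by
    intro M
    induction M with
    | zero => simp
    | succ M ih =>
      rw [Finset.sum_range_succ, ← ih]
      have : Gop (-(N : ℤ) + M) f = fun y => F (-(N : ℤ) + M) y - F (-(N : ℤ) + M + 1) y := by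
        funext y; exact cv_Gop_eq hf _ y
      rw [this, cv_sub_left (bF _) (bF _) hκ.int]
      push_cast
      rw [add_assoc]; ring
  have tel2 := tel (2 * N)
  rw [show (-(N : ℤ) + (2 * N : ℕ)) = N by push_cast; ring] at tel2
  have key : cv f κ x = (∑ k ∈ Finset.range (2 * N), cv (Gop (-(N : ℤ) + k) f) κ x) +
      (cv (fun y => f y - F (-N) y) κ x + cv (F N) κ x) := by
    rw [← tel2, cv_sub_left hf (bF _) hκ.int]; ring
  rw [key]
  refine (enorm_add_le _ _).trans (add_le_add ?_ ?_)
  · refine (enorm_sum_le _ _).trans ?_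
    have := ENNReal.sum_le_tsum (f := fun k => ‖cv (Gop k f) κ x‖ₑ)
      ((Finset.range (2 * N)).map ⟨fun k : ℕ => -(N : ℤ) + k, fun a b h => by simpa using h⟩)
    rwa [Finset.sum_map] at this
  · rw [← ofReal_norm, ← ENNReal.ofReal_coe_nnreal]
    apply ENNReal.ofReal_le_ofReal
    refine (norm_add_le _ _).trans ?_
    have h1 := norm_cv_le e1 hκ.int x
    have h2 := norm_cv_le e2 hκ.int x
    have h3 : 3 * ε' * (I + 1) = ε := by rw [hε']; field_simp
    have : 3 * ε' * I ≤ 3 * ε' * (I + 1) := by gcongr; linarith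
    linarith

/-! ### Local square-function operators on `L^p`, `p > 2` -/

/-- A finite family of operators, the `j`-th one local at scale `2 ^ τ j`, whose sum is bounded
from `L¹` of squares to `L¹`. -/
structure LocalFamily {n : ℕ} (J0 : Finset ℤ) (τ : ℤ → ℤ) (ρ : ℝ) (A : ℝ≥0∞)
    (Φ : ℤ → (Rn n → ℂ) → Rn n → ℝ≥0∞) : Prop where
  meas : ∀ j f, BddInt f → Measurable (Φ j f)
  loc : ∀ j f g x, (∀ y, dist y x ≤ ρ * 2 ^ τ j → f y = g y) → Φ j f x = Φ j g x
  bdd : ∀ g, BddInt g → ∑ j ∈ J0, ∫⁻ x, Φ j g x ≤ A * ∫⁻ x, ‖g x‖ₑ ^ 2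

lemma LocalFamily.lintegral_mul_le {n : ℕ} {J0 : Finset ℤ} {τ : ℤ → ℤ} {ρ : ℝ} {A : ℝ≥0∞}
    {Φ : ℤ → (Rn n → ℂ) → Rn n → ℝ≥0∞} (hΦ : LocalFamily J0 τ ρ A Φ) (hA : A ≠ ⊤) (hρ : 0 < ρ)
    {f : Rn n → ℂ} (hf : BddInt f) (L : ℤ) (N i : ℕ) {D : Rn n → ℝ≥0∞}
    (hD : Measurable[MeasurableSpace.comap (cell (n := n) (L - i)) inferInstance] D) :
    ∫⁻ x, D x * ∑ k ∈ Finset.Ico i N, ∑ j ∈ J0 with τ j = L - k, Φ j f x ≤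
      (A * ENNReal.ofReal ((n + ρ) ^ n)) *
        ∫⁻ x, D x * dyadicMax (n + ρ) L (fun y => ‖f y‖ₑ ^ 2) x := by
  refine lintegral_mul_le_of_cell (L - i) (ENNReal.mul_ne_top hA ENNReal.ofReal_ne_top) hD
    (Finset.measurable_fun_sum _ fun k _ => Finset.measurable_fun_sum _ fun j _ => hΦ.meas j f hf)
    fun x0 => ?_
  set K : ℤ := L - i with hK
  have h2 : (0 : ℝ) < 2 ^ K := by positivity
  set B := Metric.closedBall x0 ((n + ρ) * 2 ^ K) with hB
  set g := B.indicator f with hg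
  have hgb : BddInt g := hf.indicator measurableSet_closedBall
  have hQ : MeasurableSet {x : Rn n | cell K x = cell K x0} :=
    measurableSet_eq_fun (measurable_cell K) measurable_const
  calc ∫⁻ x in {x | cell K x = cell K x0},
        ∑ k ∈ Finset.Ico i N, ∑ j ∈ J0 with τ j = L - k, Φ j f x
      = ∫⁻ x in {x | cell K x = cell K x0},
        ∑ k ∈ Finset.Ico i N, ∑ j ∈ J0 with τ j = L - k, Φ j g x := by
        refine setLIntegral_congr_fun hQ fun x hx => ?_
        refine Finset.sum_congr rfl fun k hk => Finset.sum_congr rfl fun j hj => ?_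
        refine hΦ.loc j f g x fun y hy => ?_
        rw [hg, Set.indicator_of_mem]
        rw [hB, Metric.mem_closedBall]
        have h3 := dist_le_of_cell_eq (show cell K x = cell K x0 from hx)
        have h4 : (2 : ℝ) ^ τ j ≤ 2 ^ K := by
          apply zpow_le_zpow_right₀ (by norm_num)
          rw [(Finset.mem_filter.1 hj).2, hK]
          have := (Finset.mem_Ico.1 hk).1
          omega
        calc dist y x0 ≤ dist y x + dist x x0 := dist_triangle _ _ _
          _ ≤ ρ * 2 ^ K + n * 2 ^ K := by
            refine add_le_add (hy.trans ?_) h3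
            gcongr
          _ = _ := by ring
    _ ≤ ∫⁻ x in {x | cell K x = cell K x0}, ∑ j ∈ J0, Φ j g x := by
        refine lintegral_mono fun x => ?_
        have hinj : Set.PairwiseDisjoint (↑(Finset.Ico i N))
            (fun k : ℕ => {j ∈ J0 | τ j = L - k}) := by
          intro a _ b _ hab
          refine Finset.disjoint_filter.2 fun j _ h1 h2 => hab ?_
          omega
        rw [← Finset.sum_biUnion hinj]
        refine Finset.sum_le_sum_of_subset ?_
        exact Finset.biUnion_subset.2 fun k _ => Finset.filter_subset _ _
    _ ≤ ∫⁻ x, ∑ j ∈ J0, Φ j g x := setLIntegral_le_lintegral _ _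
    _ = ∑ j ∈ J0, ∫⁻ x, Φ j g x := lintegral_finsetSum _ fun j _ => hΦ.meas j g hgb
    _ ≤ A * ∫⁻ x, ‖g x‖ₑ ^ 2 := hΦ.bdd g hgb
    _ = A * ∫⁻ x in B, ‖f x‖ₑ ^ 2 := by
        rw [← lintegral_indicator measurableSet_closedBall]
        congr 2; funext x
        rw [← hB]
        by_cases hx : x ∈ B <;> simp [hg, hx]
    _ = (A * ENNReal.ofReal ((n + ρ) ^ n)) * ENNReal.ofReal ((2 ^ K) ^ n) *
          ballAvg ((n + ρ) * 2 ^ K) (fun y => ‖f y‖ₑ ^ 2) x0 := by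
        rw [hB, setLIntegral_ball_eq (by positivity), mul_pow, ENNReal.ofReal_mul (by positivity)]
        ring
    _ ≤ _ := by
        gcongr
        exact le_iSup₂ (f := fun (k : ℤ) (_ : k ≤ L) =>
          ballAvg ((n + ρ) * 2 ^ k) (fun y => ‖f y‖ₑ ^ 2) x0) K (by omega)

/-- `L^p` bound, `p = 2 * q > 2`, for a local family dominated by one that is constant on cells. -/
theorem exists_lintegral_rpow_sum_localFamily_le (n : ℕ) {q : ℝ} (hq : 1 < q) :
    ∃ C : ℝ≥0∞, C ≠ ⊤ ∧ ∀ (J0 : Finset ℤ) (τ : ℤ → ℤ) (ρ : ℝ) (A B : ℝ≥0∞)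
      (Φ Ψ : ℤ → (Rn n → ℂ) → Rn n → ℝ≥0∞), 0 < ρ → A ≠ ⊤ → B ≠ ⊤ →
      LocalFamily J0 τ ρ A Φ → LocalFamily J0 τ ρ B Ψ → ∀ f, BddInt f →
      (∀ j ∈ J0, ∀ x, Φ j f x ≤ Ψ j f x) →
      (∀ j, Measurable[MeasurableSpace.comap (cell (n := n) (τ j)) inferInstance] (Ψ j f)) →
      (∀ j, ∃ c : ℝ≥0∞, c ≠ ⊤ ∧ ∀ x, Ψ j f x ≤ c) →
      ∫⁻ x, (∑ j ∈ J0, Φ j f x) ^ q ≤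
        C * ENNReal.ofReal ((n + ρ) ^ n) ^ q * B ^ (q - 1) * A * ∫⁻ x, (‖f x‖ₑ ^ 2) ^ q := by
  obtain ⟨C, hC, hCM⟩ := exists_lintegral_dyadicMax_rpow_le n hq
  have hq1 : 0 < q - 1 := by linarith
  have hq0 : 0 < q := by linarith
  refine ⟨ENNReal.ofReal q ^ q * C, ENNReal.mul_ne_top
    (ENNReal.rpow_ne_top_of_nonneg (by linarith) ENNReal.ofReal_ne_top) hC, ?_⟩
  intro J0 τ ρ A B Φ Ψ hρ hA hB hΦ hΨ f hf hle hmeas hbdd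
  obtain ⟨T, hT⟩ : ∃ T : ℕ, ∀ j ∈ J0, (τ j).natAbs < T := by
    refine ⟨J0.sup (fun j => (τ j).natAbs) + 1, fun j hj => Nat.lt_succ_of_le ?_⟩
    exact Finset.le_sup (f := fun j => (τ j).natAbs) hj
  have hsum : ∀ (Θ : ℤ → ℝ≥0∞), ∑ j ∈ J0, Θ j =
      ∑ i ∈ Finset.range (2 * T), ∑ j ∈ J0 with τ j = (T : ℤ) - i, Θ j := by
    intro Θ
    rw [← Finset.sum_fiberwise_of_maps_to (g := fun j => ((T : ℤ) - τ j).toNat)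
      (t := Finset.range (2 * T))]
    · refine Finset.sum_congr rfl fun i _ => Finset.sum_congr ?_ fun _ _ => rfl
      refine Finset.filter_congr fun j hj => ?_
      have := hT j hj
      omega
    · intro j hj
      have := hT j hj
      simp only [Finset.mem_range]
      omega
  set Y := dyadicMax (n + ρ) T (fun y => ‖f y‖ₑ ^ 2) with hY
  have hfm : Measurable fun y => ‖f y‖ₑ ^ 2 := hf.meas.enorm.pow_const _
  have hgarsia := lintegral_rpow_sum_le_of_adapted_Lp volume hq
    (m := fun i => MeasurableSpace.comap (cell (n := n) ((T : ℤ) - i)) inferInstance)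
    (fun i i' h => comap_cell_le (by have : (i : ℤ) ≤ i' := by exact_mod_cast h
                                     omega))
    (fun i => (measurable_cell _).comap_le)
    (a := fun i x => ∑ j ∈ J0 with τ j = (T : ℤ) - i, Φ j f x)
    (b := fun i x => ∑ j ∈ J0 with τ j = (T : ℤ) - i, Ψ j f x)
    (Y := Y) (A := A * ENNReal.ofReal ((n + ρ) ^ n)) (B := B * ENNReal.ofReal ((n + ρ) ^ n))
    (2 * T) (fun i => Finset.measurable_fun_sum _ fun j _ => hΦ.meas j f hf)
    (fun i => Finset.measurable_fun_sum _ fun j hj => by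
      have := hmeas j
      rwa [(Finset.mem_filter.1 hj).2] at this)
    (fun i x => Finset.sum_le_sum fun j hj => hle j (Finset.mem_filter.1 hj).1 x)
    (measurable_dyadicMax _ _ hfm)
    (by
      simp_rw [← hsum]
      choose c hc hcle using hbdd
      set S := ∑ j ∈ J0, c j with hS
      have hSt : S ≠ ⊤ := ENNReal.sum_ne_top.2 fun j _ => hc j
      have h1 : ∀ x, (∑ j ∈ J0, Ψ j f x) ^ q ≤ S ^ (q - 1) * ∑ j ∈ J0, Ψ j f x := by
        intro x
        have hX : ∑ j ∈ J0, Ψ j f x ≤ S := Finset.sum_le_sum fun j _ => hcle j x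
        calc _ = (∑ j ∈ J0, Ψ j f x) ^ ((q - 1) + 1) := by rw [sub_add_cancel]
          _ = (∑ j ∈ J0, Ψ j f x) ^ (q - 1) * ∑ j ∈ J0, Ψ j f x := by
              rw [ENNReal.rpow_add_of_nonneg _ _ hq1.le zero_le_one, ENNReal.rpow_one]
          _ ≤ _ := by gcongr
      refine ne_top_of_le_ne_top ?_ (lintegral_mono h1)
      rw [lintegral_const_mul' _ _ (ENNReal.rpow_ne_top_of_nonneg hq1.le hSt),
        lintegral_finsetSum _ fun j _ => hΨ.meas j f hf]
      refine ENNReal.mul_ne_top (ENNReal.rpow_ne_top_of_nonneg hq1.le hSt)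
        (ne_top_of_le_ne_top (ENNReal.mul_ne_top hB ?_) (hΨ.bdd f hf))
      have := hf.memLp_two.eLpNorm_lt_top
      rw [eLpNorm_lt_top_iff_lintegral_rpow_enorm_lt_top (by norm_num) (by norm_num)] at this
      simpa using this.ne)
    (fun i _ D hD => hΦ.lintegral_mul_le hA hρ hf T (2 * T) i hD)
    (fun i _ D hD => hΨ.lintegral_mul_le hB hρ hf T (2 * T) i hD)
  simp_rw [← hsum] at hgarsia
  refine hgarsia.trans ?_
  obtain ⟨c, hc⟩ := hf.bdd
  have hm := hCM (n + ρ) (by positivity) T _ hfm ⟨ENNReal.ofReal c ^ 2, by finiteness, fun x => by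
    rw [← ofReal_norm]; gcongr; exact hc x⟩
  refine (mul_le_mul_right hm _).trans (le_of_eq ?_)
  set R := ENNReal.ofReal ((n + ρ) ^ n)
  set Q := ENNReal.ofReal q
  have e1 : ∀ z : ℝ≥0∞, z ^ q = z * z ^ (q - 1) := by
    intro z
    nth_rw 1 [show q = 1 + (q - 1) by ring]
    rw [ENNReal.rpow_add_of_nonneg _ _ zero_le_one hq1.le, ENNReal.rpow_one]
  rw [ENNReal.mul_rpow_of_nonneg _ _ hq1.le, ENNReal.mul_rpow_of_nonneg _ _ hq1.le, e1 R, e1 Q]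
  ring

/-- A family of convolution kernels `κ j u`, supported at scale `2 ^ σ j`, whose square functions
in `u` satisfy a local `L²` bound and a decaying multiplier bound. -/
structure OscFamily {n : ℕ} (ν : Measure ℝ) (J0 : Finset ℤ) (σ : ℤ → ℤ)
    (κ : ℤ → ℝ → Rn n → ℂ) (δ : ℝ) (A M : ℝ≥0∞) (N0 : ℕ) : Prop where
  meas : ∀ j, Measurable (Function.uncurry (κ j))
  bddInt : ∀ j u, BddInt (κ j u)
  supp : ∀ j u t, 2 * 2 ^ σ j < ‖t‖ → κ j u t = 0
  local_sq : ∀ j ∈ J0, ∀ G, BddInt G → ∀ x,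
    ∫⁻ u, ‖cv G (κ j u) x‖ₑ ^ 2 ∂ν ≤ A * ballAvg (2 * 2 ^ σ j) (fun y => ‖G y‖ₑ ^ 2) x
  multiplier : ∀ j ∈ J0, ∀ ξ,
    ∫⁻ u, ‖𝓕 (κ j u) ξ‖ₑ ^ 2 ∂ν ≤ M * ENNReal.ofReal (mm (2 ^ σ j * ‖ξ‖) ^ δ)
  card_fiber : ∀ s, (J0.filter fun j => σ j = s).card ≤ N0

lemma measurable_uncurry_cv {n : ℕ} {G : Rn n → ℂ} (hG : Measurable G) {κ : ℝ → Rn n → ℂ}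
    (hκ : Measurable (Function.uncurry κ)) :
    Measurable fun z : ℝ × Rn n => cv G (κ z.1) z.2 := by
  have : Measurable fun w : (ℝ × Rn n) × Rn n => G (w.1.2 - w.2) * κ w.1.1 w.2 :=
    (hG.comp (by fun_prop)).mul
      (hκ.comp (show Measurable fun w : (ℝ × Rn n) × Rn n => (w.1.1, w.2) by fun_prop))
  exact (this.stronglyMeasurable.integral_prod_right').measurable

lemma measurable_uncurry_fourier {n : ℕ} {κ : ℝ → Rn n → ℂ}
    (hκ : Measurable (Function.uncurry κ)) :
    Measurable fun z : ℝ × Rn n => 𝓕 (κ z.1) z.2 := by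
  have h1 : Measurable fun w : (ℝ × Rn n) × Rn n =>
      Real.fourierChar (-inner ℝ w.2 w.1.2) • κ w.1.1 w.2 := by
    have h2 : Measurable fun w : (ℝ × Rn n) × Rn n => κ w.1.1 w.2 :=
      hκ.comp (show Measurable fun w : (ℝ × Rn n) × Rn n => (w.1.1, w.2) by fun_prop)
    have h3 : Measurable fun w : (ℝ × Rn n) × Rn n =>
        ((Real.fourierChar (-inner ℝ w.2 w.1.2) : Circle) : ℂ) := by
      apply Continuous.measurable
      have := Real.continuous_fourierChar
      fun_prop
    simp only [Circle.smul_def, smul_eq_mul]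
    exact h3.mul h2
  have : (fun z : ℝ × Rn n => 𝓕 (κ z.1) z.2) = fun z : ℝ × Rn n =>
      ∫ t, Real.fourierChar (-inner ℝ t z.2) • κ z.1 t := by
    funext z; rw [Real.fourier_eq]
  rw [this]
  exact (h1.stronglyMeasurable.integral_prod_right').measurable

lemma lintegral_ball_ballAvg_le {n : ℕ} {ρ : ℝ} (hρ : 0 < ρ) (s : ℝ) {w : Rn n → ℝ≥0∞}
    (hw : Measurable w) (x : Rn n) :
    ∫⁻ y in Metric.closedBall x s, ballAvg ρ w y ≤
      unitVol n * ∫⁻ y in Metric.closedBall x (s + ρ), w y := by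
  set w' := (Metric.closedBall x (s + ρ)).indicator w with hw'
  calc ∫⁻ y in Metric.closedBall x s, ballAvg ρ w y
      = ∫⁻ y in Metric.closedBall x s, ballAvg ρ w' y := by
        refine setLIntegral_congr_fun measurableSet_closedBall fun y hy => ?_
        unfold ballAvg
        congr 1
        refine setLIntegral_congr_fun measurableSet_closedBall fun z hz => ?_
        rw [hw', Set.indicator_of_mem]
        rw [Metric.mem_closedBall] at *
        linarith [dist_triangle z y x]
    _ ≤ ∫⁻ y, ballAvg ρ w' y := setLIntegral_le_lintegral _ _
    _ = unitVol n * ∫⁻ y, w' y := lintegral_ballAvg hρ (hw.indicator measurableSet_closedBall)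
    _ = _ := by rw [hw', lintegral_indicator measurableSet_closedBall]

lemma ballAvg_le_ballAvg {n : ℕ} {r R : ℝ} (hr : 0 < r) (hR : 0 < R) {x y : Rn n}
    (h : dist y x + r ≤ R) (w : Rn n → ℝ≥0∞) :
    ballAvg r w y ≤ ENNReal.ofReal ((R / r) ^ n) * ballAvg R w x := by
  have e : ENNReal.ofReal (r ^ n)⁻¹ = ENNReal.ofReal ((R / r) ^ n) * ENNReal.ofReal (R ^ n)⁻¹ := by
    rw [← ENNReal.ofReal_mul (by positivity)]
    congr 1; rw [div_pow]; field_simp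
  rw [ballAvg, ballAvg, e, ← mul_assoc]
  gcongr
  intro z hz
  rw [Metric.mem_closedBall] at *
  linarith [dist_triangle z y x]

lemma exists_ballAvg_Gop_le (n : ℕ) : ∃ C : ℝ≥0∞, C ≠ ⊤ ∧ ∀ f : Rn n → ℂ, BddInt f →
    ∀ (s k : ℤ) x, ballAvg (2 * 2 ^ s) (fun y => ‖Gop (s + k) f y‖ₑ ^ 2) x ≤
      C * ballAvg (4 * 2 ^ (s + max k 0)) (fun y => ‖Dop (s + k) f y‖ₑ ^ 2) x := by
  obtain ⟨C, hC, hCG⟩ := exists_enorm_Gop_sq_le n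
  refine ⟨C * unitVol n * ENNReal.ofReal (2 ^ n), ENNReal.mul_ne_top
    (ENNReal.mul_ne_top hC (unitVol_ne_top n)) ENNReal.ofReal_ne_top, fun f hf s k x => ?_⟩
  have hs : (0 : ℝ) < 2 ^ s := by positivity
  have hsk : (0 : ℝ) < 2 ^ (s + k) := by positivity
  set w : Rn n → ℝ≥0∞ := fun y => ‖Dop (s + k) f y‖ₑ ^ 2 with hw
  have hwm : Measurable w := (hf.Dop _).meas.enorm.pow_const _
  rcases le_total 0 k with hk | hk
  · rw [max_eq_left hk]
    have hle : (2 : ℝ) ^ s ≤ 2 ^ (s + k) := zpow_le_zpow_right₀ (by norm_num) (by omega)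
    set c := C * (ENNReal.ofReal (2 ^ n) * ballAvg (4 * 2 ^ (s + k)) w x) with hc
    have h1 : ∀ y ∈ Metric.closedBall x (2 * 2 ^ s), ‖Gop (s + k) f y‖ₑ ^ 2 ≤ c := by
      intro y hy
      refine (hCG f hf (s + k) y).trans ?_
      rw [hc]
      gcongr
      have := ballAvg_le_ballAvg (r := 2 * 2 ^ (s + k)) (R := 4 * 2 ^ (s + k)) (x := x) (y := y)
        (by positivity) (by positivity) (by rw [Metric.mem_closedBall] at hy; linarith) w
      rwa [show (4 * (2 : ℝ) ^ (s + k)) / (2 * 2 ^ (s + k)) = 2 by field_simp; norm_num] at this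
    calc ballAvg (2 * 2 ^ s) (fun y => ‖Gop (s + k) f y‖ₑ ^ 2) x
        ≤ ballAvg (2 * 2 ^ s) (fun _ => c) x := by
          unfold ballAvg
          gcongr 1
          exact setLIntegral_mono' measurableSet_closedBall h1
      _ = unitVol n * c := ballAvg_const (by positivity) _ _
      _ = _ := by rw [hc]; ring
  · rw [max_eq_right hk, add_zero]
    have hle : (2 : ℝ) ^ (s + k) ≤ 2 ^ s := zpow_le_zpow_right₀ (by norm_num) (by omega)
    calc ballAvg (2 * 2 ^ s) (fun y => ‖Gop (s + k) f y‖ₑ ^ 2) x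
        ≤ ballAvg (2 * 2 ^ s) (fun y => C * ballAvg (2 * 2 ^ (s + k)) w y) x :=
          ballAvg_mono _ (fun y => hCG f hf (s + k) y) x
      _ = ENNReal.ofReal ((2 * 2 ^ s) ^ n)⁻¹ * (C *
            ∫⁻ y in Metric.closedBall x (2 * 2 ^ s), ballAvg (2 * 2 ^ (s + k)) w y) := by
          rw [ballAvg, lintegral_const_mul _ (measurable_ballAvg _ hwm)]
      _ ≤ ENNReal.ofReal ((2 * 2 ^ s) ^ n)⁻¹ * (C *
            (unitVol n * ∫⁻ y in Metric.closedBall x (4 * 2 ^ s), w y)) := by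
          gcongr
          refine (lintegral_ball_ballAvg_le (by positivity) _ hwm x).trans ?_
          gcongr
          linarith
      _ = _ := by
          rw [setLIntegral_ball_eq (by positivity)]
          have : ENNReal.ofReal ((2 * 2 ^ s) ^ n)⁻¹ * ENNReal.ofReal ((4 * 2 ^ s) ^ n) =
              ENNReal.ofReal (2 ^ n) := by
            rw [← ENNReal.ofReal_mul (by positivity)]
            congr 1
            rw [show (4 : ℝ) * 2 ^ s = 2 * (2 * 2 ^ s) by ring, mul_pow 2 (2 * (2 : ℝ) ^ s)]
            field_simp
          rw [← this]; ring

/-- The largest average of `w` at scale `2 ^ K` over centres in the dyadic cell of `x`. -/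
def cellSup {n : ℕ} (K : ℤ) (w : Rn n → ℝ≥0∞) (x : Rn n) : ℝ≥0∞ :=
  ⨆ (y : Rn n) (_ : cell K y = cell K x), ballAvg (4 * 2 ^ K) w y

lemma measurable_cellSup {n : ℕ} (K : ℤ) (w : Rn n → ℝ≥0∞) :
    Measurable[MeasurableSpace.comap (cell (n := n) K) inferInstance] (cellSup K w) := by
  have : cellSup K w = (fun z : Fin n → ℤ =>
      ⨆ (y : Rn n) (_ : cell K y = z), ballAvg (4 * 2 ^ K) w y) ∘ cell K := rfl
  rw [this]
  exact (measurable_of_countable _).comp (comap_measurable _)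

lemma cellSup_le {n : ℕ} (K : ℤ) (w : Rn n → ℝ≥0∞) (x : Rn n) :
    cellSup K w x ≤ ENNReal.ofReal (((n + 4) / 4) ^ n) * ballAvg ((n + 4) * 2 ^ K) w x := by
  have h2 : (0 : ℝ) < 2 ^ K := by positivity
  refine iSup₂_le fun y hy => ?_
  have := ballAvg_le_ballAvg (r := 4 * 2 ^ K) (R := (n + 4) * 2 ^ K) (x := x) (y := y)
    (by positivity) (by positivity) (by linarith [dist_le_of_cell_eq hy]) w
  rwa [show ((n + 4 : ℝ) * 2 ^ K) / (4 * 2 ^ K) = (n + 4) / 4 by field_simp] at this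

lemma cellSup_congr {n : ℕ} (K : ℤ) {w w' : Rn n → ℝ≥0∞} {x : Rn n}
    (h : ∀ y, dist y x ≤ (n + 4) * 2 ^ K → w y = w' y) : cellSup K w x = cellSup K w' x := by
  unfold cellSup
  refine iSup_congr fun y => iSup_congr fun hy => ?_
  unfold ballAvg
  congr 1
  refine setLIntegral_congr_fun measurableSet_closedBall fun z hz => h z ?_
  rw [Metric.mem_closedBall] at hz
  linarith [dist_triangle z y x, dist_le_of_cell_eq hy]

lemma sum_le_card_fiber_mul_tsum {J0 : Finset ℤ} {σ : ℤ → ℤ} {N0 : ℕ}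
    (h : ∀ s, (J0.filter fun j => σ j = s).card ≤ N0) (F : ℤ → ℝ≥0∞) :
    ∑ j ∈ J0, F (σ j) ≤ N0 * ∑' s, F s := by
  rw [Finset.sum_comp]
  calc _ ≤ ∑ s ∈ J0.image σ, (N0 : ℝ≥0∞) * F s := by
        refine Finset.sum_le_sum fun s _ => ?_
        rw [nsmul_eq_mul]
        gcongr
        exact h s
    _ = N0 * ∑ s ∈ J0.image σ, F s := by rw [Finset.mul_sum]
    _ ≤ _ := by gcongr; exact ENNReal.sum_le_tsum _

lemma mm_rpow_mul_le {δ : ℝ} (hδ : 0 < δ) (hδ2 : δ ≤ 2) {x : ℝ} (hx : 0 ≤ x) (k : ℤ) :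
    mm x ^ δ * mm (2 ^ k * x) ^ 2 ≤ 2 ^ (-(δ / 2 * |(k : ℝ)|)) * mm x ^ (δ / 2) := by
  rcases hx.eq_or_lt with rfl | hx0
  · simp only [mm, inv_zero, min_self, mul_zero]
    rw [Real.zero_rpow hδ.ne', Real.zero_rpow (by positivity)]; simp
  · have h1 := mm_nonneg hx
    have h2 : 0 ≤ mm (2 ^ k * x) := mm_nonneg (by positivity)
    have h3 : mm (2 ^ k * x) ^ 2 ≤ mm (2 ^ k * x) ^ (δ / 2) := by
      rw [← Real.rpow_natCast]
      rcases h2.eq_or_lt with h | h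
      · rw [← h, Real.zero_rpow (by norm_num), Real.zero_rpow (by positivity)]
      · exact Real.rpow_le_rpow_of_exponent_ge h (mm_le_one _) (by push_cast; linarith)
    have h4 : mm x ^ δ = mm x ^ (δ / 2) * mm x ^ (δ / 2) := by
      rw [← Real.rpow_add_of_nonneg h1 (by positivity) (by positivity), add_halves]
    have h5 : (mm x * mm (2 ^ k * x)) ^ (δ / 2) ≤ ((2 : ℝ) ^ (-|k|)) ^ (δ / 2) :=
      Real.rpow_le_rpow (by positivity) (mm_mul_le hx0 k) (by positivity)
    rw [Real.mul_rpow h1 h2] at h5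
    have h6 : ((2 : ℝ) ^ (-|k|)) ^ (δ / 2) = 2 ^ (-(δ / 2 * |(k : ℝ)|)) := by
      rw [← Real.rpow_intCast, ← Real.rpow_mul (by norm_num)]
      push_cast; ring_nf
    rw [h6] at h5
    have h7 : 0 ≤ mm x ^ (δ / 2) := Real.rpow_nonneg h1 _
    calc _ ≤ mm x ^ (δ / 2) * mm x ^ (δ / 2) * mm (2 ^ k * x) ^ (δ / 2) := by
          rw [h4]; gcongr
      _ = mm x ^ (δ / 2) * mm (2 ^ k * x) ^ (δ / 2) * mm x ^ (δ / 2) := by ring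
      _ ≤ _ := by gcongr

lemma exists_sum_lintegral_cv_Gop_le (n : ℕ) {δ : ℝ} (hδ : 0 < δ) (hδ2 : δ ≤ 2) :
    ∃ C : ℝ≥0∞, C ≠ ⊤ ∧ ∀ (ν : Measure ℝ) [SFinite ν] (J0 : Finset ℤ) (σ : ℤ → ℤ)
      (κ : ℤ → ℝ → Rn n → ℂ) (A M : ℝ≥0∞) (N0 : ℕ), OscFamily ν J0 σ κ δ A M N0 →
      ∀ (k : ℤ) (g : Rn n → ℂ), BddInt g →
      ∑ j ∈ J0, ∫⁻ x, ∫⁻ u, ‖cv (Gop (σ j + k) g) (κ j u) x‖ₑ ^ 2 ∂ν ≤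
        C * N0 * (M * ENNReal.ofReal (2 ^ (-(δ / 2 * |(k : ℝ)|)))) * ∫⁻ x, ‖g x‖ₑ ^ 2 := by
  obtain ⟨Cd, hCd0, hCd⟩ := exists_norm_fourier_dk_le n
  obtain ⟨S, hS, hSm⟩ := exists_tsum_mm_le (c := δ / 2) (by positivity)
  refine ⟨ENNReal.ofReal ((2 * Cd) ^ 2) * S, ENNReal.mul_ne_top ENNReal.ofReal_ne_top hS, ?_⟩
  intro ν _ J0 σ κ A M N0 hκ k g hg
  set Z := ENNReal.ofReal (2 ^ (-(δ / 2 * |(k : ℝ)|))) with hZ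
  have m2 : Measurable (𝓕 g) := (continuous_fourier_of_integrable hg.int).measurable
  have hmul : ∀ i ξ, ‖𝓕 (Gop i g) ξ‖ₑ ^ 2 ≤
      ENNReal.ofReal ((2 * Cd) ^ 2 * mm (2 ^ i * ‖ξ‖) ^ 2) * ‖𝓕 g ξ‖ₑ ^ 2 := by
    intro i ξ
    have e : 𝓕 (Gop i g) ξ = 𝓕 (pk n i) ξ * (𝓕 (dk n i) ξ * 𝓕 g ξ) := by
      rw [Gop, fourier_cv (hg.Dop i).int (bddInt_pk n i).int, Dop,
        fourier_cv hg.int (bddInt_dk n i).int]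
    rw [e, ← mul_assoc, enorm_mul, mul_pow, ← mul_pow (2 * Cd)]
    gcongr
    rw [ENNReal.ofReal_pow (by have := mm_nonneg (x := 2 ^ i * ‖ξ‖) (by positivity); positivity)]
    gcongr
    rw [← ofReal_norm, norm_mul]
    apply ENNReal.ofReal_le_ofReal
    rw [mul_assoc]
    exact mul_le_mul (norm_fourier_pk_le n i ξ) (hCd i ξ) (norm_nonneg _) (by norm_num)
  have hj : ∀ j ∈ J0, ∫⁻ x, ∫⁻ u, ‖cv (Gop (σ j + k) g) (κ j u) x‖ₑ ^ 2 ∂ν ≤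
      ∫⁻ ξ, ENNReal.ofReal ((2 * Cd) ^ 2) * M * Z *
        (ENNReal.ofReal (mm (2 ^ σ j * ‖ξ‖) ^ (δ / 2)) * ‖𝓕 g ξ‖ₑ ^ 2) := by
    intro j hj
    have hG := hg.Gop (σ j + k)
    have mc := measurable_uncurry_cv hG.meas (hκ.meas j)
    have mf := measurable_uncurry_fourier (hκ.meas j)
    calc ∫⁻ x, ∫⁻ u, ‖cv (Gop (σ j + k) g) (κ j u) x‖ₑ ^ 2 ∂ν
        = ∫⁻ u, (∫⁻ x, ‖cv (Gop (σ j + k) g) (κ j u) x‖ₑ ^ 2) ∂ν :=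
          (lintegral_lintegral_swap (f := fun u x => ‖cv (Gop (σ j + k) g) (κ j u) x‖ₑ ^ 2)
            (mc.enorm.pow_const 2).aemeasurable).symm
      _ = ∫⁻ u, (∫⁻ ξ, ‖𝓕 (κ j u) ξ‖ₑ ^ 2 * ‖𝓕 (Gop (σ j + k) g) ξ‖ₑ ^ 2) ∂ν :=
          lintegral_congr fun u => lintegral_enorm_cv_sq hG (hκ.bddInt j u)
      _ = ∫⁻ ξ, ∫⁻ u, ‖𝓕 (κ j u) ξ‖ₑ ^ 2 * ‖𝓕 (Gop (σ j + k) g) ξ‖ₑ ^ 2 ∂ν := by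
          refine lintegral_lintegral_swap
            (f := fun u ξ => ‖𝓕 (κ j u) ξ‖ₑ ^ 2 * ‖𝓕 (Gop (σ j + k) g) ξ‖ₑ ^ 2) ?_
          have m3 : Measurable (𝓕 (Gop (σ j + k) g)) :=
            (continuous_fourier_of_integrable hG.int).measurable
          exact ((mf.enorm.pow_const 2).mul ((m3.comp measurable_snd).enorm.pow_const 2)).aemeasurable
      _ ≤ _ := by
          refine lintegral_mono fun ξ => ?_
          rw [lintegral_mul_const]
          swap
          · exact (mf.comp (measurable_id.prodMk measurable_const)).enorm.pow_const 2
          have h0 := mm_nonneg (x := 2 ^ σ j * ‖ξ‖) (by positivity)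
          have h1 := mm_rpow_mul_le hδ hδ2 (x := 2 ^ σ j * ‖ξ‖) (by positivity) k
          rw [← mul_assoc, ← zpow_add₀ (by norm_num), add_comm k] at h1
          calc _ ≤ M * ENNReal.ofReal (mm (2 ^ σ j * ‖ξ‖) ^ δ) *
                (ENNReal.ofReal ((2 * Cd) ^ 2 * mm (2 ^ (σ j + k) * ‖ξ‖) ^ 2) * ‖𝓕 g ξ‖ₑ ^ 2) :=
                mul_le_mul' (hκ.multiplier j hj ξ) (hmul _ ξ)
            _ = ENNReal.ofReal ((2 * Cd) ^ 2) * M * ENNReal.ofReal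
                (mm (2 ^ σ j * ‖ξ‖) ^ δ * mm (2 ^ (σ j + k) * ‖ξ‖) ^ 2) * ‖𝓕 g ξ‖ₑ ^ 2 := by
                rw [ENNReal.ofReal_mul (by positivity), ENNReal.ofReal_mul (by positivity)]; ring
            _ ≤ ENNReal.ofReal ((2 * Cd) ^ 2) * M * ENNReal.ofReal
                (2 ^ (-(δ / 2 * |(k : ℝ)|)) * mm (2 ^ σ j * ‖ξ‖) ^ (δ / 2)) * ‖𝓕 g ξ‖ₑ ^ 2 := by
                gcongr
            _ = _ := by rw [ENNReal.ofReal_mul (by positivity)]; ring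
  have mj : ∀ j : ℤ, Measurable fun ξ : Rn n =>
      ENNReal.ofReal (mm (2 ^ σ j * ‖ξ‖) ^ (δ / 2)) * ‖𝓕 g ξ‖ₑ ^ 2 := by
    intro j
    unfold mm
    fun_prop
  refine (Finset.sum_le_sum hj).trans ?_
  rw [← lintegral_finsetSum _ fun j _ => (mj j).const_mul _]
  rw [← lintegral_enorm_fourier_sq hg.int hg.memLp_two, ← lintegral_const_mul _ (m2.enorm.pow_const 2)]
  refine lintegral_mono fun ξ => ?_
  rw [← Finset.mul_sum, ← Finset.sum_mul]
  have h1 : ∑ j ∈ J0, ENNReal.ofReal (mm (2 ^ σ j * ‖ξ‖) ^ (δ / 2)) ≤ N0 * S := by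
    refine (sum_le_card_fiber_mul_tsum hκ.card_fiber
      (fun s => ENNReal.ofReal (mm (2 ^ s * ‖ξ‖) ^ (δ / 2)))).trans ?_
    gcongr
    rcases (norm_nonneg ξ).eq_or_lt with h | h
    · rw [← h]; simp [mm, Real.zero_rpow (show δ / 2 ≠ 0 by positivity)]
    · exact hSm _ h
  calc _ ≤ ENNReal.ofReal ((2 * Cd) ^ 2) * M * Z * (N0 * S * ‖𝓕 g ξ‖ₑ ^ 2) := by gcongr
    _ = _ := by ring

lemma exists_tsum_rpow_le {η q : ℝ} (hη : 0 < η) (hq : 0 < q) :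
    ∃ C : ℝ≥0∞, C ≠ ⊤ ∧ ∀ y : ℤ → ℝ≥0∞,
      (∑' k, y k) ^ q ≤ C * ∑' k : ℤ, ENNReal.ofReal (2 ^ (η * |(k : ℝ)|)) * y k ^ q := by
  have hq' : 0 < q⁻¹ := inv_pos.2 hq
  have hT := tsum_two_rpow_neg_abs_ne_top (mul_pos hη hq')
  set T := ∑' k : ℤ, ENNReal.ofReal ((2 : ℝ) ^ (-(η * q⁻¹ * |(k : ℝ)|))) with hTdef
  refine ⟨T ^ q, ENNReal.rpow_ne_top_of_nonneg hq.le hT, fun y => ?_⟩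
  set S := ∑' k : ℤ, ENNReal.ofReal (2 ^ (η * |(k : ℝ)|)) * y k ^ q with hS
  have h1 : ∀ k, y k ≤ ENNReal.ofReal ((2 : ℝ) ^ (-(η * q⁻¹ * |(k : ℝ)|))) * S ^ q⁻¹ := by
    intro k
    have h2 : ENNReal.ofReal (2 ^ (η * |(k : ℝ)|)) * y k ^ q ≤ S :=
      ENNReal.le_tsum (f := fun k : ℤ => ENNReal.ofReal (2 ^ (η * |(k : ℝ)|)) * y k ^ q) k
    have h3 := ENNReal.rpow_le_rpow h2 hq'.le
    rw [ENNReal.mul_rpow_of_nonneg _ _ hq'.le, ENNReal.rpow_rpow_inv hq.ne',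
      ENNReal.ofReal_rpow_of_pos (by positivity), ← Real.rpow_mul (by norm_num)] at h3
    calc y k = ENNReal.ofReal ((2 : ℝ) ^ (-(η * q⁻¹ * |(k : ℝ)|))) *
          (ENNReal.ofReal (2 ^ (η * |(k : ℝ)| * q⁻¹)) * y k) := by
          rw [← mul_assoc, ← ENNReal.ofReal_mul (by positivity), ← Real.rpow_add (by norm_num)]
          rw [show -(η * q⁻¹ * |(k : ℝ)|) + η * |(k : ℝ)| * q⁻¹ = 0 by ring]
          simp
      _ ≤ _ := by gcongr
  calc (∑' k, y k) ^ q ≤ (T * S ^ q⁻¹) ^ q := by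
        gcongr
        rw [hTdef, ← ENNReal.tsum_mul_right]
        exact ENNReal.tsum_le_tsum h1
    _ = T ^ q * S := by
        rw [ENNReal.mul_rpow_of_nonneg _ _ hq.le, ENNReal.rpow_inv_rpow hq.ne']

lemma Dop_congr {n : ℕ} {f g : Rn n → ℂ} {i : ℤ} {y : Rn n}
    (h : ∀ z, dist z y ≤ 2 * 2 ^ i → f z = g z) : Dop i f y = Dop i g y :=
  cv_congr_of_support (dk_eq_zero i) h

lemma Gop_congr {n : ℕ} {f g : Rn n → ℂ} {i : ℤ} {y : Rn n}
    (h : ∀ z, dist z y ≤ 4 * 2 ^ i → f z = g z) : Gop i f y = Gop i g y := by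
  refine cv_congr_of_support (pk_eq_zero i) fun z hz => Dop_congr fun v hv => h v ?_
  linarith [dist_triangle v z y]

lemma exists_lintegral_rpow_Gop_le (n : ℕ) {q δ : ℝ} (hq : 1 < q) (hδ : 0 < δ) (hδ2 : δ ≤ 2)
    {A : ℝ≥0∞} (hA : A ≠ ⊤) (N0 : ℕ) :
    ∃ C : ℝ≥0∞, C ≠ ⊤ ∧ ∀ (ν : Measure ℝ) [SFinite ν] (J0 : Finset ℤ) (σ : ℤ → ℤ)
      (κ : ℤ → ℝ → Rn n → ℂ) (M : ℝ≥0∞), M ≠ ⊤ → OscFamily ν J0 σ κ δ A M N0 →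
      ∀ (k : ℤ) (f : Rn n → ℂ), BddInt f →
      ∫⁻ x, (∑ j ∈ J0, ∫⁻ u, ‖cv (Gop (σ j + k) f) (κ j u) x‖ₑ ^ 2 ∂ν) ^ q ≤
        C * M * ENNReal.ofReal (2 ^ (-(δ / 2 * |(k : ℝ)|))) * ∫⁻ x, (‖f x‖ₑ ^ 2) ^ q := by
  obtain ⟨C1, hC1, h1⟩ := exists_sum_lintegral_cv_Gop_le n hδ hδ2
  obtain ⟨C2, hC2, h2⟩ := exists_ballAvg_Gop_le n
  obtain ⟨C3, hC3, h3⟩ := exists_tsum_lintegral_Dop_le n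
  obtain ⟨C4, hC4, h4⟩ := exists_lintegral_rpow_sum_localFamily_le n hq
  have hq1 : 0 ≤ q - 1 := by linarith
  have hq0 : 0 ≤ q := by linarith
  set E := ENNReal.ofReal (((n + 4) / 4 : ℝ) ^ n) with hE
  set B := A * C2 * E * unitVol n * N0 * C3 with hB
  have hUt := unitVol_ne_top n
  have hBt : B ≠ ⊤ := by rw [hB, hE]; finiteness
  set ρ : ℝ := n + 6 with hρ
  refine ⟨C4 * ENNReal.ofReal ((n + ρ) ^ n) ^ q * B ^ (q - 1) * (C1 * N0), by finiteness, ?_⟩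
  intro ν _ J0 σ κ M hM hκ k f hf
  set τ : ℤ → ℤ := fun j => σ j + max k 0 with hτ
  set Z := ENNReal.ofReal (2 ^ (-(δ / 2 * |(k : ℝ)|))) with hZ
  set Φ : ℤ → (Rn n → ℂ) → Rn n → ℝ≥0∞ :=
    fun j f x => ∫⁻ u, ‖cv (Gop (σ j + k) f) (κ j u) x‖ₑ ^ 2 ∂ν with hΦ
  set Ψ : ℤ → (Rn n → ℂ) → Rn n → ℝ≥0∞ :=
    fun j f x => A * C2 * cellSup (τ j) (fun y => ‖Dop (σ j + k) f y‖ₑ ^ 2) x with hΨ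
  have hσ1 : ∀ j, (2 : ℝ) ^ σ j ≤ 2 ^ τ j := fun j =>
    zpow_le_zpow_right₀ (by norm_num) (by simp [hτ])
  have hσ2 : ∀ j, (2 : ℝ) ^ (σ j + k) ≤ 2 ^ τ j := fun j =>
    zpow_le_zpow_right₀ (by norm_num) (by simp [hτ])
  have hpos : ∀ j, (0 : ℝ) < 2 ^ τ j := fun j => by positivity
  have hn0 : (0 : ℝ) ≤ n := Nat.cast_nonneg n
  have hloc : ∀ j, (n : ℝ) * 2 ^ τ j ≥ 0 := fun j => by positivity
  have mD : ∀ j (g : Rn n → ℂ), BddInt g → Measurable fun y => ‖Dop (σ j + k) g y‖ₑ ^ 2 :=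
    fun j g hg => (hg.Dop _).meas.enorm.pow_const _
  have LΦ : LocalFamily J0 τ ρ (C1 * N0 * (M * Z)) Φ := by
    refine ⟨fun j g hg => ?_, fun j f g x h => ?_, fun g hg => h1 ν J0 σ κ A M N0 hκ k g hg⟩
    · have := measurable_uncurry_cv (hg.Gop (σ j + k)).meas (hκ.meas j)
      exact (this.enorm.pow_const 2).lintegral_prod_left'
    · simp only [hΦ]
      congr 1; funext u
      rw [cv_congr_of_support (hκ.supp j u) (x := x) (g := Gop (σ j + k) g)]
      intro y hy
      refine Gop_congr fun z hz => h z ?_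
      rw [hρ]
      linarith [dist_triangle z y x, hσ1 j, hσ2 j, hloc j]
  have LΨ : LocalFamily J0 τ ρ B Ψ := by
    refine ⟨fun j g hg => ?_, fun j f g x h => ?_, fun g hg => ?_⟩
    · exact ((measurable_cellSup _ _).mono (measurable_cell _).comap_le le_rfl).const_mul _
    · simp only [hΨ]
      congr 1
      refine cellSup_congr _ fun y hy => ?_
      rw [Dop_congr fun z hz => h z ?_]
      rw [hρ]
      linarith [dist_triangle z y x, hσ1 j, hσ2 j, hloc j]
    · have hj : ∀ j ∈ J0, ∫⁻ x, Ψ j g x ≤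
          A * C2 * E * unitVol n * ∫⁻ x, ‖Dop (σ j + k) g x‖ₑ ^ 2 := by
        intro j _
        calc ∫⁻ x, Ψ j g x ≤ ∫⁻ x, A * C2 * (E *
              ballAvg ((n + 4) * 2 ^ τ j) (fun y => ‖Dop (σ j + k) g y‖ₑ ^ 2) x) := by
              refine lintegral_mono fun x => ?_
              simp only [hΨ]
              gcongr
              exact cellSup_le _ _ _
          _ = _ := by
              have hm := measurable_ballAvg (((n : ℝ) + 4) * 2 ^ τ j) (mD j g hg)
              rw [lintegral_const_mul _ (hm.const_mul _), lintegral_const_mul _ hm,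
                lintegral_ballAvg (by have := hpos j; positivity) (mD j g hg)]
              ring
      refine (Finset.sum_le_sum hj).trans ?_
      rw [← Finset.mul_sum]
      have h5 := sum_le_card_fiber_mul_tsum hκ.card_fiber
        (fun s => ∫⁻ x, ‖Dop (s + k) g x‖ₑ ^ 2)
      have h6 : ∑' s, ∫⁻ x, ‖Dop (s + k) g x‖ₑ ^ 2 = ∑' s, ∫⁻ x, ‖Dop s g x‖ₑ ^ 2 :=
        (Equiv.addRight k).tsum_eq (fun s => ∫⁻ x, ‖Dop s g x‖ₑ ^ 2)
      rw [h6] at h5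
      calc _ ≤ A * C2 * E * unitVol n * (N0 * (C3 * ∫⁻ x, ‖g x‖ₑ ^ 2)) := by
            gcongr
            exact h5.trans (by gcongr; exact h3 g hg)
        _ = _ := by rw [hB]; ring
  have key := h4 J0 τ ρ (C1 * N0 * (M * Z)) B Φ Ψ (by positivity) (by finiteness) hBt LΦ LΨ f hf
    (fun j hj x => by
      simp only [hΦ, hΨ]
      refine (hκ.local_sq j hj _ (hf.Gop _) x).trans ?_
      rw [mul_assoc]
      gcongr
      refine (h2 f hf (σ j) k x).trans ?_
      gcongr
      exact le_iSup₂ (f := fun (y : Rn n) (_ : cell (τ j) y = cell (τ j) x) =>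
        ballAvg (4 * 2 ^ τ j) (fun y => ‖Dop (σ j + k) f y‖ₑ ^ 2) y) x rfl)
    (fun j => @Measurable.const_mul _ _ _ _ _ (_) _ (measurable_cellSup _ _) _)
    (fun j => by
      obtain ⟨c, hc⟩ := (hf.Dop (σ j + k)).bdd
      refine ⟨A * C2 * (unitVol n * ENNReal.ofReal c ^ 2), by finiteness, fun x => ?_⟩
      simp only [hΨ]
      gcongr
      refine iSup₂_le fun y _ => ?_
      rw [← ballAvg_const (n := n) (ρ := 4 * 2 ^ τ j) (by positivity) _ y]
      refine ballAvg_mono _ (fun z => ?_) y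
      rw [← ofReal_norm]
      gcongr
      exact hc z)
  refine key.trans (le_of_eq ?_)
  ring

theorem lintegral_enorm_cv_sq_le_tsum {n : ℕ} (hn : 0 < n) {W : ℤ → ℝ≥0∞} {C : ℝ≥0∞}
    (hW : ∀ a : ℤ → ℝ≥0∞, (∑' k, a k) ^ 2 ≤ C * ∑' k, W k * a k ^ 2) (ν : Measure ℝ)
    {κ : ℝ → Rn n → ℂ} (mκ : Measurable (Function.uncurry κ)) (bκ : ∀ u, BddInt (κ u))
    {f : Rn n → ℂ} (hf : BddInt f) (hfu : UniformContinuous f) (s : ℤ) (x : Rn n) :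
    ∫⁻ u, ‖cv f (κ u) x‖ₑ ^ 2 ∂ν ≤
      C * ∑' k, W k * ∫⁻ u, ‖cv (Gop (s + k) f) (κ u) x‖ₑ ^ 2 ∂ν := by
  have ms : ∀ k, Measurable fun u => ‖cv (Gop (s + k) f) (κ u) x‖ₑ ^ 2 := fun k =>
    (measurable_uncurry_cv (hf.Gop (s + k)).meas mκ).of_uncurry_right.enorm.pow_const 2
  have h1 : ∀ u, ‖cv f (κ u) x‖ₑ ^ 2 ≤ C * ∑' k, W k * ‖cv (Gop (s + k) f) (κ u) x‖ₑ ^ 2 := by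
    intro u
    have h5 := enorm_cv_le_tsum_Gop hn hf hfu (bκ u) x
    have h6 : ∑' k, ‖cv (Gop (s + k) f) (κ u) x‖ₑ = ∑' k, ‖cv (Gop k f) (κ u) x‖ₑ :=
      (Equiv.addLeft s).tsum_eq (fun k => ‖cv (Gop k f) (κ u) x‖ₑ)
    rw [← h6] at h5
    exact (pow_le_pow_left' h5 2).trans (hW _)
  refine (lintegral_mono h1).trans (le_of_eq ?_)
  rw [lintegral_const_mul _ (Measurable.tsum fun k => (ms k).const_mul _),
    lintegral_tsum fun k => ((ms k).const_mul _).aemeasurable]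
  congr 2; funext k
  exact lintegral_const_mul _ (ms k)

/-- The `L^p` bound, `p = 2 * q > 2`, for the square functions of an oscillatory family. -/
theorem exists_lintegral_rpow_oscFamily_le {n : ℕ} (hn : 0 < n) {q δ : ℝ} (hq : 1 < q) (hδ : 0 < δ)
    (hδ2 : δ ≤ 2) {A : ℝ≥0∞} (hA : A ≠ ⊤) (N0 : ℕ) :
    ∃ C : ℝ≥0∞, C ≠ ⊤ ∧ ∀ (ν : Measure ℝ) [SFinite ν] (J0 : Finset ℤ) (σ : ℤ → ℤ)
      (κ : ℤ → ℝ → Rn n → ℂ) (M : ℝ≥0∞), M ≠ ⊤ → OscFamily ν J0 σ κ δ A M N0 →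
      ∀ f : Rn n → ℂ, BddInt f → UniformContinuous f →
      ∫⁻ x, (∑ j ∈ J0, ∫⁻ u, ‖cv f (κ j u) x‖ₑ ^ 2 ∂ν) ^ q ≤
        C * M * ∫⁻ x, (‖f x‖ₑ ^ 2) ^ q := by
  have hq0 : 0 < q := by linarith
  set η : ℝ := δ / (4 * (1 + q)) with hη
  have hη0 : 0 < η := by positivity
  obtain ⟨C1, hC1, h1⟩ := exists_lintegral_rpow_Gop_le n hq hδ hδ2 hA N0
  obtain ⟨C2, hC2, h2⟩ := exists_tsum_rpow_le hη0 (q := 2) (by norm_num)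
  obtain ⟨C3, hC3, h3⟩ := exists_tsum_rpow_le hη0 hq0
  have hT := tsum_two_rpow_neg_abs_ne_top (c := δ / 4) (by positivity)
  set T := ∑' k : ℤ, ENNReal.ofReal ((2 : ℝ) ^ (-(δ / 4 * |(k : ℝ)|))) with hTdef
  refine ⟨C2 ^ q * C3 * C1 * T, by finiteness, ?_⟩
  intro ν _ J0 σ κ M hM hκ f hf hfu
  set W : ℤ → ℝ≥0∞ := fun k => ENNReal.ofReal (2 ^ (η * |(k : ℝ)|)) with hW
  set X : ℤ → Rn n → ℝ≥0∞ := fun k x =>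
    ∑ j ∈ J0, ∫⁻ u, ‖cv (Gop (σ j + k) f) (κ j u) x‖ₑ ^ 2 ∂ν with hX
  have mc : ∀ i j, Measurable fun z : ℝ × Rn n => ‖cv (Gop i f) (κ j z.1) z.2‖ₑ ^ 2 :=
    fun i j => (measurable_uncurry_cv (hf.Gop i).meas (hκ.meas j)).enorm.pow_const 2
  have mX : ∀ k, Measurable (X k) := fun k =>
    Finset.measurable_fun_sum _ fun j _ => (mc (σ j + k) j).lintegral_prod_left'
  have p1 : ∀ j x, ∫⁻ u, ‖cv f (κ j u) x‖ₑ ^ 2 ∂ν ≤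
      C2 * ∑' k, W k * ∫⁻ u, ‖cv (Gop (σ j + k) f) (κ j u) x‖ₑ ^ 2 ∂ν := by
    intro j x
    exact lintegral_enorm_cv_sq_le_tsum hn (fun a => by simpa only [ENNReal.rpow_two] using h2 a)
      ν (hκ.meas j) (hκ.bddInt j) hf hfu (σ j) x
  have p2 : ∀ x, (∑ j ∈ J0, ∫⁻ u, ‖cv f (κ j u) x‖ₑ ^ 2 ∂ν) ^ q ≤
      C2 ^ q * C3 * ∑' k, W k * W k ^ q * X k x ^ q := by
    intro x
    have : ∑ j ∈ J0, ∫⁻ u, ‖cv f (κ j u) x‖ₑ ^ 2 ∂ν ≤ C2 * ∑' k, W k * X k x := by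
      refine (Finset.sum_le_sum fun j _ => p1 j x).trans (le_of_eq ?_)
      rw [← Finset.mul_sum, ← Summable.tsum_finsetSum fun _ _ => ENNReal.summable]
      congr 2; funext k
      rw [hX, Finset.mul_sum]
    refine (ENNReal.rpow_le_rpow this hq0.le).trans ?_
    rw [ENNReal.mul_rpow_of_nonneg _ _ hq0.le, mul_assoc]
    gcongr
    refine (h3 fun k => W k * X k x).trans (le_of_eq ?_)
    congr 2; funext k
    rw [ENNReal.mul_rpow_of_nonneg _ _ hq0.le, mul_assoc]
  set I := ∫⁻ x, (‖f x‖ₑ ^ 2) ^ q with hI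
  calc _ ≤ ∫⁻ x, C2 ^ q * C3 * ∑' k, W k * W k ^ q * X k x ^ q := lintegral_mono p2
    _ = C2 ^ q * C3 * ∑' k, W k * W k ^ q * ∫⁻ x, X k x ^ q := by
        have m1 : ∀ k, Measurable fun x => W k * W k ^ q * X k x ^ q :=
          fun k => ((mX k).pow_const q).const_mul _
        rw [lintegral_const_mul _ (Measurable.tsum m1),
          lintegral_tsum fun k => (m1 k).aemeasurable]
        congr 2; funext k
        exact lintegral_const_mul _ ((mX k).pow_const q)
    _ ≤ C2 ^ q * C3 * ∑' k : ℤ, ENNReal.ofReal ((2 : ℝ) ^ (-(δ / 4 * |(k : ℝ)|))) * (C1 * M * I) := by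
        refine mul_le_mul_right (ENNReal.tsum_le_tsum fun k => ?_) _
        calc W k * W k ^ q * ∫⁻ x, X k x ^ q
            ≤ W k * W k ^ q * (C1 * M * ENNReal.ofReal (2 ^ (-(δ / 2 * |(k : ℝ)|))) * I) := by
              gcongr
              exact h1 ν J0 σ κ M hM hκ k f hf
          _ = (W k * W k ^ q * ENNReal.ofReal (2 ^ (-(δ / 2 * |(k : ℝ)|)))) * (C1 * M * I) := by ring
          _ = _ := by
              congr 1
              rw [hW]
              simp only
              rw [ENNReal.ofReal_rpow_of_pos (by positivity), ← ENNReal.ofReal_mul (by positivity),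
                ← ENNReal.ofReal_mul (by positivity), ← Real.rpow_mul (by norm_num),
                ← Real.rpow_add (by norm_num), ← Real.rpow_add (by norm_num)]
              congr 2
              rw [hη]
              field_simp
              ring
    _ = _ := by rw [ENNReal.tsum_mul_right]; ring

/-! ### Averages of oscillatory integrals over the frequency parameter -/

lemma integral_exp_neg_sq_mul_cexp (τ : ℝ) :
    ∫ u : ℝ, (Real.exp (-u ^ 2) : ℂ) * Complex.exp (Complex.I * (u * τ : ℝ)) =
      (Real.sqrt Real.pi * Real.exp (-τ ^ 2 / 4) : ℝ) := by
  have h := fourierIntegral_gaussian (b := 1) (by simp) (τ : ℂ)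
  calc _ = ∫ x : ℝ, Complex.exp (Complex.I * τ * x) * Complex.exp (-1 * (x : ℂ) ^ 2) := by
        congr 1; funext u
        rw [mul_comm]
        push_cast
        congr 2
        · ring
        · ring
    _ = _ := by
        rw [h, Real.sqrt_eq_rpow, Complex.ofReal_mul, Complex.ofReal_cpow Real.pi_pos.le]
        push_cast
        congr 2 <;> norm_num

theorem lintegral_enorm_integral_cexp_sq_le {X : Type*} [MeasurableSpace X] (μ : Measure X)
    [IsFiniteMeasure μ] {θ : X → ℝ} (mθ : Measurable θ) {h : X → ℂ} (mh : Measurable h)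
    (bh : ∃ C : ℝ, ∀ x, ‖h x‖ ≤ C) :
    ∫⁻ u in Icc (-4 : ℝ) 4, ‖∫ x, Complex.exp (Complex.I * (u * θ x : ℝ)) * h x ∂μ‖ₑ ^ 2 ≤
      ENNReal.ofReal (Real.exp 16 * Real.sqrt Real.pi) *
        ∫⁻ x, ∫⁻ y, ‖h x‖ₑ * ‖h y‖ₑ * ENNReal.ofReal (Real.exp (-(θ x - θ y) ^ 2 / 4)) ∂μ ∂μ := by
  obtain ⟨C, hC⟩ := bh
  set P : ℝ → ℂ := fun u => ∫ x, Complex.exp (Complex.I * (u * θ x : ℝ)) * h x ∂μ with hP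
  set G : ℝ → X × X → ℂ := fun u z => (Real.exp (-u ^ 2) : ℂ) *
    ((Complex.exp (Complex.I * (u * θ z.1 : ℝ)) * h z.1) *
      (starRingEnd ℂ) (Complex.exp (Complex.I * (u * θ z.2 : ℝ)) * h z.2)) with hG
  have mE : Measurable fun p : ℝ × X => Complex.exp (Complex.I * (p.1 * θ p.2 : ℝ)) * h p.2 := by
    fun_prop
  have mG : Measurable (Function.uncurry G) := by
    have h1 := mE.comp (show Measurable fun p : ℝ × X × X => (p.1, p.2.1) by fun_prop)
    have h2 := mE.comp (show Measurable fun p : ℝ × X × X => (p.1, p.2.2) by fun_prop)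
    have h3 : Measurable fun p : ℝ × X × X => (Real.exp (-p.1 ^ 2) : ℂ) := by fun_prop
    exact h3.mul (h1.mul (Complex.continuous_conj.measurable.comp h2))
  have nE : ∀ u x, ‖Complex.exp (Complex.I * (u * θ x : ℝ)) * h x‖ = ‖h x‖ := by
    intro u x
    rw [norm_mul, mul_comm Complex.I, Complex.norm_exp_ofReal_mul_I, one_mul]
  have nG : ∀ u z, ‖G u z‖ = Real.exp (-u ^ 2) * (‖h z.1‖ * ‖h z.2‖) := by
    intro u z
    simp only [hG]
    rw [norm_mul, norm_mul, RCLike.norm_conj, nE, nE, Complex.norm_real,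
      Real.norm_of_nonneg (Real.exp_pos _).le]
  have igau : Integrable fun u : ℝ => Real.exp (-u ^ 2) := by
    simpa using integrable_exp_neg_mul_sq (b := 1) (by norm_num)
  have iG : Integrable (Function.uncurry G) (volume.prod (μ.prod μ)) := by
    refine Integrable.mono' (g := fun p : ℝ × X × X => Real.exp (-p.1 ^ 2) * (C * C))
      (igau.mul_prod (integrable_const _)) mG.aestronglyMeasurable (ae_of_all _ fun p => ?_)
    rw [Function.uncurry, nG]
    have := (norm_nonneg _).trans (hC p.2.1)
    gcongr
    exacts [hC _, hC _]
  have e1 : ∀ u, ∫ z, G u z ∂(μ.prod μ) = (Real.exp (-u ^ 2) * ‖P u‖ ^ 2 : ℝ) := by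
    intro u
    simp only [hG]
    rw [integral_const_mul, integral_prod_mul
      (fun x => Complex.exp (Complex.I * (u * θ x : ℝ)) * h x)
      (fun x => (starRingEnd ℂ) (Complex.exp (Complex.I * (u * θ x : ℝ)) * h x)),
      integral_conj, Complex.mul_conj, Complex.normSq_eq_norm_sq, ← Complex.ofReal_mul]
  have e2 : ∀ z, ‖∫ u, G u z‖ₑ = ENNReal.ofReal (Real.sqrt Real.pi) *
      (‖h z.1‖ₑ * ‖h z.2‖ₑ * ENNReal.ofReal (Real.exp (-(θ z.1 - θ z.2) ^ 2 / 4))) := by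
    intro z
    have : ∀ u, G u z = (h z.1 * (starRingEnd ℂ) (h z.2)) *
        ((Real.exp (-u ^ 2) : ℂ) * Complex.exp (Complex.I * (u * (θ z.1 - θ z.2) : ℝ))) := by
      intro u
      simp only [hG]
      rw [map_mul, ← Complex.exp_conj, map_mul, Complex.conj_I, Complex.conj_ofReal]
      have : Complex.exp (Complex.I * (u * (θ z.1 - θ z.2) : ℝ)) =
          Complex.exp (Complex.I * (u * θ z.1 : ℝ)) * Complex.exp (-Complex.I * (u * θ z.2 : ℝ)) := by
        rw [← Complex.exp_add]
        congr 1
        push_cast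
        ring
      rw [this]
      ring
    simp only [this]
    rw [integral_const_mul, integral_exp_neg_sq_mul_cexp, enorm_mul, enorm_mul, RCLike.enorm_conj,
      ← ofReal_norm (Complex.ofReal _), Complex.norm_real, Real.norm_of_nonneg (by positivity),
      ENNReal.ofReal_mul (by positivity)]
    ring
  have iP : Integrable fun u => Real.exp (-u ^ 2) * ‖P u‖ ^ 2 := by
    have := iG.integral_prod_left
    simp only [Function.uncurry, e1] at this
    exact this.re
  calc ∫⁻ u in Icc (-4 : ℝ) 4, ‖P u‖ₑ ^ 2
      ≤ ∫⁻ u in Icc (-4 : ℝ) 4, ENNReal.ofReal (Real.exp 16 * (Real.exp (-u ^ 2) * ‖P u‖ ^ 2)) := by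
        refine setLIntegral_mono' measurableSet_Icc fun u hu => ?_
        rw [← ofReal_norm, ← ENNReal.ofReal_pow (norm_nonneg _)]
        refine ENNReal.ofReal_le_ofReal ?_
        rw [← mul_assoc, ← Real.exp_add]
        refine le_mul_of_one_le_left (by positivity) (Real.one_le_exp ?_)
        nlinarith [hu.1, hu.2]
    _ ≤ ∫⁻ u, ENNReal.ofReal (Real.exp 16 * (Real.exp (-u ^ 2) * ‖P u‖ ^ 2)) :=
        setLIntegral_le_lintegral _ _
    _ = ENNReal.ofReal (Real.exp 16) * ‖∫ z, (∫ u, G u z) ∂(μ.prod μ)‖ₑ := by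
        rw [← ofReal_integral_eq_lintegral_ofReal (iP.const_mul _)
          (ae_of_all _ fun u => by positivity), integral_const_mul,
          ENNReal.ofReal_mul (Real.exp_pos _).le]
        rw [← integral_integral_swap iG]
        simp only [e1]
        rw [integral_complex_ofReal, ← ofReal_norm, Complex.norm_real, Real.norm_of_nonneg]
        exact integral_nonneg fun u => by positivity
    _ ≤ ENNReal.ofReal (Real.exp 16) * ∫⁻ z, ‖∫ u, G u z‖ₑ ∂(μ.prod μ) := by
        gcongr
        exact enorm_integral_le_lintegral_enorm _
    _ = _ := by
        simp only [e2]
        have m1 : Measurable fun z : X × X => ‖h z.1‖ₑ * ‖h z.2‖ₑ *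
            ENNReal.ofReal (Real.exp (-(θ z.1 - θ z.2) ^ 2 / 4)) := by fun_prop
        rw [lintegral_const_mul _ m1, lintegral_prod _ m1.aemeasurable, ← mul_assoc,
          ← ENNReal.ofReal_mul (Real.exp_pos _).le]

/-- Schur's test for the Gaussian kernel of a phase with derivative bounded below. -/
theorem lintegral_enorm_integral_cexp_sq_le_of_le_abs_sub {θ : ℝ → ℝ} (mθ : Measurable θ)
    {h : ℝ → ℂ} (mh : Measurable h) (bh : ∃ C : ℝ, ∀ x, ‖h x‖ ≤ C) {S : Set ℝ}
    (mS : MeasurableSet S) (hS : volume S ≠ ⊤) {b : ℝ} (hb : 0 < b)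
    (hθ : ∀ x ∈ S, ∀ y ∈ S, b * |x - y| ≤ |θ x - θ y|) :
    ∫⁻ u in Icc (-4 : ℝ) 4, ‖∫ x in S, Complex.exp (Complex.I * (u * θ x : ℝ)) * h x‖ₑ ^ 2 ≤
      ENNReal.ofReal (Real.exp 16 * Real.sqrt Real.pi * (Real.sqrt (4 * Real.pi) / b)) *
        ∫⁻ x in S, ‖h x‖ₑ ^ 2 := by
  have : IsFiniteMeasure (volume.restrict S) := ⟨by simpa using hS.lt_top⟩
  refine (lintegral_enorm_integral_cexp_sq_le (volume.restrict S) mθ mh bh).trans ?_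
  rw [ENNReal.ofReal_mul (p := Real.exp 16 * Real.sqrt Real.pi) (by positivity), mul_assoc]
  refine mul_le_mul' le_rfl ?_
  set g : ℝ → ℝ≥0∞ := fun t => ENNReal.ofReal (Real.exp (-(b ^ 2 / 4) * t ^ 2)) with hg
  have mg : Measurable g := by fun_prop
  have Ig : ∫⁻ t, g t = ENNReal.ofReal (Real.sqrt (4 * Real.pi) / b) := by
    rw [hg, ← ofReal_integral_eq_lintegral_ofReal (integrable_exp_neg_mul_sq (by positivity))
      (ae_of_all _ fun t => (Real.exp_pos _).le), integral_gaussian]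
    congr 1
    rw [show Real.pi / (b ^ 2 / 4) = 4 * Real.pi / b ^ 2 by field_simp,
      Real.sqrt_div (by positivity), Real.sqrt_sq hb.le]
  have h2 : ∀ x y : ℝ, ‖h x‖ₑ * ‖h y‖ₑ ≤ 2⁻¹ * (‖h x‖ₑ ^ 2 + ‖h y‖ₑ ^ 2) := by
    intro x y
    rw [← ofReal_norm, ← ofReal_norm, ← ENNReal.ofReal_mul (norm_nonneg _),
      ← ENNReal.ofReal_pow (norm_nonneg _), ← ENNReal.ofReal_pow (norm_nonneg _),
      ← ENNReal.ofReal_add (by positivity) (by positivity),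
      ← ENNReal.ofReal_ofNat 2, ← ENNReal.ofReal_inv_of_pos (by norm_num),
      ← ENNReal.ofReal_mul (by positivity)]
    refine ENNReal.ofReal_le_ofReal ?_
    nlinarith [sq_nonneg (‖h x‖ - ‖h y‖)]
  have mh2 : Measurable fun x => ‖h x‖ₑ ^ 2 := by fun_prop
  have key : ∀ x, ∫⁻ y in S, g (x - y) ≤ ∫⁻ t, g t := fun x =>
    (setLIntegral_le_lintegral _ _).trans (lintegral_sub_left_eq_self g x).le
  have key' : ∀ y, ∫⁻ x in S, g (x - y) ≤ ∫⁻ t, g t := fun y =>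
    (setLIntegral_le_lintegral _ _).trans (lintegral_sub_right_eq_self g y).le
  calc ∫⁻ x in S, ∫⁻ y in S, ‖h x‖ₑ * ‖h y‖ₑ * ENNReal.ofReal (Real.exp (-(θ x - θ y) ^ 2 / 4))
      ≤ ∫⁻ x in S, ∫⁻ y in S, (2⁻¹ * (‖h x‖ₑ ^ 2 * g (x - y)) + 2⁻¹ * (‖h y‖ₑ ^ 2 * g (x - y))) := by
        refine setLIntegral_mono' mS fun x hx => setLIntegral_mono' mS fun y hy => ?_
        have h3 : ENNReal.ofReal (Real.exp (-(θ x - θ y) ^ 2 / 4)) ≤ g (x - y) := by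
          refine ENNReal.ofReal_le_ofReal (Real.exp_le_exp.2 ?_)
          have := pow_le_pow_left₀ (by positivity) (hθ x hx y hy) 2
          rw [mul_pow, sq_abs, sq_abs] at this
          linarith
        refine (mul_le_mul' (h2 x y) h3).trans (le_of_eq (by ring))
    _ = 2⁻¹ * (∫⁻ x in S, ‖h x‖ₑ ^ 2 * ∫⁻ y in S, g (x - y)) +
        2⁻¹ * ∫⁻ x in S, ∫⁻ y in S, ‖h y‖ₑ ^ 2 * g (x - y) := by
        have ma : ∀ x, Measurable fun y => ‖h x‖ₑ ^ 2 * g (x - y) := fun x => by fun_prop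
        have mb : ∀ x, Measurable fun y => ‖h y‖ₑ ^ 2 * g (x - y) := fun x => by fun_prop
        have mc : Measurable fun x => ∫⁻ y in S, g (x - y) :=
          (show Measurable fun p : ℝ × ℝ => g (p.1 - p.2) by fun_prop).lintegral_prod_right'
        have md : Measurable fun x => ∫⁻ y in S, ‖h y‖ₑ ^ 2 * g (x - y) :=
          (show Measurable fun p : ℝ × ℝ => ‖h p.2‖ₑ ^ 2 * g (p.1 - p.2) by
            fun_prop).lintegral_prod_right'
        have me : Measurable fun x => ‖h x‖ₑ ^ 2 * ∫⁻ y in S, g (x - y) := mh2.mul mc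
        rw [← lintegral_const_mul _ me, ← lintegral_const_mul _ md,
          ← lintegral_add_left (me.const_mul _)]
        refine lintegral_congr fun x => ?_
        rw [lintegral_add_left ((ma x).const_mul _), lintegral_const_mul _ (ma x),
          lintegral_const_mul _ (mb x), lintegral_const_mul _ (by fun_prop)]
    _ ≤ 2⁻¹ * (∫⁻ x in S, ‖h x‖ₑ ^ 2 * ∫⁻ t, g t) + 2⁻¹ * ∫⁻ y in S, ‖h y‖ₑ ^ 2 * ∫⁻ t, g t := by
        refine add_le_add (mul_le_mul_right (lintegral_mono fun x => mul_le_mul_right (key x) _) _)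
          (mul_le_mul_right ?_ _)
        · rw [lintegral_lintegral_swap (f := fun x y => ‖h y‖ₑ ^ 2 * g (x - y))
            (by fun_prop)]
          refine lintegral_mono fun y => ?_
          rw [lintegral_const_mul _ (by fun_prop)]
          exact mul_le_mul_right (key' y) _
    _ = _ := by
        rw [lintegral_mul_const _ mh2, Ig, ← add_mul, ENNReal.inv_two_add_inv_two, one_mul, mul_comm]

/-! ### Polar coordinates -/

/-- The unit sphere of `ℝⁿ`. -/
abbrev USph (n : ℕ) := Metric.sphere (0 : Rn n) 1

/-- The surface measure of the unit sphere of `ℝⁿ`. -/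
def sphMeas (n : ℕ) : Measure (USph n) := (volume : Measure (Rn n)).toSphere

instance (n : ℕ) : IsFiniteMeasure (sphMeas n) := by unfold sphMeas; infer_instance

lemma nontrivial_Rn {n : ℕ} (hn : 0 < n) : Nontrivial (Rn n) :=
  Module.nontrivial_of_finrank_pos (R := ℝ) (by rwa [finrank_euclideanSpace_fin])

theorem lintegral_polar {n : ℕ} (hn : 0 < n) {F : Rn n → ℝ≥0∞} (hF : Measurable F) :
    ∫⁻ t, F t = ∫⁻ r in Ioi (0 : ℝ), ENNReal.ofReal (r ^ (n - 1)) *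
      ∫⁻ ω : USph n, F (r • (ω : Rn n)) ∂(sphMeas n) := by
  have := nontrivial_Rn hn
  have m1 : Measurable fun p : USph n × Ioi (0 : ℝ) => F ((p.2 : ℝ) • (p.1 : Rn n)) := by
    refine hF.comp ?_
    exact (measurable_subtype_coe.comp measurable_snd).smul
      (measurable_subtype_coe.comp measurable_fst)
  have m2 : Measurable fun r : ℝ => ∫⁻ ω : USph n, F (r • (ω : Rn n)) ∂(sphMeas n) := by
    have : Measurable fun p : ℝ × USph n => F (p.1 • (p.2 : Rn n)) :=
      hF.comp (measurable_fst.smul (measurable_subtype_coe.comp measurable_snd))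
    exact this.lintegral_prod_right'
  have e := (volume : Measure (Rn n)).measurePreserving_homeomorphUnitSphereProd
  rw [finrank_euclideanSpace_fin] at e
  have e1 := e.lintegral_comp m1
  calc ∫⁻ t, F t = ∫⁻ t in ({0}ᶜ : Set (Rn n)), F t := by rw [restrict_compl_singleton]
    _ = ∫⁻ x : ({0}ᶜ : Set (Rn n)), F x ∂(Measure.comap Subtype.val volume) :=
        (lintegral_subtype_comap (measurableSet_singleton _).compl F).symm
    _ = ∫⁻ p, F ((p.2 : ℝ) • (p.1 : Rn n)) ∂((sphMeas n).prod (Measure.volumeIoiPow (n - 1))) := by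
        rw [sphMeas, ← e1]
        refine lintegral_congr fun x => ?_
        congr 1
        have := congrArg Subtype.val ((homeomorphUnitSphereProd (Rn n)).symm_apply_apply x)
        rw [homeomorphUnitSphereProd_symm_apply_coe] at this
        exact this.symm
    _ = ∫⁻ r : Ioi (0 : ℝ), ∫⁻ ω, F ((r : ℝ) • (ω : Rn n)) ∂(sphMeas n)
          ∂(Measure.volumeIoiPow (n - 1)) := lintegral_prod_symm' _ m1
    _ = _ := by
        have m3 : Measurable fun r : Ioi (0 : ℝ) =>
          ∫⁻ ω : USph n, F ((r : ℝ) • (ω : Rn n)) ∂(sphMeas n) := m2.comp measurable_subtype_coe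
        rw [Measure.volumeIoiPow, lintegral_withDensity_eq_lintegral_mul _ (by fun_prop) m3]
        exact lintegral_subtype_comap measurableSet_Ioi (fun r : ℝ => ENNReal.ofReal (r ^ (n - 1)) *
          ∫⁻ ω : USph n, F (r • (ω : Rn n)) ∂(sphMeas n))

theorem integral_polar {n : ℕ} (hn : 0 < n) {F : Rn n → ℂ} (hF : Integrable F) :
    ∫ t, F t = ∫ r in Ioi (0 : ℝ), ((r ^ (n - 1) : ℝ) : ℂ) *
      ∫ ω : USph n, F (r • (ω : Rn n)) ∂(sphMeas n) := by
  have := nontrivial_Rn hn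
  have e := (volume : Measure (Rn n)).measurePreserving_homeomorphUnitSphereProd
  rw [finrank_euclideanSpace_fin] at e
  have hemb := (homeomorphUnitSphereProd (Rn n)).measurableEmbedding
  have e1 := e.integral_comp hemb (fun p => F ((p.2 : ℝ) • (p.1 : Rn n)))
  have hpt : ∀ x : ({0}ᶜ : Set (Rn n)), ((homeomorphUnitSphereProd (Rn n) x).2 : ℝ) •
      ((homeomorphUnitSphereProd (Rn n) x).1 : Rn n) = x := by
    intro x
    have := congrArg Subtype.val ((homeomorphUnitSphereProd (Rn n)).symm_apply_apply x)
    rwa [homeomorphUnitSphereProd_symm_apply_coe] at this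
  have i1 : Integrable (fun p : USph n × Ioi (0 : ℝ) => F ((p.2 : ℝ) • (p.1 : Rn n)))
      ((sphMeas n).prod (Measure.volumeIoiPow (n - 1))) := by
    rw [sphMeas, ← e.integrable_comp_emb hemb]
    simp only [Function.comp_def, hpt]
    exact (integrableOn_iff_comap_subtypeVal (measurableSet_singleton _).compl).1 hF.integrableOn
  calc ∫ t, F t = ∫ t in ({0}ᶜ : Set (Rn n)), F t := by rw [restrict_compl_singleton]
    _ = ∫ x : ({0}ᶜ : Set (Rn n)), F x ∂(Measure.comap Subtype.val volume) :=
        (integral_subtype_comap (measurableSet_singleton _).compl F).symm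
    _ = ∫ p, F ((p.2 : ℝ) • (p.1 : Rn n)) ∂((sphMeas n).prod (Measure.volumeIoiPow (n - 1))) := by
        rw [sphMeas, ← e1]
        simp only [hpt]
    _ = ∫ r : Ioi (0 : ℝ), ∫ ω, F ((r : ℝ) • (ω : Rn n)) ∂(sphMeas n)
          ∂(Measure.volumeIoiPow (n - 1)) := integral_prod_symm _ i1
    _ = _ := by
        simp only [Measure.volumeIoiPow, ENNReal.ofReal]
        rw [integral_withDensity_eq_integral_smul
            (measurable_subtype_coe.pow_const _).real_toNNReal,
          integral_subtype_comap measurableSet_Ioi fun a => Real.toNNReal (a ^ (n - 1)) •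
            ∫ ω : USph n, F (a • (ω : Rn n)) ∂(sphMeas n)]
        refine setIntegral_congr_fun measurableSet_Ioi fun x hx => ?_
        simp only [NNReal.smul_def, Real.coe_toNNReal _ (pow_nonneg (le_of_lt hx) _),
          Complex.real_smul]

/-! ### Measure of spherical strips -/

/-- A subset of the unit ball whose translates by multiples of `w` in a fixed direction are
pairwise disjoint has measure `O(w)`. -/
lemma volume_le_of_forall_add_smul_notMem {n : ℕ} {A : Set (Rn n)} (mA : MeasurableSet A)
    (hA : ∀ t ∈ A, ‖t‖ ≤ 1) {v : Rn n} (hv : ‖v‖ = 1) {w : ℝ} (hw : 0 < w)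
    (h : ∀ t ∈ A, ∀ x : ℝ, w ≤ x → t + x • v ∉ A) :
    volume A ≤ ENNReal.ofReal w * volume (Metric.closedBall (0 : Rn n) 2) := by
  rcases lt_or_ge 1 w with h1 | h1
  · calc volume A ≤ volume (Metric.closedBall (0 : Rn n) 2) := by
          refine measure_mono fun t ht => ?_
          have := hA t ht
          simp only [Metric.mem_closedBall, dist_zero_right]
          linarith
      _ ≤ _ := le_mul_of_one_le_left' (by simpa using h1.le)
  set N := ⌊1 / w⌋₊ with hN
  have hN1 : (N : ℝ) * w ≤ 1 := by
    have := Nat.floor_le (a := 1 / w) (by positivity)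
    rwa [le_div_iff₀ hw] at this
  have hN2 : 1 ≤ w * ((N + 1 : ℕ) : ℝ) := by
    have := (Nat.lt_floor_add_one (1 / w)).le
    rw [div_le_iff₀ hw] at this
    push_cast
    linarith
  set T : ℕ → Set (Rn n) := fun k => (fun t => t - (k * w) • v) ⁻¹' A with hT
  have mT : ∀ k, MeasurableSet (T k) := fun k => mA.preimage (by fun_prop)
  have vT : ∀ k, volume (T k) = volume A := fun k => by
    simp only [hT, sub_eq_add_neg]
    exact measure_preimage_add_right _ _ _
  have aux : ∀ i j : ℕ, i < j → Disjoint (T i) (T j) := by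
    intro i j hij
    rw [Set.disjoint_left]
    intro t hi hj
    have hij' : (i : ℝ) + 1 ≤ j := by exact_mod_cast hij
    refine h _ hj ((j - i) * w) (by nlinarith) ?_
    have : t - ((j : ℝ) * w) • v + (((j : ℝ) - i) * w) • v = t - ((i : ℝ) * w) • v := by module
    rw [this]
    exact hi
  have hdis : (Finset.range (N + 1) : Set ℕ).PairwiseDisjoint T := by
    intro i _ j _ hij
    rcases lt_or_gt_of_ne hij with h' | h'
    · exact aux i j h'
    · exact (aux j i h').symm
  have hsum := measure_biUnion_finset (μ := volume) hdis fun k _ => mT k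
  simp only [vT, Finset.sum_const, Finset.card_range, nsmul_eq_mul] at hsum
  have hsub : (⋃ k ∈ Finset.range (N + 1), T k) ⊆ Metric.closedBall (0 : Rn n) 2 := by
    refine iUnion₂_subset fun k hk t ht => ?_
    have h3 := hA _ ht
    have h4 : ‖((k : ℝ) * w) • v‖ ≤ 1 := by
      rw [norm_smul, hv, mul_one, Real.norm_of_nonneg (by positivity)]
      have : (k : ℝ) ≤ N := by exact_mod_cast Nat.lt_succ_iff.1 (Finset.mem_range.1 hk)
      nlinarith
    simp only [Metric.mem_closedBall, dist_zero_right]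
    calc ‖t‖ = ‖(t - ((k : ℝ) * w) • v) + ((k : ℝ) * w) • v‖ := by rw [sub_add_cancel]
      _ ≤ 1 + 1 := (norm_add_le _ _).trans (add_le_add h3 h4)
      _ = 2 := by norm_num
  calc volume A ≤ ENNReal.ofReal (w * ((N + 1 : ℕ) : ℝ)) * volume A :=
        le_mul_of_one_le_left' (by simpa using hN2)
    _ = ENNReal.ofReal w * volume (⋃ k ∈ Finset.range (N + 1), T k) := by
        rw [hsum, ENNReal.ofReal_mul hw.le, ENNReal.ofReal_natCast, mul_assoc]
    _ ≤ _ := by gcongr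

lemma exists_unit_orthogonal {n : ℕ} (hn : 2 ≤ n) (e : Rn n) :
    ∃ v : Rn n, ‖v‖ = 1 ∧ inner ℝ e v = 0 := by
  have h1 : Module.finrank ℝ (ℝ ∙ e) ≤ 1 := by
    simpa using finrank_span_le_card (R := ℝ) ({e} : Set (Rn n))
  have h2 := Submodule.finrank_add_finrank_orthogonal (ℝ ∙ e)
  rw [finrank_euclideanSpace_fin] at h2
  have : Nontrivial (ℝ ∙ e)ᗮ := Module.nontrivial_of_finrank_pos (R := ℝ) (by omega)
  obtain ⟨v, hv⟩ := exists_ne (0 : (ℝ ∙ e)ᗮ)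
  have hv' : (v : Rn n) ≠ 0 := by simpa using hv
  refine ⟨‖(v : Rn n)‖⁻¹ • (v : Rn n), ?_, ?_⟩
  · rw [norm_smul, norm_inv, norm_norm, inv_mul_cancel₀ (norm_ne_zero_iff.2 hv')]
  · rw [real_inner_smul_right, Submodule.mem_orthogonal_singleton_iff_inner_right.1 v.2, mul_zero]

lemma inner_sq_add_inner_sq_le {n : ℕ} {e v : Rn n} (he : ‖e‖ = 1) (hv : ‖v‖ = 1)
    (hev : inner ℝ e v = 0) (t : Rn n) :
    (inner ℝ e t : ℝ) ^ 2 + (inner ℝ v t : ℝ) ^ 2 ≤ ‖t‖ ^ 2 := by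
  set a : ℝ := inner ℝ e t with ha
  set b : ℝ := inner ℝ v t with hb
  have h0 : 0 ≤ ‖t - (a • e + b • v)‖ ^ 2 := by positivity
  have h1 : ‖t - (a • e + b • v)‖ ^ 2 = ‖t‖ ^ 2 - a ^ 2 - b ^ 2 := by
    rw [norm_sub_sq_real, norm_add_sq_real, inner_add_right, real_inner_smul_right,
      real_inner_smul_right, real_inner_smul_left, real_inner_smul_right, norm_smul, norm_smul,
      he, hv, hev, real_inner_comm, real_inner_comm v t, ← ha, ← hb, mul_one, mul_one,
      Real.norm_eq_abs, Real.norm_eq_abs, sq_abs, sq_abs]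
    ring
  linarith

lemma volume_cone_strip_le {n : ℕ} (hn : 2 ≤ n) {e : Rn n} (he : ‖e‖ = 1) {c : ℝ} (hc : |c| ≤ 1)
    {η : ℝ} (hη : 0 < η) :
    volume {t : Rn n | ‖t‖ ≤ 1 ∧ |inner ℝ e t - c * ‖t‖| ≤ η ^ 3} ≤
      ENNReal.ofReal (7 * η) * volume (Metric.closedBall (0 : Rn n) 2) := by
  obtain ⟨v, hv, hev⟩ := exists_unit_orthogonal hn e
  set A1 : Set (Rn n) := {t | ‖t‖ ≤ 1 ∧ |(inner ℝ v t : ℝ)| < η} with hA1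
  set A2 : Set (Rn n) :=
    {t | ‖t‖ ≤ 1 ∧ |inner ℝ e t - c * ‖t‖| ≤ η ^ 3 ∧ η ≤ |(inner ℝ v t : ℝ)|} with hA2
  have m0 : MeasurableSet {t : Rn n | ‖t‖ ≤ 1} := measurableSet_le measurable_norm measurable_const
  have m1 : MeasurableSet A1 := m0.inter
    (show MeasurableSet {t : Rn n | |(inner ℝ v t : ℝ)| < η} from
      measurableSet_lt (by fun_prop) (by fun_prop))
  have m2 : MeasurableSet A2 := m0.inter
    ((show MeasurableSet {t : Rn n | |inner ℝ e t - c * ‖t‖| ≤ η ^ 3} from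
      measurableSet_le (by fun_prop) (by fun_prop)).inter
    (show MeasurableSet {t : Rn n | η ≤ |(inner ℝ v t : ℝ)|} from
      measurableSet_le (by fun_prop) (by fun_prop)))
  have b1 : volume A1 ≤ ENNReal.ofReal (2 * η) * volume (Metric.closedBall (0 : Rn n) 2) := by
    refine volume_le_of_forall_add_smul_notMem m1 (fun t ht => ht.1) hv (by positivity) ?_
    rintro t ⟨_, ht⟩ x hx ⟨_, ht'⟩
    rw [inner_add_right, real_inner_smul_right, real_inner_self_eq_norm_sq, hv] at ht'
    rw [abs_lt] at ht ht'
    linarith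
  have b2 : volume A2 ≤ ENNReal.ofReal (5 * η) * volume (Metric.closedBall (0 : Rn n) 2) := by
    refine volume_le_of_forall_add_smul_notMem m2 (fun t ht => ht.1) he (by positivity) ?_
    rintro t ⟨hL, h1, h2⟩ x hx ⟨hL', h1', h2'⟩
    have q1 := inner_sq_add_inner_sq_le he hv hev t
    have q2 := inner_sq_add_inner_sq_le he hv hev (t + x • e)
    have q3 : ‖t + x • e‖ ^ 2 = ‖t‖ ^ 2 + 2 * (x * inner ℝ e t) + x ^ 2 := by
      rw [norm_add_sq_real, real_inner_smul_right, norm_smul, he, mul_one, Real.norm_eq_abs,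
        sq_abs, real_inner_comm]
    have s1 := pow_le_pow_left₀ hη.le h2 2
    have s2 := pow_le_pow_left₀ hη.le h2' 2
    rw [sq_abs] at s1 s2
    rw [inner_add_right (x := e), real_inner_smul_right, real_inner_self_eq_norm_sq, he] at q2 h1'
    have hL0 := norm_nonneg t
    have hL0' := norm_nonneg (t + x • e)
    generalize ‖t + x • e‖ = L' at *
    generalize ‖t‖ = L at *
    generalize (inner ℝ e t : ℝ) = a at *
    generalize (inner ℝ v t : ℝ) ^ 2 = y at *
    generalize (inner ℝ v (t + x • e) : ℝ) ^ 2 = y' at *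
    rw [one_pow, mul_one] at q2 h1'
    have hx0 : 0 < x := by linarith
    have aux : ∀ {M z : ℝ}, 0 ≤ M → M ≤ 1 → z ^ 2 + η ^ 2 ≤ M ^ 2 → |z| ≤ M - η ^ 2 / 2 := by
      intro M z h0 h1 h2
      refine abs_le_of_sq_le_sq (by nlinarith [sq_nonneg (η ^ 2)]) ?_
      nlinarith [sq_nonneg z, sq_nonneg η]
    have u1 := aux hL0 hL (by linarith : a ^ 2 + η ^ 2 ≤ L ^ 2)
    have u2 := aux hL0' hL' (by linarith : (a + x) ^ 2 + η ^ 2 ≤ L' ^ 2)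
    have hd : |L' - L| ≤ x * (1 - η ^ 2 / 2) := by
      have e1 : |L' - L| * (L' + L) = x * |2 * a + x| := by
        rw [← abs_of_nonneg (by linarith : (0 : ℝ) ≤ L' + L), ← abs_of_pos hx0, ← abs_mul,
          ← abs_mul, abs_of_pos hx0]
        congr 1
        nlinarith
      have e2 : |2 * a + x| ≤ L + L' - η ^ 2 := by
        calc |2 * a + x| = |a + (a + x)| := by ring_nf
          _ ≤ |a| + |a + x| := abs_add_le _ _
          _ ≤ _ := by linarith
      have hpos : 0 < L' + L := by
        have := abs_nonneg a
        nlinarith [pow_pos hη 2]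
      have e3 : |L' - L| * (L' + L) ≤ x * (1 - η ^ 2 / 2) * (L' + L) := by
        rw [e1]
        have : L + L' - η ^ 2 ≤ (1 - η ^ 2 / 2) * (L' + L) := by nlinarith [sq_nonneg η]
        calc x * |2 * a + x| ≤ x * ((1 - η ^ 2 / 2) * (L' + L)) := by
              gcongr; linarith
          _ = _ := by ring
      exact le_of_mul_le_mul_right e3 hpos
    have hx2 : x ≤ 2 * η ^ 3 + |L' - L| := by
      have e4 : x = (a + x - c * L') - (a - c * L) + c * (L' - L) := by ring
      have e5 : |c * (L' - L)| ≤ |L' - L| := by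
        rw [abs_mul]
        exact mul_le_of_le_one_left (abs_nonneg _) hc
      have := (abs_le.1 h1').2
      have := (abs_le.1 h1).1
      have := le_abs_self (c * (L' - L))
      linarith
    have : x * η ^ 2 ≤ 4 * η ^ 3 := by linarith
    nlinarith [pow_pos hη 2, pow_pos hη 3]
  calc _ ≤ volume (A1 ∪ A2) := by
        refine measure_mono fun t ht => ?_
        rcases lt_or_ge |(inner ℝ v t : ℝ)| η with h | h
        · exact Or.inl ⟨ht.1, h⟩
        · exact Or.inr ⟨ht.1, ht.2, h⟩
    _ ≤ volume A1 + volume A2 := measure_union_le _ _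
    _ ≤ _ := add_le_add b1 b2
    _ = _ := by
        rw [← add_mul, ← ENNReal.ofReal_add (by positivity) (by positivity)]
        congr 2
        ring

theorem sphMeas_strip_le {n : ℕ} (hn : 2 ≤ n) {e : Rn n} (he : ‖e‖ = 1) {c : ℝ} (hc : |c| ≤ 1)
    {η : ℝ} (hη : 0 < η) :
    sphMeas n {ω : USph n | |inner ℝ e (ω : Rn n) - c| ≤ η ^ 3} ≤
      n * (ENNReal.ofReal (7 * η) * volume (Metric.closedBall (0 : Rn n) 2)) := by
  rw [sphMeas, Measure.toSphere_apply' _ (measurableSet_le (by fun_prop) (by fun_prop)),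
    finrank_euclideanSpace_fin]
  gcongr
  refine le_trans (measure_mono ?_) (volume_cone_strip_le hn he hc hη)
  rintro _ ⟨r, ⟨hr0, hr1⟩, _, ⟨ω, hω, rfl⟩, rfl⟩
  have hω1 : ‖(ω : Rn n)‖ = 1 := by simp
  have hω' : |inner ℝ e (ω : Rn n) - c| ≤ η ^ 3 := hω
  simp only [mem_ofPred_eq]
  rw [real_inner_smul_right, norm_smul, hω1, mul_one, Real.norm_of_nonneg hr0.le]
  refine ⟨hr1.le, ?_⟩
  rw [show r * inner ℝ e (ω : Rn n) - c * r = r * (inner ℝ e (ω : Rn n) - c) by ring, abs_mul,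
    abs_of_pos hr0]
  exact (mul_le_of_le_one_left (abs_nonneg _) hr1.le).trans hω'

/-! ### The Fourier transform of a density on the sphere -/

/-- The Fourier transform of the measure `Ω dσ` on the unit sphere. -/
def sphFourier {n : ℕ} (Ω : Rn n → ℝ) (η : Rn n) : ℂ :=
  ∫ ω : USph n, Complex.exp (Complex.I * ((-(2 * Real.pi * inner ℝ (ω : Rn n) η) : ℝ) : ℂ)) *
    (Ω ω : ℂ) ∂(sphMeas n)

lemma norm_sphFourier_le {n : ℕ} {Ω : Rn n → ℝ} (mΩ : Measurable Ω) {B : ℝ}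
    (hB : ∀ ω : USph n, |Ω ω| ≤ B) (h0 : ∫ ω : USph n, Ω ω ∂(sphMeas n) = 0) (η : Rn n) :
    ‖sphFourier Ω η‖ ≤ 2 * Real.pi * ‖η‖ * B * (sphMeas n).real univ := by
  have m1 : Measurable fun ω : USph n => Ω ω := mΩ.comp measurable_subtype_coe
  have m2 : Measurable fun ω : USph n =>
      Complex.exp (Complex.I * ((-(2 * Real.pi * inner ℝ (ω : Rn n) η) : ℝ) : ℂ)) := by
    have : Measurable fun ω : USph n => (inner ℝ (ω : Rn n) η : ℝ) := by fun_prop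
    fun_prop
  have b1 : ∀ ω : USph n, ‖Complex.exp
      (Complex.I * ((-(2 * Real.pi * inner ℝ (ω : Rn n) η) : ℝ) : ℂ))‖ = 1 := fun ω => by
    rw [mul_comm]; exact Complex.norm_exp_ofReal_mul_I _
  have i1 : Integrable (fun ω : USph n => (Ω ω : ℂ)) (sphMeas n) :=
    Integrable.of_bound (Complex.measurable_ofReal.comp m1).aestronglyMeasurable B
      (Eventually.of_forall fun ω => by simpa using hB ω)
  have i2 : Integrable (fun ω : USph n => Complex.exp (Complex.I *
      ((-(2 * Real.pi * inner ℝ (ω : Rn n) η) : ℝ) : ℂ)) * (Ω ω : ℂ)) (sphMeas n) :=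
    Integrable.of_bound (m2.mul (Complex.measurable_ofReal.comp m1)).aestronglyMeasurable B
      (Eventually.of_forall fun ω => by
        rw [norm_mul, b1, one_mul]; simpa using hB ω)
  have e : sphFourier Ω η = ∫ ω : USph n, (Complex.exp (Complex.I *
      ((-(2 * Real.pi * inner ℝ (ω : Rn n) η) : ℝ) : ℂ)) - 1) * (Ω ω : ℂ) ∂(sphMeas n) := by
    simp only [sub_mul, one_mul]
    rw [integral_sub i2 i1, integral_complex_ofReal, h0]
    simp [sphFourier]
  rw [e]
  refine norm_integral_le_of_norm_le_const (Eventually.of_forall fun ω => ?_)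
  rw [norm_mul]
  have h1 := Real.norm_exp_I_mul_ofReal_sub_one_le
    (x := -(2 * Real.pi * inner ℝ (ω : Rn n) η))
  have h2 : ‖-(2 * Real.pi * (inner ℝ (ω : Rn n) η : ℝ))‖ ≤ 2 * Real.pi * ‖η‖ := by
    have := abs_real_inner_le_norm (ω : Rn n) η
    rw [show ‖(ω : Rn n)‖ = 1 by simp, one_mul] at this
    rw [norm_neg, norm_mul, Real.norm_of_nonneg (by positivity), Real.norm_eq_abs]
    gcongr
  have h3 : ‖(Ω ω : ℂ)‖ ≤ B := by simpa using hB ω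
  exact mul_le_mul (h1.trans h2) h3 (norm_nonneg _) (by positivity)

/-- The averaged decay bound `∫ |(Ω dσ)^(rη)|² dr ≲ |η|^{-1/4}`. -/
theorem exists_lintegral_sphFourier_sq_le {n : ℕ} (hn : 2 ≤ n) : ∃ C : ℝ≥0∞, C ≠ ⊤ ∧
    ∀ (Ω : Rn n → ℝ) (B : ℝ), Measurable Ω → (∀ ω : USph n, |Ω ω| ≤ B) → ∀ η : Rn n, η ≠ 0 →
      ∫⁻ r in Icc (-4 : ℝ) 4, ‖sphFourier Ω (r • η)‖ₑ ^ 2 ≤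
        C * ENNReal.ofReal (B ^ 2) * ENNReal.ofReal (‖η‖ ^ (-(1 / 4) : ℝ)) := by
  set V := volume (Metric.closedBall (0 : Rn n) 2) with hV
  set D : ℝ≥0∞ := ENNReal.ofReal (Real.exp 16 * √Real.pi) with hD
  set E : ℝ≥0∞ := n * (ENNReal.ofReal 7 * V) + sphMeas n univ with hE
  have hVt : V ≠ ⊤ := measure_closedBall_lt_top.ne
  refine ⟨D * (E * sphMeas n univ), by finiteness, ?_⟩
  intro Ω B mΩ hB η hη
  set ρ := ‖η‖ with hρ
  have hρ0 : 0 < ρ := norm_pos_iff.2 hη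
  set h := ρ ^ (-(1 / 4) : ℝ) with hh
  have h0 : 0 < h := Real.rpow_pos_of_pos hρ0 _
  have hh4 : h ^ 4 * ρ = 1 := by
    rw [hh, ← Real.rpow_natCast, ← Real.rpow_mul hρ0.le]
    norm_num
    rw [Real.rpow_neg_one]
    exact inv_mul_cancel₀ hρ0.ne'
  have m1 : Measurable fun ω : USph n => (Ω ω : ℂ) :=
    Complex.measurable_ofReal.comp (mΩ.comp measurable_subtype_coe)
  have m2 : Measurable fun ω : USph n => -(2 * Real.pi * inner ℝ (ω : Rn n) η) := by
    have : Measurable fun ω : USph n => (inner ℝ (ω : Rn n) η : ℝ) := by fun_prop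
    fun_prop
  have key := lintegral_enorm_integral_cexp_sq_le (sphMeas n) m2 m1
    ⟨B, fun ω => by simpa using hB ω⟩
  have hexp : Real.exp (-(Real.pi ^ 2 * ρ ^ 2 * h ^ 6)) ≤ h := by
    rcases le_or_gt 1 h with h1 | h1
    · exact (Real.exp_le_one_iff.2 (by simp only [Left.neg_nonpos_iff]; positivity)).trans h1
    · have a1 : 1 ≤ (Real.pi ^ 2 * ρ ^ 2 * h ^ 6) * h := by
        have : 1 ≤ Real.pi := by linarith [Real.pi_gt_three]
        have e1 : (Real.pi ^ 2 * ρ ^ 2 * h ^ 6) * h * h = Real.pi ^ 2 * (h ^ 4 * ρ) ^ 2 := by ring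
        rw [hh4] at e1
        have : 1 ≤ (Real.pi ^ 2 * ρ ^ 2 * h ^ 6) * h * h := by nlinarith
        have p : 0 ≤ (Real.pi ^ 2 * ρ ^ 2 * h ^ 6) * h := by positivity
        nlinarith
      rw [Real.exp_neg, inv_le_comm₀ (Real.exp_pos _) h0]
      have a2 := Real.add_one_le_exp (Real.pi ^ 2 * ρ ^ 2 * h ^ 6)
      have a3 : h⁻¹ ≤ Real.pi ^ 2 * ρ ^ 2 * h ^ 6 := by
        rw [inv_le_iff_one_le_mul₀ h0]; exact a1
      linarith
  set e : Rn n := ρ⁻¹ • η with he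
  have he1 : ‖e‖ = 1 := by
    rw [he, norm_smul, norm_inv, Real.norm_of_nonneg hρ0.le, ← hρ, inv_mul_cancel₀ hρ0.ne']
  have inner_eq : ∀ ω : Rn n, (inner ℝ ω η : ℝ) = ρ * inner ℝ e ω := by
    intro ω
    rw [he, real_inner_smul_left, real_inner_comm, ← mul_assoc, mul_inv_cancel₀ hρ0.ne', one_mul]
  have inner_bd : ∀ x : USph n, ∫⁻ y : USph n, ENNReal.ofReal (Real.exp
      (-(-(2 * Real.pi * inner ℝ (x : Rn n) η) - -(2 * Real.pi * inner ℝ (y : Rn n) η)) ^ 2 / 4))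
      ∂(sphMeas n) ≤ E * ENNReal.ofReal h := by
    intro x
    set c : ℝ := inner ℝ e (x : Rn n) with hc
    have hc1 : |c| ≤ 1 := by
      have := abs_real_inner_le_norm e (x : Rn n)
      rwa [he1, show ‖(x : Rn n)‖ = 1 by simp, one_mul] at this
    set S : Set (USph n) := {ω : USph n | |inner ℝ e (ω : Rn n) - c| ≤ h ^ 3} with hS
    have mS : MeasurableSet S := measurableSet_le (by fun_prop) (by fun_prop)
    calc _ ≤ ∫⁻ y : USph n, (S.indicator 1 y + ENNReal.ofReal h) ∂(sphMeas n) := by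
          refine lintegral_mono fun y => ?_
          by_cases hy : y ∈ S
          · rw [indicator_of_mem hy]
            refine le_trans ?_ (le_add_of_nonneg_right zero_le)
            rw [Pi.one_apply, ← ENNReal.ofReal_one]
            refine ENNReal.ofReal_le_ofReal (Real.exp_le_one_iff.2 ?_)
            have := sq_nonneg (-(2 * Real.pi * (inner ℝ (x : Rn n) η : ℝ)) -
              -(2 * Real.pi * inner ℝ (y : Rn n) η))
            linarith
          · rw [indicator_of_notMem hy, zero_add]
            refine ENNReal.ofReal_le_ofReal (le_trans (Real.exp_le_exp.2 ?_) hexp)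
            have hy' : h ^ 3 < |inner ℝ e (y : Rn n) - c| := not_le.1 hy
            have hy2 := pow_le_pow_left₀ (by positivity) hy'.le 2
            rw [sq_abs] at hy2
            rw [inner_eq, inner_eq, ← hc]
            have : Real.pi ^ 2 * ρ ^ 2 * (h ^ 3) ^ 2 ≤
              Real.pi ^ 2 * ρ ^ 2 * ((inner ℝ e (y : Rn n) - c) ^ 2) := by gcongr
            nlinarith
      _ = sphMeas n S + ENNReal.ofReal h * sphMeas n univ := by
          rw [lintegral_add_right _ measurable_const, lintegral_indicator_one mS, lintegral_const]
      _ ≤ n * (ENNReal.ofReal (7 * h) * V) + ENNReal.ofReal h * sphMeas n univ := by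
          gcongr
          exact sphMeas_strip_le hn he1 hc1 h0
      _ = _ := by
          rw [ENNReal.ofReal_mul (by norm_num), hE]; ring
  calc ∫⁻ r in Icc (-4 : ℝ) 4, ‖sphFourier Ω (r • η)‖ₑ ^ 2
      = ∫⁻ u in Icc (-4 : ℝ) 4, ‖∫ ω : USph n, Complex.exp (Complex.I *
          (u * -(2 * Real.pi * inner ℝ (ω : Rn n) η) : ℝ)) * (Ω ω : ℂ) ∂(sphMeas n)‖ₑ ^ 2 := by
        refine lintegral_congr fun u => ?_
        rw [sphFourier]
        congr 4; funext ω
        rw [real_inner_smul_right]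
        congr 4
        ring
    _ ≤ _ := key
    _ ≤ D * ∫⁻ x : USph n, ∫⁻ y : USph n, ENNReal.ofReal (B ^ 2) * ENNReal.ofReal (Real.exp
        (-(-(2 * Real.pi * inner ℝ (x : Rn n) η) - -(2 * Real.pi * inner ℝ (y : Rn n) η)) ^ 2 / 4))
        ∂(sphMeas n) ∂(sphMeas n) := by
        refine mul_le_mul_right ?_ _
        refine lintegral_mono fun x => lintegral_mono fun y => ?_
        refine mul_le_mul_left ?_ _
        have hb : ∀ z : USph n, ‖(Ω z : ℂ)‖ₑ ≤ ENNReal.ofReal B := fun z => by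
          rw [← ofReal_norm]
          exact ENNReal.ofReal_le_ofReal (by simpa using hB z)
        have hB0 : 0 ≤ B := (abs_nonneg _).trans (hB x)
        rw [pow_two, ENNReal.ofReal_mul hB0]
        exact mul_le_mul' (hb x) (hb y)
    _ ≤ D * ∫⁻ _x : USph n, ENNReal.ofReal (B ^ 2) * (E * ENNReal.ofReal h) ∂(sphMeas n) := by
        refine mul_le_mul_right (lintegral_mono fun x => ?_) _
        have : Measurable fun y : USph n => (inner ℝ (y : Rn n) η : ℝ) := by fun_prop
        rw [lintegral_const_mul _ (by fun_prop)]
        exact mul_le_mul_right (inner_bd x) _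
    _ = _ := by
        rw [lintegral_const]; ring

/-! ### Averaged bounds for a single oscillatory kernel -/

lemma lintegral_comp_smul_pos {n : ℕ} {s : ℝ} (hs : 0 < s) {w : Rn n → ℝ≥0∞} (hw : Measurable w) :
    ∫⁻ t, w (s • t) = ENNReal.ofReal ((s ^ n)⁻¹) * ∫⁻ t, w t := by
  rw [← lintegral_map hw (measurable_const_smul s), Measure.map_addHaar_smul _ hs.ne',
    lintegral_smul_measure, finrank_euclideanSpace_fin, abs_of_pos (by positivity), smul_eq_mul]

lemma integrable_of_bdd_of_closedBall {n : ℕ} {F : Rn n → ℂ} (mF : Measurable F) {C ρ : ℝ}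
    (bF : ∀ t, ‖F t‖ ≤ C) (sF : ∀ t, ρ < ‖t‖ → F t = 0) : Integrable F := by
  have : IsFiniteMeasure ((volume : Measure (Rn n)).restrict (Metric.closedBall 0 ρ)) :=
    ⟨by simpa using measure_closedBall_lt_top⟩
  have h : IntegrableOn F (Metric.closedBall 0 ρ) :=
    Integrable.of_bound mF.aestronglyMeasurable C (Eventually.of_forall bF)
  refine (integrableOn_iff_integrable_of_support_subset fun t ht => ?_).1 h
  simp only [Metric.mem_closedBall, dist_zero_right]
  exact not_lt.1 fun h' => ht (sF t h')

theorem lintegral_enorm_integral_radial_phase_le {n : ℕ} (hn : 0 < n) {θ : ℝ → ℝ}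
    (mθ : Measurable θ) {b : ℝ} (hb : 0 < b)
    (hθ : ∀ x ∈ Icc (1 / 2 : ℝ) 2, ∀ y ∈ Icc (1 / 2 : ℝ) 2, b * |x - y| ≤ |θ x - θ y|)
    {F : Rn n → ℂ} (mF : Measurable F) (bF : ∃ C : ℝ, ∀ t, ‖F t‖ ≤ C)
    (sF : ∀ t, ‖t‖ ∉ Icc (1 / 2 : ℝ) 2 → F t = 0) :
    ∫⁻ u in Icc (1 / 2 : ℝ) 4, ‖∫ t, Complex.exp (Complex.I * (u * θ ‖t‖ : ℝ)) * F t‖ₑ ^ 2 ≤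
      ENNReal.ofReal (Real.exp 16 * √Real.pi * (√(4 * Real.pi) / b)) *
        ∫⁻ r in Icc (1 / 2 : ℝ) 2, (ENNReal.ofReal (r ^ (n - 1)) *
          ‖∫ ω : USph n, F (r • (ω : Rn n)) ∂(sphMeas n)‖ₑ) ^ 2 := by
  obtain ⟨C, hC⟩ := bF
  set S := Icc (1 / 2 : ℝ) 2 with hS
  have mS : MeasurableSet S := measurableSet_Icc
  set h0 : ℝ → ℂ := fun r => ((r ^ (n - 1) : ℝ) : ℂ) *
    ∫ ω : USph n, F (r • (ω : Rn n)) ∂(sphMeas n) with hh0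
  have mh0 : Measurable h0 := by
    have : Measurable fun p : ℝ × USph n => F (p.1 • (p.2 : Rn n)) :=
      mF.comp (measurable_fst.smul (measurable_subtype_coe.comp measurable_snd))
    have := this.stronglyMeasurable.integral_prod_right' (ν := sphMeas n)
    have := this.measurable
    fun_prop
  have bh : ∃ C', ∀ r, ‖S.indicator h0 r‖ ≤ C' := by
    refine ⟨2 ^ (n - 1) * (C * (sphMeas n).real univ), fun r => ?_⟩
    have hC0 : 0 ≤ C := (norm_nonneg _).trans (hC 0)
    by_cases hr : r ∈ S
    · rw [indicator_of_mem hr, hh0]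
      simp only
      have r0 : 0 ≤ r := by linarith [hr.1]
      rw [norm_mul, Complex.norm_real, Real.norm_of_nonneg (by positivity)]
      gcongr
      · exact hr.2
      · exact norm_integral_le_of_norm_le_const (Eventually.of_forall fun ω => hC _)
    · rw [indicator_of_notMem hr, norm_zero]; positivity
  have key := lintegral_enorm_integral_cexp_sq_le_of_le_abs_sub mθ (mh0.indicator mS) bh mS
    (by rw [hS]; simp) hb hθ
  have Fz : ∀ r ∈ Ioi (0 : ℝ), r ∉ S → ∀ ω : USph n, F (r • (ω : Rn n)) = 0 := by
    intro r hr hrS ω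
    refine sF _ ?_
    rwa [norm_smul, show ‖(ω : Rn n)‖ = 1 by simp, mul_one, Real.norm_of_nonneg (le_of_lt hr)]
  have polar : ∀ u : ℝ, ∫ t, Complex.exp (Complex.I * (u * θ ‖t‖ : ℝ)) * F t =
      ∫ r in S, Complex.exp (Complex.I * (u * θ r : ℝ)) * S.indicator h0 r := by
    intro u
    have mexp : Measurable fun t : Rn n => Complex.exp (Complex.I * (u * θ ‖t‖ : ℝ)) := by
      have := mθ.comp (measurable_norm (α := Rn n))
      simp only [Function.comp_def] at this
      fun_prop
    have h_intg : Integrable fun t : Rn n => Complex.exp (Complex.I * (u * θ ‖t‖ : ℝ)) * F t := by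
      refine integrable_of_bdd_of_closedBall (C := C) (ρ := 2) (mexp.mul mF) (fun t => ?_)
        fun t ht => ?_
      · rw [norm_mul, mul_comm Complex.I, Complex.norm_exp_ofReal_mul_I, one_mul]; exact hC t
      · rw [sF t fun h => absurd h.2 (not_le.2 ht), mul_zero]
    rw [integral_polar hn h_intg]
    have e1 : ∀ r ∈ Ioi (0 : ℝ), ((r ^ (n - 1) : ℝ) : ℂ) * ∫ ω : USph n,
        Complex.exp (Complex.I * (u * θ ‖r • (ω : Rn n)‖ : ℝ)) * F (r • (ω : Rn n)) ∂(sphMeas n) =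
        S.indicator (fun r => Complex.exp (Complex.I * (u * θ r : ℝ)) * S.indicator h0 r) r := by
      intro r hr
      by_cases hrS : r ∈ S
      · rw [indicator_of_mem hrS, indicator_of_mem hrS, hh0]
        simp only
        have : ∀ ω : USph n, ‖r • (ω : Rn n)‖ = r := fun ω => by
          rw [norm_smul, show ‖(ω : Rn n)‖ = 1 by simp, mul_one, Real.norm_of_nonneg (le_of_lt hr)]
        simp only [this]
        rw [integral_const_mul]
        ring
      · rw [indicator_of_notMem hrS]
        simp [Fz r hr hrS]
    rw [setIntegral_congr_fun measurableSet_Ioi e1, integral_indicator mS,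
      Measure.restrict_restrict mS]
    congr 2
    exact inter_eq_left.2 fun r hr => lt_of_lt_of_le (by norm_num) hr.1
  simp only [polar]
  refine (lintegral_mono_set (Icc_subset_Icc (by norm_num) le_rfl)).trans (key.trans (le_of_eq ?_))
  congr 1
  refine setLIntegral_congr_fun mS fun r hr => ?_
  have r0 : 0 ≤ r := by linarith [hr.1]
  simp only [indicator_of_mem hr, hh0]
  rw [enorm_mul, ← ofReal_norm (((r ^ (n - 1) : ℝ) : ℂ)), Complex.norm_real,
    Real.norm_of_nonneg (by positivity)]

lemma enorm_integral_sq_le {X : Type*} [MeasurableSpace X] (μ : Measure X) {h : X → ℂ}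
    (mh : Measurable h) : ‖∫ x, h x ∂μ‖ₑ ^ 2 ≤ μ univ * ∫⁻ x, ‖h x‖ₑ ^ 2 ∂μ := by
  refine (pow_le_pow_left' (enorm_integral_le_lintegral_enorm _) 2).trans ?_
  have := ENNReal.lintegral_mul_le_Lp_mul_Lq μ Real.HolderConjugate.two_two (f := fun _ => 1)
    (g := fun y => ‖h y‖ₑ) aemeasurable_const mh.enorm.aemeasurable
  simp only [Pi.mul_apply, one_mul, lintegral_const, ENNReal.rpow_ofNat] at this
  refine (pow_le_pow_left' this 2).trans (le_of_eq ?_)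
  have h3 : ∀ z : ℝ≥0∞, (z ^ (1 / 2 : ℝ)) ^ 2 = z := by
    intro z
    rw [← ENNReal.rpow_ofNat, ← ENNReal.rpow_mul]
    norm_num
  rw [mul_pow, h3, h3, one_pow, one_mul]

theorem lintegral_enorm_integral_radial_phase_le_lintegral {n : ℕ} (hn : 0 < n) {θ : ℝ → ℝ}
    (mθ : Measurable θ) {b : ℝ} (hb : 0 < b)
    (hθ : ∀ x ∈ Icc (1 / 2 : ℝ) 2, ∀ y ∈ Icc (1 / 2 : ℝ) 2, b * |x - y| ≤ |θ x - θ y|)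
    {F : Rn n → ℂ} (mF : Measurable F) (bF : ∃ C : ℝ, ∀ t, ‖F t‖ ≤ C)
    (sF : ∀ t, ‖t‖ ∉ Icc (1 / 2 : ℝ) 2 → F t = 0) :
    ∫⁻ u in Icc (1 / 2 : ℝ) 4, ‖∫ t, Complex.exp (Complex.I * (u * θ ‖t‖ : ℝ)) * F t‖ₑ ^ 2 ≤
      ENNReal.ofReal (Real.exp 16 * √Real.pi * (√(4 * Real.pi) / b)) *
        (ENNReal.ofReal (2 ^ (n - 1)) * sphMeas n univ * ∫⁻ t, ‖F t‖ₑ ^ 2) := by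
  refine (lintegral_enorm_integral_radial_phase_le hn mθ hb hθ mF bF sF).trans
    (mul_le_mul_right ?_ _)
  have mF2 : Measurable fun t => ‖F t‖ₑ ^ 2 := by fun_prop
  have m2 : Measurable fun r : ℝ => ∫⁻ ω : USph n, ‖F (r • (ω : Rn n))‖ₑ ^ 2 ∂(sphMeas n) := by
    have : Measurable fun p : ℝ × USph n => ‖F (p.1 • (p.2 : Rn n))‖ₑ ^ 2 :=
      mF2.comp (measurable_fst.smul (measurable_subtype_coe.comp measurable_snd))
    exact this.lintegral_prod_right'
  rw [lintegral_polar hn mF2, ← lintegral_const_mul _ (by fun_prop)]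
  refine le_trans (setLIntegral_mono (by fun_prop) fun r hr => ?_)
    (lintegral_mono_set (fun r (hr : r ∈ Icc (1 / 2 : ℝ) 2) => lt_of_lt_of_le (by norm_num) hr.1))
  have mr : Measurable fun ω : USph n => F (r • (ω : Rn n)) :=
    mF.comp ((measurable_const_smul r).comp measurable_subtype_coe)
  have h1 : ENNReal.ofReal (r ^ (n - 1)) ≤ ENNReal.ofReal (2 ^ (n - 1)) :=
    ENNReal.ofReal_le_ofReal (pow_le_pow_left₀ (by linarith [hr.1]) hr.2 _)
  calc _ = ENNReal.ofReal (r ^ (n - 1)) * ENNReal.ofReal (r ^ (n - 1)) *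
        ‖∫ ω : USph n, F (r • (ω : Rn n)) ∂(sphMeas n)‖ₑ ^ 2 := by ring
    _ ≤ ENNReal.ofReal (2 ^ (n - 1)) * ENNReal.ofReal (r ^ (n - 1)) *
        (sphMeas n univ * ∫⁻ ω : USph n, ‖F (r • (ω : Rn n))‖ₑ ^ 2 ∂(sphMeas n)) :=
        mul_le_mul' (mul_le_mul_left h1 _) (enorm_integral_sq_le _ mr)
    _ = _ := by ring

/-- A bounded function, homogeneous of degree zero, with mean value zero on the sphere. -/
structure SphData {n : ℕ} (Ω : Rn n → ℝ) (B : ℝ) : Prop where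
  meas : Measurable Ω
  bdd : ∀ t, |Ω t| ≤ B
  hom : ∀ c : ℝ, 0 < c → ∀ t, Ω (c • t) = Ω t
  mean : ∫ ω : USph n, Ω ω ∂(sphMeas n) = 0

/-- A radial phase `θ` with derivative comparable to `lam` and an amplitude `a` on `[1/2, 2]`. -/
structure RadData (θ θ₁ θ₂ a a₁ : ℝ → ℝ) (lam c B : ℝ) : Prop where
  c_pos : 0 < c
  one_le : 1 ≤ lam
  meas : Measurable θ
  meas_a : Measurable a
  supp : ∀ r, a r ≠ 0 → r ∈ Icc (1 / 2 : ℝ) 2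
  bdd : ∀ r, |a r| ≤ B
  deriv_phase : ∀ r ∈ Icc (1 / 2 : ℝ) 2, HasDerivAt θ (θ₁ r) r
  deriv_phase₁ : ∀ r ∈ Icc (1 / 2 : ℝ) 2, HasDerivAt θ₁ (θ₂ r) r
  cont_phase₂ : ContinuousOn θ₂ (Icc (1 / 2 : ℝ) 2)
  le_phase₁ : ∀ r ∈ Icc (1 / 2 : ℝ) 2, c * lam ≤ θ₁ r
  abs_phase₂_le : ∀ r ∈ Icc (1 / 2 : ℝ) 2, |θ₂ r| ≤ B * lam
  deriv_amp : ∀ r ∈ Icc (1 / 2 : ℝ) 2, HasDerivAt a (a₁ r) r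
  cont_amp₁ : ContinuousOn a₁ (Icc (1 / 2 : ℝ) 2)
  abs_amp₁_le : ∀ r ∈ Icc (1 / 2 : ℝ) 2, |a₁ r| ≤ B

/-- The modulated kernel `e^{iuθ(|t|)} a(|t|) Ω(t)`. -/
def radKer {n : ℕ} (θ a : ℝ → ℝ) (Ω : Rn n → ℝ) (u : ℝ) (t : Rn n) : ℂ :=
  Complex.exp (Complex.I * (u * θ ‖t‖ : ℝ)) * ((a ‖t‖ * Ω t : ℝ) : ℂ)

/-- The measure `lam du` on `[1/2, 4]`. -/
def freqMeas (lam : ℝ) : Measure ℝ := ENNReal.ofReal lam • volume.restrict (Icc (1 / 2 : ℝ) 4)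

instance (lam : ℝ) : IsFiniteMeasure (freqMeas lam) := by
  have : IsFiniteMeasure (volume.restrict (Icc (1 / 2 : ℝ) 4)) := ⟨by simp⟩
  exact ⟨by
    rw [freqMeas, Measure.smul_apply, smul_eq_mul]
    exact ENNReal.mul_lt_top ENNReal.ofReal_lt_top (measure_lt_top _ _)⟩

lemma lintegral_freqMeas (lam : ℝ) (F : ℝ → ℝ≥0∞) :
    ∫⁻ u, F u ∂(freqMeas lam) = ENNReal.ofReal lam * ∫⁻ u in Icc (1 / 2 : ℝ) 4, F u := by
  rw [freqMeas, lintegral_smul_measure, smul_eq_mul]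

section
variable {θ θ₁ θ₂ a a₁ : ℝ → ℝ} {lam c B : ℝ} {n : ℕ} {Ω : Rn n → ℝ}

lemma RadData.B_nonneg (h : RadData θ θ₁ θ₂ a a₁ lam c B) : 0 ≤ B := (abs_nonneg _).trans (h.bdd 0)

lemma RadData.lam_pos (h : RadData θ θ₁ θ₂ a a₁ lam c B) : 0 < lam := zero_lt_one.trans_le h.one_le

lemma RadData.amp_eq_zero (h : RadData θ θ₁ θ₂ a a₁ lam c B) {r : ℝ}
    (hr : r ∉ Icc (1 / 2 : ℝ) 2) : a r = 0 := by
  by_contra h'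
  exact hr (h.supp r h')

lemma RadData.mul_abs_sub_le (h : RadData θ θ₁ θ₂ a a₁ lam c B) :
    ∀ x ∈ Icc (1 / 2 : ℝ) 2, ∀ y ∈ Icc (1 / 2 : ℝ) 2, c * lam * |x - y| ≤ |θ x - θ y| := by
  have key : ∀ x ∈ Icc (1 / 2 : ℝ) 2, ∀ y ∈ Icc (1 / 2 : ℝ) 2, x ≤ y →
      c * lam * (y - x) ≤ θ y - θ x := by
    refine Convex.mul_sub_le_image_sub_of_le_deriv (convex_Icc _ _)
      (fun x hx => (h.deriv_phase x hx).continuousAt.continuousWithinAt)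
      (fun x hx => (h.deriv_phase x (interior_subset hx)).differentiableAt.differentiableWithinAt)
      fun x hx => ?_
    rw [(h.deriv_phase x (interior_subset hx)).deriv]
    exact h.le_phase₁ x (interior_subset hx)
  intro x hx y hy
  rcases le_total x y with hxy | hxy
  · rw [abs_sub_comm, abs_sub_comm (θ x), abs_of_nonneg (sub_nonneg.2 hxy)]
    exact (key x hx y hy hxy).trans (le_abs_self _)
  · rw [abs_of_nonneg (sub_nonneg.2 hxy)]
    exact (key y hy x hx hxy).trans (le_abs_self _)

lemma measurable_uncurry_radKer (h : RadData θ θ₁ θ₂ a a₁ lam c B) (hΩ : Measurable Ω) :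
    Measurable (Function.uncurry (radKer θ a Ω)) := by
  have m1 : Measurable fun p : ℝ × Rn n => θ ‖p.2‖ := h.meas.comp (by fun_prop)
  have m2 : Measurable fun p : ℝ × Rn n => a ‖p.2‖ := h.meas_a.comp (by fun_prop)
  have m3 : Measurable fun p : ℝ × Rn n => Ω p.2 := hΩ.comp measurable_snd
  have : Measurable fun p : ℝ × Rn n => Complex.exp (Complex.I * (p.1 * θ ‖p.2‖ : ℝ)) *
    ((a ‖p.2‖ * Ω p.2 : ℝ) : ℂ) := by
    have m4 := Complex.measurable_ofReal.comp (measurable_fst.mul m1)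
    exact (Complex.measurable_exp.comp (m4.const_mul _)).mul
      (Complex.measurable_ofReal.comp (m2.mul m3))
  exact this

lemma norm_radKer (u : ℝ) (t : Rn n) : ‖radKer θ a Ω u t‖ = |a ‖t‖ * Ω t| := by
  rw [radKer, norm_mul, mul_comm Complex.I, Complex.norm_exp_ofReal_mul_I, one_mul,
    Complex.norm_real, Real.norm_eq_abs]

lemma radKer_eq_zero (h : RadData θ θ₁ θ₂ a a₁ lam c B) (u : ℝ) {t : Rn n}
    (ht : ‖t‖ ∉ Icc (1 / 2 : ℝ) 2) : radKer θ a Ω u t = 0 := by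
  simp [radKer, h.amp_eq_zero ht]

lemma bddInt_radKer (h : RadData θ θ₁ θ₂ a a₁ lam c B) {B' : ℝ} (hΩ : SphData Ω B') (u : ℝ) :
    BddInt (radKer θ a Ω u) := by
  have m : Measurable (radKer θ a Ω u) :=
    (measurable_uncurry_radKer h hΩ.meas).comp measurable_prodMk_left
  have b : ∀ t, ‖radKer θ a Ω u t‖ ≤ B * B' := fun t => by
    rw [norm_radKer, abs_mul]
    exact mul_le_mul (h.bdd _) (hΩ.bdd _) (abs_nonneg _) h.B_nonneg
  exact ⟨m, ⟨_, b⟩, integrable_of_bdd_of_closedBall m b (ρ := 2)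
    fun t ht => radKer_eq_zero h u fun h' => absurd h'.2 (not_le.2 ht)⟩

lemma measurable_uncurry_dil {s : ℝ} {κ : ℝ → Rn n → ℂ} (hκ : Measurable (Function.uncurry κ)) :
    Measurable (Function.uncurry fun u => dil s (κ u)) := by
  have : Measurable fun p : ℝ × Rn n => Function.uncurry κ (p.1, s⁻¹ • p.2) :=
    hκ.comp (by fun_prop)
  exact this.const_mul _

lemma cv_dil {s : ℝ} (hs : 0 < s) (G κ : Rn n → ℂ) (x : Rn n) :
    cv G (dil s κ) x = ∫ t, G (x - s • t) * κ t := by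
  have := integral_dil hs fun t => G (x - s • t) * κ t
  rw [← this]
  unfold cv
  congr 1
  funext t
  simp only [dil]
  rw [smul_inv_smul₀ hs.ne']
  ring

theorem exists_lintegral_cv_dil_radKer_le (hn : 0 < n) (c B B' : ℝ) : ∃ A : ℝ≥0∞, A ≠ ⊤ ∧
    ∀ {θ θ₁ θ₂ a a₁ : ℝ → ℝ} {lam : ℝ} {Ω : Rn n → ℝ}, RadData θ θ₁ θ₂ a a₁ lam c B →
      SphData Ω B' → ∀ s : ℝ, 0 < s → ∀ G, BddInt G → ∀ x,
      ∫⁻ u, ‖cv G (dil s (radKer θ a Ω u)) x‖ₑ ^ 2 ∂(freqMeas lam) ≤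
        A * ballAvg (2 * s) (fun y => ‖G y‖ₑ ^ 2) x := by
  refine ⟨ENNReal.ofReal (Real.exp 16 * √Real.pi * (√(4 * Real.pi) / c)) *
    (ENNReal.ofReal (2 ^ (n - 1)) * sphMeas n univ * (ENNReal.ofReal (B * B') ^ 2 *
      ENNReal.ofReal (2 ^ n))), by finiteness, ?_⟩
  intro θ θ₁ θ₂ a a₁ lam Ω h hΩ s hs G hG x
  set F : Rn n → ℂ := fun t => G (x - s • t) * ((a ‖t‖ * Ω t : ℝ) : ℂ) with hF
  have hBa : ∀ t, ‖((a ‖t‖ * Ω t : ℝ) : ℂ)‖ ≤ B * B' := fun t => by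
    rw [Complex.norm_real, Real.norm_eq_abs, abs_mul]
    exact mul_le_mul (h.bdd _) (hΩ.bdd _) (abs_nonneg _) h.B_nonneg
  have mF : Measurable F := by
    have m1 : Measurable fun t : Rn n => G (x - s • t) := hG.meas.comp (by fun_prop)
    have m2 : Measurable fun t : Rn n => a ‖t‖ := h.meas_a.comp measurable_norm
    have m3 := hΩ.meas
    exact m1.mul (Complex.measurable_ofReal.comp (m2.mul m3))
  have sF : ∀ t, ‖t‖ ∉ Icc (1 / 2 : ℝ) 2 → F t = 0 := fun t ht => by
    simp [hF, h.amp_eq_zero ht]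
  have bF : ∃ C : ℝ, ∀ t, ‖F t‖ ≤ C := by
    obtain ⟨C, hC⟩ := hG.bdd
    exact ⟨C * (B * B'), fun t => by
      rw [hF, norm_mul]
      exact mul_le_mul (hC _) (hBa t) (norm_nonneg _) ((norm_nonneg _).trans (hC 0))⟩
  have e1 : ∀ u, cv G (dil s (radKer θ a Ω u)) x =
      ∫ t, Complex.exp (Complex.I * (u * θ ‖t‖ : ℝ)) * F t := fun u => by
    rw [cv_dil hs]
    congr 1; funext t
    simp only [radKer, hF]; ring
  have key := lintegral_enorm_integral_radial_phase_le_lintegral hn h.meas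
    (mul_pos h.c_pos h.lam_pos) h.mul_abs_sub_le mF bF sF
  set w : Rn n → ℝ≥0∞ := fun y => ‖G y‖ₑ ^ 2 with hw
  have mw : Measurable w := by have := hG.meas; fun_prop
  have hFw : ∫⁻ t, ‖F t‖ₑ ^ 2 ≤ ENNReal.ofReal (B * B') ^ 2 * ENNReal.ofReal (2 ^ n) *
      ballAvg (2 * s) w x := by
    set W : Rn n → ℝ≥0∞ := fun y => (Metric.closedBall x (2 * s)).indicator w (x - y) with hW
    have mW : Measurable W := (mw.indicator measurableSet_closedBall).comp (by fun_prop)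
    calc ∫⁻ t, ‖F t‖ₑ ^ 2 ≤ ∫⁻ t, ENNReal.ofReal (B * B') ^ 2 * W (s • t) := by
          refine lintegral_mono fun t => ?_
          by_cases ht : ‖t‖ ∈ Icc (1 / 2 : ℝ) 2
          · have hm : x - s • t ∈ Metric.closedBall x (2 * s) := by
              rw [Metric.mem_closedBall, dist_eq_norm, sub_sub_cancel_left, norm_neg, norm_smul,
                Real.norm_of_nonneg hs.le, mul_comm]
              exact mul_le_mul_of_nonneg_right ht.2 hs.le
            simp only [hW, indicator_of_mem hm, hF, hw]
            rw [enorm_mul, mul_pow, mul_comm]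
            refine mul_le_mul_left (pow_le_pow_left' ?_ 2) _
            rw [← ofReal_norm]
            exact ENNReal.ofReal_le_ofReal (hBa t)
          · simp [sF t ht]
      _ = ENNReal.ofReal (B * B') ^ 2 * (ENNReal.ofReal ((s ^ n)⁻¹) *
          ∫⁻ y in Metric.closedBall x (2 * s), w y) := by
          rw [lintegral_const_mul _ (show Measurable fun t => W (s • t) from
              mW.comp (measurable_const_smul s)),
            lintegral_comp_smul_pos hs mW, hW, lintegral_sub_left_eq_self
            (fun y => (Metric.closedBall x (2 * s)).indicator w y) x,
            lintegral_indicator measurableSet_closedBall]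
      _ = _ := by
          rw [ballAvg, mul_assoc, ← mul_assoc (ENNReal.ofReal (2 ^ n)),
            ← ENNReal.ofReal_mul (by positivity)]
          congr 3
          rw [mul_pow]
          field_simp
  rw [lintegral_freqMeas]
  simp only [e1]
  calc _ ≤ ENNReal.ofReal lam * (ENNReal.ofReal (Real.exp 16 * √Real.pi *
        (√(4 * Real.pi) / (c * lam))) * (ENNReal.ofReal (2 ^ (n - 1)) * sphMeas n univ *
          (ENNReal.ofReal (B * B') ^ 2 * ENNReal.ofReal (2 ^ n) * ballAvg (2 * s) w x))) :=
        mul_le_mul_right (key.trans (mul_le_mul_right (mul_le_mul_right hFw _) _)) _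
    _ = ENNReal.ofReal (lam * (Real.exp 16 * √Real.pi * (√(4 * Real.pi) / (c * lam)))) *
        (ENNReal.ofReal (2 ^ (n - 1)) * sphMeas n univ *
          (ENNReal.ofReal (B * B') ^ 2 * ENNReal.ofReal (2 ^ n) * ballAvg (2 * s) w x)) := by
        rw [ENNReal.ofReal_mul (p := lam) h.lam_pos.le, mul_assoc (ENNReal.ofReal lam)]
    _ = _ := by
        have : lam * (Real.exp 16 * √Real.pi * (√(4 * Real.pi) / (c * lam))) =
            Real.exp 16 * √Real.pi * (√(4 * Real.pi) / c) := by
          have := h.lam_pos.ne'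
          have := h.c_pos.ne'
          field_simp
        rw [this]; ring

end

/-- A first-derivative van der Corput estimate. -/
lemma norm_integral_cexp_mul_le {φ φ₁ φ₂ b b₁ : ℝ → ℝ} {m B B₂ : ℝ} (hm : 0 < m)
    (hφ : ∀ x ∈ Icc (1 / 2 : ℝ) 2, HasDerivAt φ (φ₁ x) x)
    (hφ₁ : ∀ x ∈ Icc (1 / 2 : ℝ) 2, HasDerivAt φ₁ (φ₂ x) x)
    (cφ₂ : ContinuousOn φ₂ (Icc (1 / 2 : ℝ) 2))
    (lφ : ∀ x ∈ Icc (1 / 2 : ℝ) 2, m ≤ φ₁ x) (uφ : ∀ x ∈ Icc (1 / 2 : ℝ) 2, |φ₂ x| ≤ B₂ * m)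
    (hb : ∀ x ∈ Icc (1 / 2 : ℝ) 2, HasDerivAt b (b₁ x) x)
    (cb₁ : ContinuousOn b₁ (Icc (1 / 2 : ℝ) 2)) (ub : ∀ x ∈ Icc (1 / 2 : ℝ) 2, |b x| ≤ B)
    (ub₁ : ∀ x ∈ Icc (1 / 2 : ℝ) 2, |b₁ x| ≤ B) :
    ‖∫ x in (1 / 2 : ℝ)..2, Complex.exp (Complex.I * (φ x : ℝ)) * (b x : ℂ)‖ ≤
      (2 * B + (B + B * B₂) * (3 / 2)) / m := by
  have hI : uIcc (1 / 2 : ℝ) 2 = Icc (1 / 2 : ℝ) 2 := uIcc_of_le (by norm_num)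
  have h12 : (1 / 2 : ℝ) ∈ Icc (1 / 2 : ℝ) 2 := by norm_num
  have h22 : (2 : ℝ) ∈ Icc (1 / 2 : ℝ) 2 := by norm_num
  have hB : 0 ≤ B := (abs_nonneg _).trans (ub _ h12)
  have pos : ∀ x ∈ Icc (1 / 2 : ℝ) 2, 0 < φ₁ x := fun x hx => hm.trans_le (lφ x hx)
  have cφ : ContinuousOn φ (Icc (1 / 2 : ℝ) 2) :=
    fun x hx => (hφ x hx).continuousAt.continuousWithinAt
  have cφ₁ : ContinuousOn φ₁ (Icc (1 / 2 : ℝ) 2) :=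
    fun x hx => (hφ₁ x hx).continuousAt.continuousWithinAt
  have cb : ContinuousOn b (Icc (1 / 2 : ℝ) 2) :=
    fun x hx => (hb x hx).continuousAt.continuousWithinAt
  set q : ℝ → ℝ := fun x => b x / φ₁ x with hq
  set q₁ : ℝ → ℝ := fun x => (b₁ x * φ₁ x - b x * φ₂ x) / φ₁ x ^ 2 with hq₁
  have dq : ∀ x ∈ Icc (1 / 2 : ℝ) 2, HasDerivAt q (q₁ x) x := fun x hx =>
    (hb x hx).div (hφ₁ x hx) (pos x hx).ne'
  have cq₁ : ContinuousOn q₁ (Icc (1 / 2 : ℝ) 2) :=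
    ((cb₁.mul cφ₁).sub (cb.mul cφ₂)).div (cφ₁.pow 2) fun x hx => by have := pos x hx; positivity
  set v : ℝ → ℂ := fun x => -Complex.I * Complex.exp (Complex.I * (φ x : ℝ)) with hv
  have dv : ∀ x ∈ Icc (1 / 2 : ℝ) 2,
      HasDerivAt v (Complex.exp (Complex.I * (φ x : ℝ)) * (φ₁ x : ℂ)) x := fun x hx => by
    have h1 := (((hφ x hx).ofReal_comp.const_mul Complex.I).cexp).const_mul (-Complex.I)
    refine h1.congr_deriv ?_
    linear_combination (-Complex.exp (Complex.I * (φ x : ℝ)) * (φ₁ x : ℂ)) * Complex.I_sq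
  have nv : ∀ x, ‖v x‖ = 1 := fun x => by
    rw [hv, norm_mul, mul_comm Complex.I, Complex.norm_exp_ofReal_mul_I]; simp
  have cexp : ContinuousOn (fun x => Complex.exp (Complex.I * (φ x : ℝ))) (Icc (1 / 2 : ℝ) 2) :=
    (continuousOn_const.mul (Complex.continuous_ofReal.comp_continuousOn cφ)).cexp
  have ibp := intervalIntegral.integral_mul_deriv_eq_deriv_mul (a := (1 / 2 : ℝ)) (b := 2)
    (u := fun x => (q x : ℂ)) (v := v) (u' := fun x => (q₁ x : ℂ))
    (v' := fun x => Complex.exp (Complex.I * (φ x : ℝ)) * (φ₁ x : ℂ))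
    (fun x hx => (dq x (hI ▸ hx)).ofReal_comp) (fun x hx => dv x (hI ▸ hx))
    (ContinuousOn.intervalIntegrable (by
      rw [hI]; exact Complex.continuous_ofReal.comp_continuousOn cq₁))
    (ContinuousOn.intervalIntegrable (by
      rw [hI]; exact cexp.mul (Complex.continuous_ofReal.comp_continuousOn cφ₁)))
  have e1 : ∫ x in (1 / 2 : ℝ)..2, Complex.exp (Complex.I * (φ x : ℝ)) * (b x : ℂ) =
      ∫ x in (1 / 2 : ℝ)..2, (q x : ℂ) * (Complex.exp (Complex.I * (φ x : ℝ)) * (φ₁ x : ℂ)) := by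
    refine intervalIntegral.integral_congr fun x hx => ?_
    have := (pos x (hI ▸ hx)).ne'
    have h2 : ((φ₁ x : ℝ) : ℂ) ≠ 0 := by exact_mod_cast this
    simp only [hq]
    push_cast
    field_simp
  have bq : ∀ x ∈ Icc (1 / 2 : ℝ) 2, |q x| ≤ B / m := fun x hx => by
    rw [hq, abs_div, abs_of_pos (pos x hx)]
    exact div_le_div₀ hB (ub x hx) hm (lφ x hx)
  have bq₁ : ∀ x ∈ Icc (1 / 2 : ℝ) 2, |q₁ x| ≤ (B + B * B₂) / m := fun x hx => by
    have hp := pos x hx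
    have hl := lφ x hx
    have e : q₁ x = b₁ x / φ₁ x - b x * φ₂ x / φ₁ x ^ 2 := by
      simp only [hq₁]; field_simp
    rw [e, add_div]
    refine (abs_sub _ _).trans (add_le_add ?_ ?_)
    · rw [abs_div, abs_of_pos hp]
      exact div_le_div₀ hB (ub₁ x hx) hm hl
    · rw [abs_div, abs_mul, abs_of_pos (pow_pos hp 2)]
      calc |b x| * |φ₂ x| / φ₁ x ^ 2 ≤ B * (B₂ * m) / m ^ 2 := by
            have h3 : |b x| * |φ₂ x| ≤ B * (B₂ * m) :=
              mul_le_mul (ub x hx) (uφ x hx) (abs_nonneg _) hB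
            exact div_le_div₀ ((by positivity : 0 ≤ |b x| * |φ₂ x|).trans h3) h3 (by positivity)
              (pow_le_pow_left₀ hm.le hl 2)
        _ = B * B₂ / m := by field_simp
  rw [e1, ibp]
  have n1 : ∀ x ∈ Icc (1 / 2 : ℝ) 2, ‖(q x : ℂ) * v x‖ ≤ B / m := fun x hx => by
    rw [norm_mul, nv, mul_one, Complex.norm_real]; exact bq x hx
  have n2 : ‖∫ x in (1 / 2 : ℝ)..2, (q₁ x : ℂ) * v x‖ ≤ (B + B * B₂) / m * |2 - 1 / 2| := by
    refine intervalIntegral.norm_integral_le_of_norm_le_const fun x hx => ?_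
    rw [norm_mul, nv, mul_one, Complex.norm_real]
    exact bq₁ x (hI ▸ uIoc_subset_uIcc hx)
  calc _ ≤ ‖(q 2 : ℂ) * v 2‖ + ‖(q (1 / 2) : ℂ) * v (1 / 2)‖ +
        ‖∫ x in (1 / 2 : ℝ)..2, (q₁ x : ℂ) * v x‖ :=
        (norm_sub_le _ _).trans (add_le_add (norm_sub_le _ _) le_rfl)
    _ ≤ B / m + B / m + (B + B * B₂) / m * |2 - 1 / 2| :=
        add_le_add (add_le_add (n1 _ h22) (n1 _ h12)) n2
    _ = _ := by
        rw [abs_of_pos (by norm_num)]; ring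

section
variable {n : ℕ} {Ω : Rn n → ℝ} {B B' c lam : ℝ} {θ θ₁ θ₂ a a₁ : ℝ → ℝ}

/-- The character `e^{-2πi⟨t,η⟩}` times the amplitude of a modulated kernel. -/
def ampChar (a : ℝ → ℝ) (Ω : Rn n → ℝ) (η t : Rn n) : ℂ :=
  Complex.exp (Complex.I * ((-(2 * Real.pi * inner ℝ t η) : ℝ) : ℂ)) * ((a ‖t‖ * Ω t : ℝ) : ℂ)

lemma fourier_radKer (θ a : ℝ → ℝ) (Ω : Rn n → ℝ) (u : ℝ) (η : Rn n) :
    𝓕 (radKer θ a Ω u) η = ∫ t, Complex.exp (Complex.I * (u * θ ‖t‖ : ℝ)) * ampChar a Ω η t := by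
  rw [Real.fourier_eq]
  congr 1
  funext t
  rw [Circle.smul_def, Real.fourierChar_apply, radKer, ampChar, smul_eq_mul]
  have : Complex.exp (((2 * Real.pi * -inner ℝ t η : ℝ) : ℂ) * Complex.I) =
      Complex.exp (Complex.I * ((-(2 * Real.pi * inner ℝ t η) : ℝ) : ℂ)) := by
    congr 1; push_cast; ring
  rw [this]
  ring

lemma measurable_cexp_inner (η : Rn n) : Measurable fun t : Rn n =>
    Complex.exp (Complex.I * ((-(2 * Real.pi * inner ℝ t η) : ℝ) : ℂ)) := by
  have : Measurable fun t : Rn n => (inner ℝ t η : ℝ) := by fun_prop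
  fun_prop

lemma measurable_ampChar (ha : Measurable a) (hΩ : Measurable Ω) (η : Rn n) :
    Measurable (ampChar a Ω η) := by
  have m2 : Measurable fun t : Rn n => a ‖t‖ := ha.comp measurable_norm
  exact (measurable_cexp_inner η).mul (Complex.measurable_ofReal.comp (m2.mul hΩ))

lemma norm_ampChar_le (h : RadData θ θ₁ θ₂ a a₁ lam c B) (hΩ : SphData Ω B') (η t : Rn n) :
    ‖ampChar a Ω η t‖ ≤ B * B' := by
  rw [ampChar, norm_mul, mul_comm Complex.I, Complex.norm_exp_ofReal_mul_I, one_mul,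
    Complex.norm_real, Real.norm_eq_abs, abs_mul]
  exact mul_le_mul (h.bdd _) (hΩ.bdd _) (abs_nonneg _) h.B_nonneg

lemma integral_sphere_ampChar (hΩ : SphData Ω B') (η : Rn n) {r : ℝ} (hr : 0 < r) :
    ∫ ω : USph n, ampChar a Ω η (r • (ω : Rn n)) ∂(sphMeas n) =
      (a r : ℂ) * sphFourier Ω (r • η) := by
  rw [sphFourier, ← integral_const_mul]
  congr 1
  funext ω
  rw [ampChar, hΩ.hom r hr, norm_smul, show ‖(ω : Rn n)‖ = 1 by simp, mul_one,
    Real.norm_of_nonneg hr.le, real_inner_smul_left, real_inner_smul_right]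
  push_cast
  ring

theorem exists_lintegral_fourier_radKer_le_mm (hn : 2 ≤ n) (c B B' : ℝ) : ∃ C : ℝ≥0∞, C ≠ ⊤ ∧
    ∀ {θ θ₁ θ₂ a a₁ : ℝ → ℝ} {lam : ℝ} {Ω : Rn n → ℝ}, RadData θ θ₁ θ₂ a a₁ lam c B →
      SphData Ω B' → ∀ η : Rn n,
      ∫⁻ u, ‖𝓕 (radKer θ a Ω u) η‖ₑ ^ 2 ∂(freqMeas lam) ≤
        C * ENNReal.ofReal (mm ‖η‖ ^ (1 / 4 : ℝ)) := by
  obtain ⟨C₁, hC₁, H₁⟩ := exists_lintegral_sphFourier_sq_le hn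
  set D := ENNReal.ofReal (Real.exp 16 * √Real.pi * (√(4 * Real.pi) / c)) with hD
  set E := ENNReal.ofReal (2 ^ (n - 1) * B) ^ 2 with hE
  set Z := C₁ * ENNReal.ofReal (B' ^ 2) + ENNReal.ofReal (4 * Real.pi * B' *
    (sphMeas n).real univ) ^ 2 * 2 with hZ
  refine ⟨D * (E * Z), by finiteness, ?_⟩
  intro θ θ₁ θ₂ a a₁ lam Ω h hΩ η
  have hB' : 0 ≤ B' := (abs_nonneg _).trans (hΩ.bdd 0)
  have n0 : 0 < n := by omega
  have key := lintegral_enorm_integral_radial_phase_le n0 h.meas (mul_pos h.c_pos h.lam_pos)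
    h.mul_abs_sub_le (measurable_ampChar h.meas_a hΩ.meas η)
    ⟨_, norm_ampChar_le h hΩ η⟩ (fun t ht => by simp [ampChar, h.amp_eq_zero ht])
  have mS : MeasurableSet (Icc (1 / 2 : ℝ) 2) := measurableSet_Icc
  have b1 : ∫⁻ r in Icc (1 / 2 : ℝ) 2, ‖sphFourier Ω (r • η)‖ₑ ^ 2 ≤
      Z * ENNReal.ofReal (mm ‖η‖ ^ (1 / 4 : ℝ)) := by
    rcases le_or_gt ‖η‖ 1 with h1 | h1
    · have hmm : mm ‖η‖ = ‖η‖ := by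
        rcases (norm_nonneg η).eq_or_lt with h0 | h0
        · rw [← h0]; simp [mm]
        · exact min_eq_left (h1.trans ((one_le_inv₀ h0).2 h1))
      have hpt : ∀ r ∈ Icc (1 / 2 : ℝ) 2, ‖sphFourier Ω (r • η)‖ₑ ^ 2 ≤
          ENNReal.ofReal (4 * Real.pi * B' * (sphMeas n).real univ) ^ 2 *
            ENNReal.ofReal (mm ‖η‖ ^ (1 / 4 : ℝ)) := by
        intro r hr
        have r0 : 0 ≤ r := by linarith [hr.1]
        have e1 := norm_sphFourier_le hΩ.meas (fun ω => hΩ.bdd ω) hΩ.mean (r • η)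
        have e2 : ‖sphFourier Ω (r • η)‖ ≤ (4 * Real.pi * B' * (sphMeas n).real univ) * ‖η‖ := by
          refine e1.trans ?_
          rw [norm_smul, Real.norm_of_nonneg r0]
          have : 2 * Real.pi * (r * ‖η‖) * B' * (sphMeas n).real univ ≤
            2 * Real.pi * (2 * ‖η‖) * B' * (sphMeas n).real univ := by
              gcongr; exact hr.2
          linarith
        rw [← ofReal_norm, ← ENNReal.ofReal_pow (norm_nonneg _),
          ← ENNReal.ofReal_pow (by positivity), ← ENNReal.ofReal_mul (by positivity)]
        refine ENNReal.ofReal_le_ofReal ?_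
        refine (pow_le_pow_left₀ (norm_nonneg _) e2 2).trans ?_
        rw [mul_pow, hmm]
        gcongr
        rw [← Real.rpow_natCast]
        exact Real.rpow_le_rpow_of_exponent_ge' (norm_nonneg _) h1 (by norm_num) (by norm_num)
      calc _ ≤ ∫⁻ r in Icc (1 / 2 : ℝ) 2,
            ENNReal.ofReal (4 * Real.pi * B' * (sphMeas n).real univ) ^ 2 *
            ENNReal.ofReal (mm ‖η‖ ^ (1 / 4 : ℝ)) := setLIntegral_mono measurable_const hpt
        _ = ENNReal.ofReal (4 * Real.pi * B' * (sphMeas n).real univ) ^ 2 *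
            ENNReal.ofReal (2 - 1 / 2) * ENNReal.ofReal (mm ‖η‖ ^ (1 / 4 : ℝ)) := by
            rw [setLIntegral_const, Real.volume_Icc]; ring
        _ ≤ _ := by
            refine mul_le_mul_left (le_trans ?_ (le_add_of_nonneg_left zero_le)) _
            refine mul_le_mul_right ?_ _
            rw [show (2 : ℝ≥0∞) = ENNReal.ofReal 2 by simp]
            exact ENNReal.ofReal_le_ofReal (by norm_num)
    · have hη : η ≠ 0 := fun h0 => by rw [h0, norm_zero] at h1; linarith
      have h0 : 0 < ‖η‖ := by linarith
      have hmm : mm ‖η‖ = ‖η‖⁻¹ := min_eq_right (((inv_le_one₀ h0).2 h1.le).trans h1.le)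
      have e1 := H₁ Ω B' hΩ.meas (fun ω => hΩ.bdd ω) η hη
      have e2 : mm ‖η‖ ^ (1 / 4 : ℝ) = ‖η‖ ^ (-(1 / 4) : ℝ) := by
        rw [hmm, Real.inv_rpow h0.le, Real.rpow_neg h0.le]
      rw [e2]
      refine (lintegral_mono_set (Icc_subset_Icc (by norm_num) (by norm_num))).trans (e1.trans ?_)
      exact mul_le_mul_left (le_add_of_nonneg_right zero_le) _
  have b2 : ∫⁻ r in Icc (1 / 2 : ℝ) 2, (ENNReal.ofReal (r ^ (n - 1)) *
      ‖∫ ω : USph n, ampChar a Ω η (r • (ω : Rn n)) ∂(sphMeas n)‖ₑ) ^ 2 ≤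
      E * ∫⁻ r in Icc (1 / 2 : ℝ) 2, ‖sphFourier Ω (r • η)‖ₑ ^ 2 := by
    rw [← lintegral_const_mul' _ _ (by rw [hE]; finiteness)]
    refine setLIntegral_mono' mS fun r hr => ?_
    have r0 : 0 < r := by linarith [hr.1]
    rw [integral_sphere_ampChar hΩ η r0, enorm_mul, ← mul_assoc, mul_pow]
    refine mul_le_mul_left (pow_le_pow_left' ?_ 2) _
    rw [← ofReal_norm (a r : ℂ), Complex.norm_real, Real.norm_eq_abs,
      ← ENNReal.ofReal_mul (by positivity)]
    refine ENNReal.ofReal_le_ofReal ?_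
    exact mul_le_mul (pow_le_pow_left₀ r0.le hr.2 _) (h.bdd r) (abs_nonneg _) (by positivity)
  rw [lintegral_freqMeas]
  simp only [fourier_radKer]
  calc _ ≤ ENNReal.ofReal lam * (ENNReal.ofReal (Real.exp 16 * √Real.pi *
        (√(4 * Real.pi) / (c * lam))) * (E * (Z * ENNReal.ofReal (mm ‖η‖ ^ (1 / 4 : ℝ))))) :=
        mul_le_mul_right (key.trans (mul_le_mul_right (b2.trans (mul_le_mul_right b1 _)) _)) _
    _ = ENNReal.ofReal (lam * (Real.exp 16 * √Real.pi * (√(4 * Real.pi) / (c * lam)))) *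
        (E * (Z * ENNReal.ofReal (mm ‖η‖ ^ (1 / 4 : ℝ)))) := by
        rw [ENNReal.ofReal_mul (p := lam) h.lam_pos.le, mul_assoc (ENNReal.ofReal lam)]
    _ = _ := by
        have : lam * (Real.exp 16 * √Real.pi * (√(4 * Real.pi) / (c * lam))) =
            Real.exp 16 * √Real.pi * (√(4 * Real.pi) / c) := by
          have := h.lam_pos.ne'
          have := h.c_pos.ne'
          field_simp
        rw [this, ← hD]; ring

end

section
variable {n : ℕ} {Ω : Rn n → ℝ} {B B' c lam : ℝ} {θ θ₁ θ₂ a a₁ : ℝ → ℝ}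

lemma norm_integral_radial_le (h : RadData θ θ₁ θ₂ a a₁ lam c B) {u : ℝ}
    (hu : u ∈ Icc (1 / 2 : ℝ) 4) {y : ℝ} (hy : |y| ≤ c * lam / (8 * Real.pi)) :
    ‖∫ r in (1 / 2 : ℝ)..2, Complex.exp (Complex.I * ((u * θ r - 2 * Real.pi * y * r : ℝ) : ℂ)) *
      ((r ^ (n - 1) * a r : ℝ) : ℂ)‖ ≤
      (2 * ((n + 1) * 2 ^ n * B) + ((n + 1) * 2 ^ n * B + ((n + 1) * 2 ^ n * B) * (16 * B / c)) *
        (3 / 2)) / (c * lam / 4) := by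
  have hc := h.c_pos
  have hl := h.lam_pos
  have hB := h.B_nonneg
  have u0 : 0 < u := by linarith [hu.1]
  have p2 : ∀ k ≤ n, (2 : ℝ) ^ k ≤ 2 ^ n := fun k hk => pow_le_pow_right₀ (by norm_num) hk
  have pr : ∀ r ∈ Icc (1 / 2 : ℝ) 2, ∀ k ≤ n, |r ^ k| ≤ 2 ^ n := fun r hr k hk => by
    have r0 : 0 ≤ r := by linarith [hr.1]
    rw [abs_of_nonneg (by positivity)]
    exact (pow_le_pow_left₀ r0 hr.2 k).trans (p2 k hk)
  refine norm_integral_cexp_mul_le (φ := fun r => u * θ r - 2 * Real.pi * y * r)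
    (φ₁ := fun r => u * θ₁ r - 2 * Real.pi * y) (φ₂ := fun r => u * θ₂ r)
    (b := fun r => r ^ (n - 1) * a r)
    (b₁ := fun r => ((n - 1 : ℕ) : ℝ) * r ^ (n - 1 - 1) * a r + r ^ (n - 1) * a₁ r)
    (by positivity) (fun r hr => ?_) (fun r hr => ?_) (continuousOn_const.mul h.cont_phase₂)
    (fun r hr => ?_) (fun r hr => ?_) (fun r hr => ?_) ?_ (fun r hr => ?_) (fun r hr => ?_)
  · exact ((h.deriv_phase r hr).const_mul u).sub
      (by simpa using (hasDerivAt_id r).const_mul (2 * Real.pi * y))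
  · exact ((h.deriv_phase₁ r hr).const_mul u).sub_const _
  · have h1 := h.le_phase₁ r hr
    have h2 : 2 * Real.pi * y ≤ c * lam / 4 := by
      have := (le_abs_self y).trans hy
      rw [le_div_iff₀ (by positivity)] at this
      linarith
    have h3 : 1 / 2 * (c * lam) ≤ u * θ₁ r := mul_le_mul hu.1 h1 (by positivity) u0.le
    linarith
  · rw [abs_mul, abs_of_pos u0]
    calc u * |θ₂ r| ≤ 4 * (B * lam) :=
          mul_le_mul hu.2 (h.abs_phase₂_le r hr) (abs_nonneg _) (by norm_num)
      _ = 16 * B / c * (c * lam / 4) := by field_simp; ring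
  · exact (hasDerivAt_pow (n - 1) r).mul (h.deriv_amp r hr)
  · have ca : ContinuousOn a (Icc (1 / 2 : ℝ) 2) :=
      fun r hr => (h.deriv_amp r hr).continuousAt.continuousWithinAt
    have := h.cont_amp₁
    fun_prop
  · rw [abs_mul]
    calc |r ^ (n - 1)| * |a r| ≤ 2 ^ n * B :=
          mul_le_mul (pr r hr _ (by omega)) (h.bdd r) (abs_nonneg _) (by positivity)
      _ ≤ (n + 1) * 2 ^ n * B := by
          have : 0 ≤ 2 ^ n * B := by positivity
          nlinarith [(Nat.cast_nonneg n : (0 : ℝ) ≤ n)]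
  · refine (abs_add_le _ _).trans ?_
    rw [abs_mul, abs_mul, abs_mul, Nat.abs_cast]
    have e1 : ((n - 1 : ℕ) : ℝ) ≤ n := by exact_mod_cast Nat.sub_le n 1
    calc ((n - 1 : ℕ) : ℝ) * |r ^ (n - 1 - 1)| * |a r| + |r ^ (n - 1)| * |a₁ r|
        ≤ n * 2 ^ n * B + 2 ^ n * B := by
          refine add_le_add (mul_le_mul (mul_le_mul e1 (pr r hr _ (by omega)) (abs_nonneg _)
            (by positivity)) (h.bdd r) (abs_nonneg _) (by positivity))
            (mul_le_mul (pr r hr _ (by omega)) (h.abs_amp₁_le r hr) (abs_nonneg _) (by positivity))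
      _ = _ := by ring

theorem norm_fourier_radKer_le (hn : 0 < n) (h : RadData θ θ₁ θ₂ a a₁ lam c B)
    (hΩ : SphData Ω B') {u : ℝ} (hu : u ∈ Icc (1 / 2 : ℝ) 4) {η : Rn n}
    (hη : ‖η‖ ≤ c * lam / (8 * Real.pi)) :
    ‖𝓕 (radKer θ a Ω u) η‖ ≤ (B' * ((2 * ((n + 1) * 2 ^ n * B) + ((n + 1) * 2 ^ n * B +
      ((n + 1) * 2 ^ n * B) * (16 * B / c)) * (3 / 2)) / (c / 4)) * (sphMeas n).real univ) /
        lam := by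
  set Y := (2 * ((n + 1) * 2 ^ n * B) + ((n + 1) * 2 ^ n * B +
      ((n + 1) * 2 ^ n * B) * (16 * B / c)) * (3 / 2)) with hY
  set S := Icc (1 / 2 : ℝ) 2 with hS
  have mS : MeasurableSet S := measurableSet_Icc
  have : IsFiniteMeasure (volume.restrict S) := ⟨by simp [hS]⟩
  set H : ℝ → USph n → ℂ := fun r ω =>
    Complex.exp (Complex.I * ((u * θ r - 2 * Real.pi * inner ℝ (ω : Rn n) η * r : ℝ) : ℂ)) *
      ((r ^ (n - 1) * a r : ℝ) : ℂ) * (Ω ω : ℂ) with hH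
  have mH : Measurable (Function.uncurry H) := by
    have m1 : Measurable fun p : ℝ × USph n => θ p.1 := h.meas.comp measurable_fst
    have m2 : Measurable fun p : ℝ × USph n => a p.1 := h.meas_a.comp measurable_fst
    have m3 : Measurable fun p : ℝ × USph n => Ω p.2 :=
      hΩ.meas.comp (measurable_subtype_coe.comp measurable_snd)
    have m4 : Measurable fun p : ℝ × USph n => (inner ℝ (p.2 : Rn n) η : ℝ) := by fun_prop
    have m5 : Measurable fun p : ℝ × USph n =>
        u * θ p.1 - 2 * Real.pi * inner ℝ (p.2 : Rn n) η * p.1 :=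
      (m1.const_mul u).sub ((m4.const_mul _).mul measurable_fst)
    exact ((Complex.measurable_exp.comp ((Complex.measurable_ofReal.comp m5).const_mul _)).mul
      (Complex.measurable_ofReal.comp ((measurable_fst.pow_const _).mul m2))).mul
      (Complex.measurable_ofReal.comp m3)
  have iH : Integrable (Function.uncurry H) ((volume.restrict S).prod (sphMeas n)) := by
    refine Integrable.of_bound mH.aestronglyMeasurable (2 ^ (n - 1) * B * B') ?_
    have : ∀ᵐ p ∂((volume.restrict S).prod (sphMeas n)), p.1 ∈ S :=
      Measure.quasiMeasurePreserving_fst.ae (ae_restrict_mem mS)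
    filter_upwards [this] with p hp
    have r0 : 0 ≤ p.1 := by linarith [hp.1]
    simp only [Function.uncurry, hH]
    rw [norm_mul, norm_mul, mul_comm Complex.I, Complex.norm_exp_ofReal_mul_I, one_mul,
      Complex.norm_real, Complex.norm_real, Real.norm_eq_abs, Real.norm_eq_abs, abs_mul,
      abs_of_nonneg (pow_nonneg r0 _)]
    have hB := h.B_nonneg
    exact mul_le_mul (mul_le_mul (pow_le_pow_left₀ r0 hp.2 _) (h.bdd _) (abs_nonneg _)
      (by positivity)) (hΩ.bdd _) (abs_nonneg _) (by positivity)
  have mexp : Measurable fun t : Rn n => Complex.exp (Complex.I * (u * θ ‖t‖ : ℝ)) := by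
    have m1 : Measurable fun t : Rn n => θ ‖t‖ := h.meas.comp measurable_norm
    exact Complex.measurable_exp.comp ((Complex.measurable_ofReal.comp
      (m1.const_mul u)).const_mul _)
  have h_intg : Integrable fun t : Rn n =>
      Complex.exp (Complex.I * (u * θ ‖t‖ : ℝ)) * ampChar a Ω η t := by
    refine integrable_of_bdd_of_closedBall (C := B * B') (ρ := 2)
      (mexp.mul (measurable_ampChar h.meas_a hΩ.meas η)) (fun t => ?_) fun t ht => ?_
    · rw [norm_mul, mul_comm Complex.I, Complex.norm_exp_ofReal_mul_I, one_mul]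
      exact norm_ampChar_le h hΩ η t
    · rw [ampChar, h.amp_eq_zero fun h => absurd h.2 (not_le.2 ht)]; simp
  have e0 : ∀ r ∈ Ioi (0 : ℝ), ((r ^ (n - 1) : ℝ) : ℂ) * ∫ ω : USph n,
      Complex.exp (Complex.I * (u * θ ‖r • (ω : Rn n)‖ : ℝ)) * ampChar a Ω η (r • (ω : Rn n))
        ∂(sphMeas n) = S.indicator (fun r => ∫ ω, H r ω ∂(sphMeas n)) r := by
    intro r hr
    by_cases hrS : r ∈ S
    · rw [indicator_of_mem hrS, ← integral_const_mul]
      congr 1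
      funext ω
      rw [ampChar, hΩ.hom r hr, norm_smul, show ‖(ω : Rn n)‖ = 1 by simp, mul_one,
        Real.norm_of_nonneg (le_of_lt hr), real_inner_smul_left, hH]
      simp only
      have : Complex.exp (Complex.I * ((u * θ r - 2 * Real.pi * inner ℝ (ω : Rn n) η * r : ℝ) : ℂ))
          = Complex.exp (Complex.I * (u * θ r : ℝ)) * Complex.exp
            (Complex.I * ((-(2 * Real.pi * (r * inner ℝ (ω : Rn n) η)) : ℝ) : ℂ)) := by
        rw [← Complex.exp_add]
        congr 1
        push_cast
        ring
      rw [this]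
      push_cast
      ring
    · rw [indicator_of_notMem hrS]
      have : ∀ ω : USph n, ‖r • (ω : Rn n)‖ = r := fun ω => by
        rw [norm_smul, show ‖(ω : Rn n)‖ = 1 by simp, mul_one, Real.norm_of_nonneg (le_of_lt hr)]
      simp [ampChar, this, h.amp_eq_zero hrS]
  have hSI : S ∩ Ioi (0 : ℝ) = S :=
    inter_eq_left.2 fun r hr => lt_of_lt_of_le (by norm_num : (0 : ℝ) < 1 / 2) hr.1
  have e1 : 𝓕 (radKer θ a Ω u) η = ∫ ω, (∫ r in S, H r ω) ∂(sphMeas n) := by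
    rw [fourier_radKer, integral_polar hn h_intg, setIntegral_congr_fun measurableSet_Ioi e0,
      integral_indicator mS, Measure.restrict_restrict mS,
      hSI]
    exact integral_integral_swap iH
  have e2 : ∀ ω : USph n, ‖∫ r in S, H r ω‖ ≤ B' * (Y / (c / 4)) / lam := by
    intro ω
    have hy : |(inner ℝ (ω : Rn n) η : ℝ)| ≤ c * lam / (8 * Real.pi) := by
      have := abs_real_inner_le_norm (ω : Rn n) η
      rw [show ‖(ω : Rn n)‖ = 1 by simp, one_mul] at this
      exact this.trans hη
    have := norm_integral_radial_le (n := n) h hu hy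
    simp only [hH]
    rw [integral_mul_const, norm_mul, hS, integral_Icc_eq_integral_Ioc,
      ← intervalIntegral.integral_of_le (by norm_num), Complex.norm_real, Real.norm_eq_abs, mul_comm]
    have hc := h.c_pos.ne'
    have hl := h.lam_pos.ne'
    calc _ ≤ B' * (Y / (c * lam / 4)) := mul_le_mul (hΩ.bdd _) this (norm_nonneg _)
          ((abs_nonneg _).trans (hΩ.bdd 0))
      _ = _ := by field_simp
  rw [e1]
  refine (norm_integral_le_of_norm_le_const (Eventually.of_forall e2)).trans (le_of_eq ?_)
  ring

theorem exists_lintegral_fourier_radKer_le (hn : 2 ≤ n) (c B B' : ℝ) : ∃ C : ℝ≥0∞, C ≠ ⊤ ∧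
    ∀ {θ θ₁ θ₂ a a₁ : ℝ → ℝ} {lam : ℝ} {Ω : Rn n → ℝ}, RadData θ θ₁ θ₂ a a₁ lam c B →
      SphData Ω B' → ∀ η : Rn n,
      ∫⁻ u, ‖𝓕 (radKer θ a Ω u) η‖ₑ ^ 2 ∂(freqMeas lam) ≤
        C * ENNReal.ofReal (lam ^ (-(1 / 8) : ℝ)) * ENNReal.ofReal (mm ‖η‖ ^ (1 / 8 : ℝ)) := by
  rcases le_or_gt c 0 with hc | hc
  · exact ⟨0, by simp, fun h => absurd h.c_pos (not_lt.2 hc)⟩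
  obtain ⟨C₁, hC₁, H₁⟩ := exists_lintegral_fourier_radKer_le_mm hn c B B'
  set E := B' * ((2 * ((n + 1) * 2 ^ n * B) + ((n + 1) * 2 ^ n * B +
      ((n + 1) * 2 ^ n * B) * (16 * B / c)) * (3 / 2)) / (c / 4)) * (sphMeas n).real univ with hE
  set C₂ : ℝ≥0∞ := ENNReal.ofReal (E ^ 2) * 4 with hC₂
  set c₁ := c / (8 * Real.pi) with hc₁
  have c₁0 : 0 < c₁ := by positivity
  refine ⟨C₁ + C₂ + C₁ * ENNReal.ofReal (c₁ ^ (-(1 / 8) : ℝ)), by finiteness, ?_⟩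
  intro θ θ₁ θ₂ a a₁ lam Ω h hΩ η
  have h1 := H₁ h hΩ η
  set X := ∫⁻ u, ‖𝓕 (radKer θ a Ω u) η‖ₑ ^ 2 ∂(freqMeas lam) with hX
  set m := mm ‖η‖ with hm
  have m0 : 0 ≤ m := mm_nonneg (norm_nonneg _)
  have l0 := h.lam_pos
  have split : ∀ x : ℝ, 0 ≤ x → x ^ (1 / 4 : ℝ) = x ^ (1 / 8 : ℝ) * x ^ (1 / 8 : ℝ) := by
    intro x hx
    rw [← Real.rpow_add_of_nonneg hx (by norm_num) (by norm_num)]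
    norm_num
  have inv8 : ∀ x : ℝ, 0 < x → x ^ (-(1 / 8) : ℝ) = x⁻¹ ^ (1 / 8 : ℝ) := fun x hx => by
    rw [Real.rpow_neg hx.le, Real.inv_rpow hx.le]
  rcases le_or_gt ‖η‖ (c * lam / (8 * Real.pi)) with hη | hη
  · have h2 : X ≤ C₂ * ENNReal.ofReal (lam⁻¹ ^ (1 / 4 : ℝ)) := by
      have hpt : ∀ u ∈ Icc (1 / 2 : ℝ) 4, ‖𝓕 (radKer θ a Ω u) η‖ₑ ^ 2 ≤
          ENNReal.ofReal (E ^ 2 / lam ^ 2) := fun u hu => by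
        have := norm_fourier_radKer_le (by omega) h hΩ hu hη
        rw [← ofReal_norm, ← ENNReal.ofReal_pow (norm_nonneg _), ← div_pow]
        exact ENNReal.ofReal_le_ofReal (pow_le_pow_left₀ (norm_nonneg _) this 2)
      rw [hX, lintegral_freqMeas]
      calc _ ≤ ENNReal.ofReal lam * ∫⁻ _u in Icc (1 / 2 : ℝ) 4, ENNReal.ofReal (E ^ 2 / lam ^ 2) :=
            mul_le_mul_right (setLIntegral_mono measurable_const hpt) _
        _ = ENNReal.ofReal (lam * (E ^ 2 / lam ^ 2)) * ENNReal.ofReal (4 - 1 / 2) := by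
            rw [setLIntegral_const, Real.volume_Icc, ENNReal.ofReal_mul (p := lam) l0.le, mul_assoc]
        _ ≤ ENNReal.ofReal (E ^ 2 * lam⁻¹ ^ (1 / 4 : ℝ)) * 4 := by
            refine mul_le_mul' (ENNReal.ofReal_le_ofReal ?_) ?_
            · have e : lam * (E ^ 2 / lam ^ 2) = E ^ 2 * lam⁻¹ ^ (1 : ℝ) := by
                rw [Real.rpow_one]; field_simp
              rw [e]
              refine mul_le_mul_of_nonneg_left ?_ (sq_nonneg _)
              exact Real.rpow_le_rpow_of_exponent_ge (inv_pos.2 l0) (inv_le_one_of_one_le₀ h.one_le)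
                (by norm_num)
            · rw [show (4 : ℝ≥0∞) = ENNReal.ofReal 4 by simp]
              exact ENNReal.ofReal_le_ofReal (by norm_num)
        _ = _ := by rw [ENNReal.ofReal_mul (sq_nonneg _)]; ring
    rcases le_total m lam⁻¹ with hml | hml
    · calc X ≤ C₁ * ENNReal.ofReal (lam ^ (-(1 / 8) : ℝ) * m ^ (1 / 8 : ℝ)) := by
            refine h1.trans (mul_le_mul_right (ENNReal.ofReal_le_ofReal ?_) _)
            rw [split m m0, inv8 lam l0]
            gcongr
        _ ≤ _ := by
            rw [ENNReal.ofReal_mul (by positivity), ← mul_assoc]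
            refine mul_le_mul_left (mul_le_mul_left ?_ _) _
            rw [add_assoc]; exact le_self_add
    · calc X ≤ C₂ * ENNReal.ofReal (lam ^ (-(1 / 8) : ℝ) * m ^ (1 / 8 : ℝ)) := by
            refine h2.trans (mul_le_mul_right (ENNReal.ofReal_le_ofReal ?_) _)
            rw [split _ (inv_pos.2 l0).le, inv8 lam l0]
            gcongr
        _ ≤ _ := by
            rw [ENNReal.ofReal_mul (by positivity), ← mul_assoc]
            refine mul_le_mul_left (mul_le_mul_left ?_ _) _
            rw [add_right_comm]; exact le_add_self
  · have hη' : c₁ * lam < ‖η‖ := by rw [hc₁, div_mul_eq_mul_div]; exact hη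
    have hm1 : m ≤ c₁⁻¹ * lam⁻¹ := by
      rw [← mul_inv]
      exact (min_le_right _ _).trans (inv_anti₀ (by positivity) hη'.le)
    calc X ≤ C₁ * ENNReal.ofReal (c₁ ^ (-(1 / 8) : ℝ) *
          (lam ^ (-(1 / 8) : ℝ) * m ^ (1 / 8 : ℝ))) := by
          refine h1.trans (mul_le_mul_right (ENNReal.ofReal_le_ofReal ?_) _)
          rw [split m m0, inv8 lam l0, inv8 c₁ c₁0, ← mul_assoc,
            ← Real.mul_rpow (inv_pos.2 c₁0).le (inv_pos.2 l0).le]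
          gcongr
      _ ≤ _ := by
          rw [ENNReal.ofReal_mul (by positivity), ENNReal.ofReal_mul (by positivity), ← mul_assoc,
            ← mul_assoc]
          refine mul_le_mul_left (mul_le_mul_left ?_ _) _
          exact le_add_self

end

lemma integrable_memLp_of_bdd_of_support {F : ℝ → ℂ} (mF : Measurable F) {C R : ℝ}
    (bF : ∀ t, ‖F t‖ ≤ C) (sF : ∀ t, R < |t| → F t = 0) : Integrable F ∧ MemLp F 2 := by
  have hs : Function.support F ⊆ Icc (-R) R := fun t ht =>
    abs_le.1 (not_lt.1 fun h' => ht (sF t h'))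
  have e : (Icc (-R) R).indicator F = F := indicator_eq_self.2 hs
  constructor
  · refine (integrableOn_iff_integrable_of_support_subset hs).1 ?_
    exact Integrable.of_bound mF.aestronglyMeasurable C (Eventually.of_forall bF)
  · rw [← e, memLp_indicator_iff_restrict measurableSet_Icc]
    exact MemLp.of_bound mF.aestronglyMeasurable C (Eventually.of_forall bF)

/-- Bernstein's inequality. -/
lemma eLpNorm_fourierInv_le {r : ℝ} (hr : 2 ≤ r) {F : ℝ → ℂ} (mF : Measurable F) {C R : ℝ}
    (bF : ∀ t, ‖F t‖ ≤ C) (sF : ∀ t, R < |t| → F t = 0) :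
    eLpNorm (𝓕⁻ F) (ENNReal.ofReal r) volume ≤
      ENNReal.ofReal (2 * R) ^ (1 / 2 - 1 / r) * (∫⁻ t, ‖F t‖ₑ ^ 2) ^ (1 / 2 : ℝ) := by
  obtain ⟨h1, h2⟩ := integrable_memLp_of_bdd_of_support mF bF sF
  have hr0 : 0 < r := by linarith
  set Q := ∫⁻ t, ‖F t‖ₑ ^ 2 with hQ
  set V := ENNReal.ofReal (2 * R) with hV
  have hsup : ∀ x, ‖𝓕⁻ F x‖ₑ ≤ (V * Q) ^ (1 / 2 : ℝ) := by
    intro x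
    have e1 : ‖𝓕⁻ F x‖ₑ ^ 2 ≤ V * Q := by
      have hs : Function.support (fun v => Real.fourierChar (inner ℝ v x) • F v) ⊆ Icc (-R) R := fun t ht =>
        abs_le.1 (not_lt.1 fun h' => ht (by simp [sF t h']))
      rw [Real.fourierInv_eq, ← setIntegral_eq_integral_of_forall_compl_eq_zero
        (s := Icc (-R) R) fun t ht => Function.notMem_support.1 fun h => ht (hs h)]
      have mm' : Measurable fun v => Real.fourierChar (inner ℝ v x) • F v := by
        have : Continuous fun v : ℝ => ((Real.fourierChar (inner ℝ v x) : Circle) : ℂ) :=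
          continuous_subtype_val.comp (Real.continuous_fourierChar.comp (by fun_prop))
        exact this.measurable.mul mF
      refine (enorm_integral_sq_le _ mm').trans ?_
      rw [Measure.restrict_apply_univ, Real.volume_Icc, show R - -R = 2 * R by ring]
      refine mul_le_mul_right ((setLIntegral_le_lintegral _ _).trans
        (lintegral_mono fun v => ?_)) _
      simp only
      rw [← ofReal_norm, Circle.norm_smul, ofReal_norm]
    calc ‖𝓕⁻ F x‖ₑ = (‖𝓕⁻ F x‖ₑ ^ 2) ^ (1 / 2 : ℝ) := by
          rw [← ENNReal.rpow_ofNat, ← ENNReal.rpow_mul]; norm_num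
      _ ≤ _ := ENNReal.rpow_le_rpow e1 (by norm_num)
  have hI : ∫⁻ x, ‖𝓕⁻ F x‖ₑ ^ r ≤ (V * Q) ^ ((r - 2) / 2) * Q := by
    calc ∫⁻ x, ‖𝓕⁻ F x‖ₑ ^ r ≤ ∫⁻ x, (V * Q) ^ ((r - 2) / 2) * ‖𝓕⁻ F x‖ₑ ^ 2 := by
          refine lintegral_mono fun x => ?_
          rw [show r = (r - 2) + 2 by ring, ENNReal.rpow_add_of_nonneg _ _ (by linarith)
            (by norm_num), ENNReal.rpow_ofNat]
          refine mul_le_mul_left ?_ _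
          refine (ENNReal.rpow_le_rpow (hsup x) (by linarith)).trans (le_of_eq ?_)
          rw [← ENNReal.rpow_mul]
          congr 1; ring
      _ = _ := by
          rw [lintegral_const_mul'' _ ?_, lintegral_enorm_fourierInv_sq h1 h2]
          have : (𝓕⁻ F) = fun x => 𝓕 F (-x) := by
            funext x; rw [Real.fourierInv_eq_fourier_neg]
          rw [this]
          exact (((continuous_fourier_of_integrable h1).comp continuous_neg).measurable.enorm.pow_const
            2).aemeasurable
  rw [eLpNorm_eq_lintegral_rpow_enorm_toReal (by simpa using hr0) ENNReal.ofReal_ne_top,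
    ENNReal.toReal_ofReal hr0.le]
  refine (ENNReal.rpow_le_rpow hI (by positivity)).trans (le_of_eq ?_)
  have h22 : 0 ≤ (r - 2) / 2 := by linarith
  rw [ENNReal.mul_rpow_of_nonneg _ _ h22, mul_assoc]
  have hQ1 : Q ^ ((r - 2) / 2) * Q = Q ^ ((r - 2) / 2 + 1) := by
    rw [ENNReal.rpow_add_of_nonneg _ _ h22 zero_le_one, ENNReal.rpow_one]
  rw [hQ1, ENNReal.mul_rpow_of_nonneg _ _ (by positivity),
    ← ENNReal.rpow_mul, ← ENNReal.rpow_mul]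
  congr 2 <;> (field_simp; try ring)

lemma IsLPCutoff.eq_zero {ψ : ℝ → ℝ} (hψ : IsLPCutoff ψ) {s : ℝ} (hs : |s| ∉ Icc (1 / 2 : ℝ) 2) :
    ψ s = 0 := by
  by_contra h
  exact hs (hψ.2.2.1 s h)

lemma IsLPCutoff.low_mem {ψ : ℝ → ℝ} (hψ : IsLPCutoff ψ) (τ : ℝ) :
    1 - ∑' i : ℕ, ψ ((2 : ℝ) ^ (-(i : ℤ)) * |τ|) ∈ Icc (0 : ℝ) 1 := by
  rcases eq_or_ne τ 0 with rfl | hτ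
  · have : ψ 0 = 0 := hψ.eq_zero (by norm_num)
    simp [this]
  have hs := hψ.2.2.2 |τ| (abs_ne_zero.2 hτ)
  have h0 : ∀ s, 0 ≤ ψ s := fun s => (hψ.2.1 s).1
  have := (hs.summable.comp_injective Nat.cast_injective).tsum_le_tsum_of_inj (f := fun i : ℕ =>
    ψ ((2 : ℝ) ^ (-(i : ℤ)) * |τ|)) (g := fun l : ℤ => ψ ((2 : ℝ) ^ (-l) * |τ|)) (fun i : ℕ => (i : ℤ)) Nat.cast_injective
    (fun _ _ => h0 _) (fun _ => le_rfl) hs.summable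
  rw [hs.tsum_eq] at this
  exact ⟨by linarith, by
    have h1 : 0 ≤ ∑' i : ℕ, ψ ((2 : ℝ) ^ (-(i : ℤ)) * |τ|) := tsum_nonneg fun i => h0 _
    linarith⟩

lemma IsLPCutoff.low_eq_zero {ψ : ℝ → ℝ} (hψ : IsLPCutoff ψ) {τ : ℝ} (hτ : 1 < |τ|) :
    1 - ∑' i : ℕ, ψ ((2 : ℝ) ^ (-(i : ℤ)) * |τ|) = 0 := by
  have hs := hψ.2.2.2 |τ| (by linarith)
  have h1 : HasSum (fun i : ℕ => ψ ((2 : ℝ) ^ (-(i : ℤ)) * |τ|)) 1 := by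
    refine (Function.Injective.hasSum_iff (f := fun l : ℤ => ψ ((2 : ℝ) ^ (-l) * |τ|))
      (g := fun i : ℕ => (i : ℤ)) Nat.cast_injective fun l hl => ?_).2 hs
    have hl0 : l < 0 := by
      by_contra h
      exact hl ⟨l.toNat, by simpa using not_lt.1 h⟩
    refine hψ.eq_zero fun h => ?_
    have h2 : (2 : ℝ) ^ (1 : ℤ) ≤ 2 ^ (-l) := zpow_le_zpow_right₀ (by norm_num) (by omega)
    rw [abs_of_nonneg (by positivity)] at h
    have := h.2
    rw [zpow_one] at h2
    nlinarith
  rw [h1.tsum_eq, sub_self]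

/-- `L²` control of the critical Besov norm by a function and its derivative. -/
theorem exists_besovNorm_le {ψ : ℝ → ℝ} (hψ : IsLPCutoff ψ) {r : ℝ} (hr : 2 ≤ r) :
    ∃ C : ℝ≥0∞, C ≠ ⊤ ∧ ∀ lam : ℝ, 1 ≤ lam → ∀ g : ℝ → ℂ, Differentiable ℝ g →
      Integrable g → MemLp g 2 → Integrable (deriv g) → MemLp (deriv g) 2 →
      besovNorm ψ r g ≤ C * (ENNReal.ofReal lam * (∫⁻ u, ‖g u‖ₑ ^ 2) +
        ENNReal.ofReal lam⁻¹ * ∫⁻ u, ‖deriv g u‖ₑ ^ 2) ^ (1 / 2 : ℝ) := by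
  obtain ⟨C₀, hC₀, H₀⟩ := exists_tsum_mm_le (c := 1 / 2) (by norm_num)
  refine ⟨2 + 2 * C₀, by finiteness, fun lam hlam g dg ig g2 idg dg2 => ?_⟩
  have hlam0 : 0 < lam := by linarith
  have hr0 : 0 < r := by linarith
  have hr1 : 0 ≤ 1 / 2 - 1 / r := by
    rw [sub_nonneg]; exact one_div_le_one_div_of_le (by norm_num) hr
  set N := ∫⁻ u, ‖g u‖ₑ ^ 2 with hN
  set D := ∫⁻ u, ‖deriv g u‖ₑ ^ 2 with hD
  set X := (ENNReal.ofReal lam * N + ENNReal.ofReal lam⁻¹ * D) with hX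
  have hNX : N ≤ ENNReal.ofReal lam⁻¹ * X := by
    rw [hX, mul_add, ← mul_assoc, ← ENNReal.ofReal_mul (by positivity), inv_mul_cancel₀ hlam0.ne',
      ENNReal.ofReal_one, one_mul]
    exact le_self_add
  have hDX : D ≤ ENNReal.ofReal lam * X := by
    rw [hX, mul_add, ← mul_assoc _ _ D, ← ENNReal.ofReal_mul (by positivity),
      mul_inv_cancel₀ hlam0.ne', ENNReal.ofReal_one, one_mul]
    exact le_add_self
  have cG := continuous_fourier_of_integrable ig
  obtain ⟨CG, hCG⟩ : ∃ CG : ℝ, ∀ τ, ‖𝓕 g τ‖ ≤ CG :=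
    ⟨∫ v, ‖g v‖, fun τ => VectorFourier.norm_fourierIntegral_le_integral_norm _ _ _ _ _⟩
  have hCG0 : 0 ≤ CG := (norm_nonneg _).trans (hCG 0)
  have pN := lintegral_enorm_fourier_sq ig g2
  have pD := lintegral_enorm_fourier_sq idg dg2
  rw [← hN] at pN
  rw [← hD] at pD
  have hfd := Real.fourier_deriv ig dg idg
  have mψ : Measurable ψ := hψ.1.continuous.measurable
  -- a piece with a bounded multiplier
  have piece : ∀ (w : ℝ → ℝ) (R : ℝ), Measurable w → (∀ τ, w τ ∈ Icc (0 : ℝ) 1) →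
      (∀ τ, R < |τ| → w τ = 0) → eLpNorm (𝓕⁻ fun τ => (w τ : ℂ) * 𝓕 g τ) (ENNReal.ofReal r) volume ≤
      ENNReal.ofReal (2 * R) ^ (1 / 2 - 1 / r) * (∫⁻ t, ‖(w t : ℂ) * 𝓕 g t‖ₑ ^ 2) ^ (1 / 2 : ℝ) := by
    intro w R mw hw sw
    refine eLpNorm_fourierInv_le hr ((Complex.measurable_ofReal.comp mw).mul cG.measurable)
      (C := CG) (fun t => ?_) fun t ht => by simp [sw t ht]
    rw [Pi.mul_apply, norm_mul, Function.comp_apply, Complex.norm_real,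
      Real.norm_of_nonneg (hw t).1]
    exact (mul_le_mul (hw t).2 (hCG t) (norm_nonneg _) zero_le_one).trans (by simp)
  have pieceN : ∀ (w : ℝ → ℝ), (∀ τ, w τ ∈ Icc (0 : ℝ) 1) →
      ∫⁻ t, ‖(w t : ℂ) * 𝓕 g t‖ₑ ^ 2 ≤ N := by
    intro w hw
    rw [← pN]
    refine lintegral_mono fun t => pow_le_pow_left' ?_ 2
    rw [enorm_mul, ← ofReal_norm, Complex.norm_real, Real.norm_of_nonneg (hw t).1]
    calc _ ≤ 1 * ‖𝓕 g t‖ₑ := mul_le_mul_left (by simpa using (hw t).2) _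
      _ = _ := one_mul _
  have low : eLpNorm (deltaLow ψ g) (ENNReal.ofReal r) volume ≤ 2 * X ^ (1 / 2 : ℝ) := by
    refine (piece (fun τ => 1 - ∑' i : ℕ, ψ ((2 : ℝ) ^ (-(i : ℤ)) * |τ|)) 1 ?_ hψ.low_mem
      fun τ => hψ.low_eq_zero).trans ?_
    · refine measurable_const.sub (Measurable.tsum fun i => mψ.comp ?_)
      fun_prop
    · refine mul_le_mul' ?_ (ENNReal.rpow_le_rpow ((pieceN _ hψ.low_mem).trans (hNX.trans ?_))
        (by norm_num))
      · rw [mul_one, ENNReal.ofReal_ofNat]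
        calc (2 : ℝ≥0∞) ^ (1 / 2 - 1 / r) ≤ 2 ^ (1 : ℝ) :=
              ENNReal.rpow_le_rpow_of_exponent_le (by norm_num)
                (by linarith [one_div_pos.2 hr0])
          _ = 2 := by simp
      · calc _ ≤ 1 * X := mul_le_mul_left (by simpa using inv_le_one_of_one_le₀ hlam) _
          _ = X := one_mul X
  have high : ∀ i : ℕ, ENNReal.ofReal ((2 : ℝ) ^ ((i : ℝ) / r)) *
      eLpNorm (deltaHigh ψ i g) (ENNReal.ofReal r) volume ≤
      2 * X ^ (1 / 2 : ℝ) * ENNReal.ofReal (mm (2 ^ (i : ℤ) * lam⁻¹) ^ (1 / 2 : ℝ)) := by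
    intro i
    set w : ℝ → ℝ := fun τ => ψ ((2 : ℝ) ^ (-(i : ℤ)) * |τ|) with hw
    have hw01 : ∀ τ, w τ ∈ Icc (0 : ℝ) 1 := fun τ => hψ.2.1 _
    have h2i : (0 : ℝ) < 2 ^ i := by positivity
    have hws : ∀ τ, w τ ≠ 0 → 2 ^ i / 2 ≤ |τ| ∧ |τ| ≤ 2 * 2 ^ i := by
      intro τ hτ
      have := hψ.2.2.1 _ hτ
      rw [zpow_neg, zpow_natCast, abs_of_nonneg (by positivity), inv_mul_eq_div, mem_Icc,
        le_div_iff₀ h2i, div_le_iff₀ h2i] at this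
      exact ⟨by linarith [this.1], this.2⟩
    set b := ∫⁻ t, ‖(w t : ℂ) * 𝓕 g t‖ₑ ^ 2 with hb
    have hp := piece w (2 * 2 ^ i) (mψ.comp (by fun_prop)) hw01 fun τ hτ => by
      by_contra h
      exact absurd (hws τ h).2 (not_le.2 hτ)
    have hbD : b ≤ ENNReal.ofReal ((2 ^ i)⁻¹ ^ 2) * D := by
      rw [← pD, ← lintegral_const_mul' _ _ ENNReal.ofReal_ne_top]
      refine lintegral_mono fun t => ?_
      rw [ENNReal.ofReal_pow (by positivity), ← mul_pow]
      refine pow_le_pow_left' ?_ 2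
      rcases eq_or_ne (w t) 0 with h0 | h0
      · simp [h0]
      rw [← ofReal_norm, ← ofReal_norm, ← ENNReal.ofReal_mul (by positivity)]
      refine ENNReal.ofReal_le_ofReal ?_
      rw [hfd]
      simp only [norm_smul, norm_mul, Complex.norm_real, Complex.norm_I, mul_one, Complex.norm_ofNat,
        Real.norm_eq_abs, abs_of_pos Real.pi_pos, abs_of_nonneg (hw01 t).1]
      have h1 := (hws t h0).1
      have h3 : 1 ≤ (2 ^ i : ℝ)⁻¹ * (2 * Real.pi * |t|) := by
        rw [inv_mul_eq_div, le_div_iff₀ h2i]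
        nlinarith [Real.pi_gt_three, abs_nonneg t]
      calc w t * ‖𝓕 g t‖ ≤ 1 * ‖𝓕 g t‖ := mul_le_mul_of_nonneg_right (hw01 t).2 (norm_nonneg _)
        _ ≤ ((2 ^ i : ℝ)⁻¹ * (2 * Real.pi * |t|)) * ‖𝓕 g t‖ :=
            mul_le_mul_of_nonneg_right h3 (norm_nonneg _)
        _ = _ := by ring
    have hbX : ENNReal.ofReal (2 ^ i) * b ≤ ENNReal.ofReal (mm (2 ^ (i : ℤ) * lam⁻¹)) * X := by
      rw [mm, zpow_natCast]
      rcases min_choice ((2 : ℝ) ^ i * lam⁻¹) ((2 : ℝ) ^ i * lam⁻¹)⁻¹ with h | h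
      · rw [h, ENNReal.ofReal_mul h2i.le, mul_assoc]
        exact mul_le_mul_right ((pieceN w hw01).trans hNX) _
      · rw [h]
        refine (mul_le_mul_right (hbD.trans (mul_le_mul_right hDX _)) _).trans (le_of_eq ?_)
        rw [← mul_assoc, ← mul_assoc, ← ENNReal.ofReal_mul h2i.le,
          ← ENNReal.ofReal_mul (by positivity)]
        congr 2
        field_simp
    have hc : ENNReal.ofReal ((2 : ℝ) ^ ((i : ℝ) / r)) *
        ENNReal.ofReal (2 * (2 * 2 ^ i)) ^ (1 / 2 - 1 / r) ≤ 2 * ENNReal.ofReal (2 ^ i) ^ (1 / 2 : ℝ) := by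
      rw [ENNReal.ofReal_rpow_of_pos (by positivity), ENNReal.ofReal_rpow_of_pos (by positivity),
        ← ENNReal.ofReal_mul (by positivity), ← ENNReal.ofReal_ofNat,
        ← ENNReal.ofReal_mul (by positivity)]
      refine ENNReal.ofReal_le_ofReal ?_
      have e : (2 : ℝ) * (2 * 2 ^ i) = 2 ^ ((i : ℝ) + 2) := by
        rw [Real.rpow_add (by norm_num), Real.rpow_natCast]; norm_num; ring
      rw [e, ← Real.rpow_natCast, ← Real.rpow_mul (by norm_num), ← Real.rpow_mul (by norm_num),
        ← Real.rpow_add (by norm_num)]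
      have e2 : (2 : ℝ) * 2 ^ ((i : ℝ) * (1 / 2)) = 2 ^ (1 + (i : ℝ) * (1 / 2)) := by
        rw [Real.rpow_add (by norm_num), Real.rpow_one]
      rw [e2]
      refine Real.rpow_le_rpow_of_exponent_le (by norm_num) ?_
      have : 0 ≤ 1 / r := by positivity
      have e : (i : ℝ) / r + (i + 2) * (1 / 2 - 1 / r) = 1 + i * (1 / 2) - 2 * (1 / r) := by ring
      rw [e]
      linarith
    calc _ ≤ ENNReal.ofReal ((2 : ℝ) ^ ((i : ℝ) / r)) *
          (ENNReal.ofReal (2 * (2 * 2 ^ i)) ^ (1 / 2 - 1 / r) * b ^ (1 / 2 : ℝ)) :=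
          mul_le_mul_right hp _
      _ ≤ 2 * ENNReal.ofReal (2 ^ i) ^ (1 / 2 : ℝ) * b ^ (1 / 2 : ℝ) := by
          rw [← mul_assoc]; exact mul_le_mul_left hc _
      _ = 2 * (ENNReal.ofReal (2 ^ i) * b) ^ (1 / 2 : ℝ) := by
          rw [ENNReal.mul_rpow_of_nonneg _ _ (by norm_num), mul_assoc]
      _ ≤ 2 * (ENNReal.ofReal (mm (2 ^ (i : ℤ) * lam⁻¹)) * X) ^ (1 / 2 : ℝ) :=
          mul_le_mul_right (ENNReal.rpow_le_rpow hbX (by norm_num)) _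
      _ = _ := by
          rw [ENNReal.mul_rpow_of_nonneg _ _ (by norm_num),
            ENNReal.ofReal_rpow_of_nonneg (mm_nonneg (by positivity)) (by norm_num)]
          ring
  have sum : ∑' i : ℕ, ENNReal.ofReal (mm (2 ^ (i : ℤ) * lam⁻¹) ^ (1 / 2 : ℝ)) ≤ C₀ :=
    (ENNReal.tsum_comp_le_tsum_of_injective (f := fun i : ℕ => (i : ℤ)) Nat.cast_injective
      fun k : ℤ => ENNReal.ofReal (mm (2 ^ k * lam⁻¹) ^ (1 / 2 : ℝ))).trans (H₀ _ (by positivity))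
  calc besovNorm ψ r g ≤ 2 * X ^ (1 / 2 : ℝ) + 2 * X ^ (1 / 2 : ℝ) * C₀ := by
        refine add_le_add low ((ENNReal.tsum_le_tsum high).trans ?_)
        rw [ENNReal.tsum_mul_left]
        exact mul_le_mul_right sum _
    _ = _ := by ring

section
variable {θ θ₁ θ₂ a a₁ a' a₁' : ℝ → ℝ} {lam c B B' : ℝ} {n : ℕ} {Ω : Rn n → ℝ}

lemma norm_dil_radKer (s u : ℝ) (t : Rn n) :
    ‖dil s (radKer θ a Ω u) t‖ = ‖dil s (radKer θ a Ω 0) t‖ := by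
  simp only [dil, norm_mul, norm_radKer]

lemma hasDerivAt_cv_dil_radKer (h : RadData θ θ₁ θ₂ a a₁ lam c B)
    (h' : RadData θ θ₁ θ₂ a' a₁' lam c B) (ha : ∀ r, a' r * lam = a r * θ r) (hΩ : SphData Ω B')
    {s : ℝ} (hs : 0 < s) {f : Rn n → ℂ} (hf : BddInt f) (x : Rn n) (u : ℝ) :
    HasDerivAt (fun u => cv f (dil s (radKer θ a Ω u)) x)
      (Complex.I * lam * cv f (dil s (radKer θ a' Ω u)) x) u := by
  have b := fun u => (bddInt_radKer h hΩ u).dil hs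
  have b' := fun u => (bddInt_radKer h' hΩ u).dil hs
  have key := (hasDerivAt_integral_of_dominated_loc_of_deriv_le (μ := (volume : Measure (Rn n)))
    (F := fun u t => f (x - t) * dil s (radKer θ a Ω u) t)
    (F' := fun u t => f (x - t) * (Complex.I * lam * dil s (radKer θ a' Ω u) t)) (x₀ := u)
    (s := univ) (bound := fun t => lam * ‖f (x - t) * dil s (radKer θ a' Ω 0) t‖) univ_mem
    (Eventually.of_forall fun v => (hf.comp_sub_mul (b v).int x).aestronglyMeasurable)
    (hf.comp_sub_mul (b u).int x) ?_ ?_ ?_ ?_).2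
  · refine key.congr_deriv ?_
    unfold cv
    rw [← integral_const_mul]
    congr 1
    funext t
    ring
  · have := ((hf.comp_sub_mul (b' u).int x).const_mul (Complex.I * lam)).aestronglyMeasurable
    refine this.congr (Eventually.of_forall fun t => ?_)
    simp only
    ring
  · refine Eventually.of_forall fun t v _ => le_of_eq ?_
    rw [norm_mul, norm_mul, norm_mul, norm_mul, norm_dil_radKer, Complex.norm_I, one_mul,
      Complex.norm_real, Real.norm_of_nonneg h.lam_pos.le]
    ring
  · exact (hf.comp_sub_mul (b' 0).int x).norm.const_mul _
  · refine Eventually.of_forall fun t v _ => HasDerivAt.const_mul _ ?_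
    have e1 : HasDerivAt (fun u : ℝ => Complex.exp (Complex.I * (u * θ ‖s⁻¹ • t‖ : ℝ)))
        (Complex.exp (Complex.I * (v * θ ‖s⁻¹ • t‖ : ℝ)) * (Complex.I * (θ ‖s⁻¹ • t‖ : ℝ))) v := by
      refine HasDerivAt.cexp (HasDerivAt.const_mul _ ?_)
      have := ((hasDerivAt_id v).mul_const (θ ‖s⁻¹ • t‖)).ofReal_comp
      simpa using this
    have e2 := (e1.mul_const ((a ‖s⁻¹ • t‖ * Ω (s⁻¹ • t) : ℝ) : ℂ)).const_mul (((s ^ n)⁻¹ : ℝ) : ℂ)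
    refine e2.congr_deriv ?_
    simp only [dil, radKer]
    have := congrArg (fun y : ℝ => (y : ℂ)) (ha ‖s⁻¹ • t‖)
    push_cast at this ⊢
    linear_combination (-(Complex.I * ((s : ℂ) ^ n)⁻¹ * Complex.exp (Complex.I * (v * θ ‖s⁻¹ • t‖)) *
      Ω (s⁻¹ • t))) * this

/-- The critical Besov norm in the modulation parameter is controlled by square functions. -/
theorem exists_besovNorm_cv_le {ψ χ : ℝ → ℝ} (hψ : IsLPCutoff ψ) (hχ : IsChiCutoff χ) {r : ℝ}
    (hr : 2 ≤ r) : ∃ C : ℝ≥0∞, C ≠ ⊤ ∧ ∀ {n : ℕ} {θ θ₁ θ₂ a a₁ a' a₁' : ℝ → ℝ} {lam c B B' : ℝ}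
      {Ω : Rn n → ℝ}, RadData θ θ₁ θ₂ a a₁ lam c B → RadData θ θ₁ θ₂ a' a₁' lam c B →
      (∀ r, a' r * lam = a r * θ r) → SphData Ω B' → ∀ s, 0 < s → ∀ f : Rn n → ℂ, BddInt f → ∀ x,
      besovNorm ψ r (fun u => (χ u : ℂ) * cv f (dil s (radKer θ a Ω u)) x) ^ 2 ≤
        C * ((∫⁻ u, ‖cv f (dil s (radKer θ a Ω u)) x‖ₑ ^ 2 ∂(freqMeas lam)) +
          ∫⁻ u, ‖cv f (dil s (radKer θ a' Ω u)) x‖ₑ ^ 2 ∂(freqMeas lam)) := by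
  obtain ⟨C, hC, H⟩ := exists_besovNorm_le hψ hr
  have dχ : Differentiable ℝ χ := hχ.1.differentiable (by simp)
  have cχ' : Continuous (deriv χ) := hχ.1.continuous_deriv (by simp)
  have χ0 : ∀ u, u ∉ Icc (1 / 2 : ℝ) 4 → χ u = 0 := fun u hu => by
    by_contra h
    exact hu (hχ.2.2.1 u h)
  have χ0' : ∀ u, u ∉ Icc (1 / 2 : ℝ) 4 → deriv χ u = 0 := fun u hu => by
    have : χ =ᶠ[𝓝 u] fun _ => 0 := by
      filter_upwards [isClosed_Icc.isOpen_compl.mem_nhds hu] with v hv using χ0 v hv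
    rw [this.deriv_eq, deriv_const]
  obtain ⟨E, hE⟩ : ∃ E : ℝ, ∀ u, |deriv χ u| ≤ E := by
    obtain ⟨E, hE⟩ := isCompact_Icc.exists_bound_of_continuousOn (s := Icc (1 / 2 : ℝ) 4)
      cχ'.continuousOn
    refine ⟨E, fun u => ?_⟩
    by_cases hu : u ∈ Icc (1 / 2 : ℝ) 4
    · exact hE u hu
    · rw [χ0' u hu, abs_zero]
      exact (norm_nonneg _).trans (hE 1 (by norm_num))
  have hE0 : 0 ≤ E := (abs_nonneg _).trans (hE 0)
  refine ⟨C ^ 2 * (1 + 2 * ENNReal.ofReal E ^ 2 + 2), by finiteness,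
    fun {n θ θ₁ θ₂ a a₁ a' a₁' lam c B B' Ω} h h' ha hΩ s hs f hf x => ?_⟩
  set P : ℝ → ℂ := fun u => cv f (dil s (radKer θ a Ω u)) x with hP
  set P' : ℝ → ℂ := fun u => cv f (dil s (radKer θ a' Ω u)) x with hP'
  have dP : ∀ u, HasDerivAt P (Complex.I * lam * P' u) u :=
    hasDerivAt_cv_dil_radKer h h' ha hΩ hs hf x
  have hl := h.lam_pos
  obtain ⟨Cf, hCf⟩ := hf.bdd
  obtain ⟨D, hD⟩ : ∃ D : ℝ, ∀ u, ‖P u‖ ≤ D := ⟨_, fun u => by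
    have := norm_cv_le hCf ((bddInt_radKer h hΩ u).dil hs).int x
    simp_rw [norm_dil_radKer s u] at this
    exact this⟩
  obtain ⟨D', hD'⟩ : ∃ D : ℝ, ∀ u, ‖P' u‖ ≤ D := ⟨_, fun u => by
    have := norm_cv_le hCf ((bddInt_radKer h' hΩ u).dil hs).int x
    simp_rw [norm_dil_radKer s u] at this
    exact this⟩
  have hD0 : 0 ≤ D := (norm_nonneg _).trans (hD 0)
  set g : ℝ → ℂ := fun u => (χ u : ℂ) * P u with hg
  have dg : ∀ u, HasDerivAt g (deriv χ u * P u + χ u * (Complex.I * lam * P' u)) u := fun u =>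
    ((dχ u).hasDerivAt.ofReal_comp).mul (dP u)
  have dg' : deriv g = fun u => deriv χ u * P u + χ u * (Complex.I * lam * P' u) :=
    funext fun u => (dg u).deriv
  have gd : Differentiable ℝ g := fun u => (dg u).differentiableAt
  have nχ : ∀ u, ‖(χ u : ℂ)‖ ≤ 1 := fun u => by
    rw [Complex.norm_real, Real.norm_of_nonneg (hχ.2.1 u).1]
    exact (hχ.2.1 u).2
  have nχ' : ∀ u, ‖((deriv χ u : ℝ) : ℂ)‖ ≤ E := fun u => by
    rw [Complex.norm_real]
    exact hE u
  have out : ∀ u : ℝ, 4 < |u| → u ∉ Icc (1 / 2 : ℝ) 4 := fun u hu hu' => by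
    rw [abs_of_nonneg (by linarith [hu'.1])] at hu
    linarith [hu'.2]
  have ig := integrable_memLp_of_bdd_of_support gd.continuous.measurable (C := 1 * D) (R := 4)
    (fun u => by
      simp only [hg]
      rw [norm_mul]
      exact mul_le_mul (nχ u) (hD u) (norm_nonneg _) zero_le_one)
    fun u hu => by simp [hg, χ0 u (out u hu)]
  have idg := integrable_memLp_of_bdd_of_support (measurable_deriv g) (C := E * D + 1 * (lam * D'))
    (R := 4) (fun u => by
      rw [dg']
      refine (norm_add_le _ _).trans (add_le_add ?_ ?_)
      · rw [norm_mul]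
        exact mul_le_mul (nχ' u) (hD u) (norm_nonneg _) hE0
      · rw [norm_mul, norm_mul, norm_mul, Complex.norm_I, one_mul, Complex.norm_of_nonneg hl.le]
        exact mul_le_mul (nχ u) (mul_le_mul_of_nonneg_left (hD' u) hl.le) (by positivity)
          zero_le_one)
    fun u hu => by simp [dg', χ0 u (out u hu), χ0' u (out u hu)]
  have main := H lam h.one_le g gd ig.1 ig.2 idg.1 idg.2
  set S := ∫⁻ u in Icc (1 / 2 : ℝ) 4, ‖P u‖ₑ ^ 2 with hS
  set S' := ∫⁻ u in Icc (1 / 2 : ℝ) 4, ‖P' u‖ₑ ^ 2 with hS'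
  have mP : Measurable P := (Differentiable.continuous fun u => (dP u).differentiableAt).measurable
  have restr : ∀ G : ℝ → ℂ, (∀ u, u ∉ Icc (1 / 2 : ℝ) 4 → G u = 0) →
      ∫⁻ u, ‖G u‖ₑ ^ 2 = ∫⁻ u in Icc (1 / 2 : ℝ) 4, ‖G u‖ₑ ^ 2 := fun G hG => by
    rw [← lintegral_indicator measurableSet_Icc]
    refine lintegral_congr fun u => ?_
    by_cases hu : u ∈ Icc (1 / 2 : ℝ) 4
    · rw [indicator_of_mem hu]
    · rw [indicator_of_notMem hu, hG u hu]
      simp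
  have n1 : ∫⁻ u, ‖g u‖ₑ ^ 2 ≤ S := by
    rw [restr g fun u hu => by simp [hg, χ0 u hu]]
    refine lintegral_mono fun u => pow_le_pow_left' ?_ 2
    simp only [hg]
    rw [enorm_mul, ← ofReal_norm (χ u : ℂ)]
    calc _ ≤ 1 * ‖P u‖ₑ := mul_le_mul_left (by simpa using nχ u) _
      _ = _ := one_mul _
  have n2 : ∫⁻ u, ‖deriv g u‖ₑ ^ 2 ≤
      2 * ENNReal.ofReal E ^ 2 * S + 2 * ENNReal.ofReal lam ^ 2 * S' := by
    rw [restr _ fun u hu => by simp [dg', χ0 u hu, χ0' u hu], hS, hS',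
      ← lintegral_const_mul' _ _ (by finiteness), ← lintegral_const_mul' _ _ (by finiteness),
      ← lintegral_add_left ((mP.enorm.pow_const 2).const_mul _)]
    refine lintegral_mono fun u => ?_
    have : ‖deriv g u‖ₑ ≤ ENNReal.ofReal E * ‖P u‖ₑ + ENNReal.ofReal lam * ‖P' u‖ₑ := by
      rw [dg']
      refine (enorm_add_le _ _).trans (add_le_add ?_ ?_)
      · rw [enorm_mul, ← ofReal_norm ((deriv χ u : ℝ) : ℂ)]
        exact mul_le_mul_left (ENNReal.ofReal_le_ofReal (nχ' u)) _
      · rw [enorm_mul, enorm_mul, enorm_mul, ← ofReal_norm (χ u : ℂ), ← ofReal_norm Complex.I,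
          ← ofReal_norm (lam : ℂ), Complex.norm_I, Complex.norm_of_nonneg hl.le,
          ENNReal.ofReal_one, one_mul]
        calc _ ≤ 1 * (ENNReal.ofReal lam * ‖P' u‖ₑ) := mul_le_mul_left (by simpa using nχ u) _
          _ = _ := one_mul _
    refine (pow_le_pow_left' this 2).trans ?_
    have e := ENNReal.rpow_add_le_mul_rpow_add_rpow (ENNReal.ofReal E * ‖P u‖ₑ)
      (ENNReal.ofReal lam * ‖P' u‖ₑ) (p := 2) (by norm_num)
    simp only [ENNReal.rpow_ofNat, show (2 - 1 : ℝ) = 1 by norm_num, ENNReal.rpow_one] at e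
    refine e.trans (le_of_eq ?_)
    ring
  rw [lintegral_freqMeas, lintegral_freqMeas]
  have hE1 : ENNReal.ofReal lam⁻¹ ≤ ENNReal.ofReal lam :=
    ENNReal.ofReal_le_ofReal ((inv_le_one_of_one_le₀ h.one_le).trans h.one_le)
  have hE2 : ENNReal.ofReal lam⁻¹ * ENNReal.ofReal lam ^ 2 = ENNReal.ofReal lam := by
    rw [← ENNReal.ofReal_pow hl.le, ← ENNReal.ofReal_mul (by positivity)]
    congr 1
    field_simp
  calc _ ≤ (C * (ENNReal.ofReal lam * (∫⁻ u, ‖g u‖ₑ ^ 2) +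
        ENNReal.ofReal lam⁻¹ * ∫⁻ u, ‖deriv g u‖ₑ ^ 2) ^ (1 / 2 : ℝ)) ^ 2 := pow_le_pow_left' main 2
    _ = C ^ 2 * (ENNReal.ofReal lam * (∫⁻ u, ‖g u‖ₑ ^ 2) +
        ENNReal.ofReal lam⁻¹ * ∫⁻ u, ‖deriv g u‖ₑ ^ 2) := by
        rw [mul_pow, ← ENNReal.rpow_ofNat (_ ^ (1 / 2 : ℝ)), ← ENNReal.rpow_mul]
        norm_num
    _ ≤ C ^ 2 * (ENNReal.ofReal lam * S + ENNReal.ofReal lam⁻¹ *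
        (2 * ENNReal.ofReal E ^ 2 * S + 2 * ENNReal.ofReal lam ^ 2 * S')) := by
        exact mul_le_mul_right (add_le_add (mul_le_mul_right n1 _) (mul_le_mul_right n2 _)) _
    _ = C ^ 2 * (ENNReal.ofReal lam * S + 2 * ENNReal.ofReal E ^ 2 * (ENNReal.ofReal lam⁻¹ * S) +
        2 * (ENNReal.ofReal lam * S')) := by
        rw [mul_add (ENNReal.ofReal lam⁻¹), show ENNReal.ofReal lam⁻¹ *
          (2 * ENNReal.ofReal lam ^ 2 * S') = 2 * ((ENNReal.ofReal lam⁻¹ * ENNReal.ofReal lam ^ 2) * S')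
          by ring, hE2]
        ring
    _ ≤ C ^ 2 * (ENNReal.ofReal lam * S + 2 * ENNReal.ofReal E ^ 2 * (ENNReal.ofReal lam * S) +
        2 * (ENNReal.ofReal lam * S')) := by gcongr
    _ ≤ C ^ 2 * ((1 + 2 * ENNReal.ofReal E ^ 2 + 2) * (ENNReal.ofReal lam * S) +
        (1 + 2 * ENNReal.ofReal E ^ 2 + 2) * (ENNReal.ofReal lam * S')) := by
        gcongr
        · rw [add_mul, add_mul, one_mul]
          exact le_self_add
        · exact le_add_self
    _ = _ := by ring
end

section
variable {Γ : ℝ → ℝ}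

lemma IsGammaU.strictMonoOn (hΓ : IsGammaU Γ) : StrictMonoOn Γ (Ici 0) :=
  strictMonoOn_of_deriv_pos (convex_Ici 0) hΓ.continuousOn fun s hs => by
    rw [interior_Ici] at hs
    exact hΓ.deriv_pos s hs

lemma IsGammaU.pos (hΓ : IsGammaU Γ) {s : ℝ} (hs : 0 < s) : 0 < Γ s := by
  rw [← hΓ.map_zero]
  exact hΓ.strictMonoOn self_mem_Ici hs.le hs

lemma IsGammaU.mono (hΓ : IsGammaU Γ) {s t : ℝ} (hs : 0 ≤ s) (h : s ≤ t) : Γ s ≤ Γ t :=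
  hΓ.strictMonoOn.monotoneOn hs (hs.trans h) h

lemma IsGammaU.hasDerivAt (hΓ : IsGammaU Γ) {s : ℝ} (hs : 0 < s) :
    HasDerivAt Γ (deriv Γ s) s :=
  (((hΓ.smooth.differentiableOn (by simp)) s hs).differentiableAt (Ioi_mem_nhds hs)).hasDerivAt

lemma IsGammaU.contDiffOn_deriv (hΓ : IsGammaU Γ) :
    ContDiffOn ℝ (⊤ : ℕ∞) (deriv Γ) (Ioi 0) :=
  hΓ.smooth.deriv_of_isOpen isOpen_Ioi (by simp)

lemma iteratedDeriv_two_eq : iteratedDeriv 2 Γ = deriv (deriv Γ) := by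
  rw [iteratedDeriv_succ, iteratedDeriv_one]

lemma IsGammaU.hasDerivAt_deriv (hΓ : IsGammaU Γ) {s : ℝ} (hs : 0 < s) :
    HasDerivAt (deriv Γ) (iteratedDeriv 2 Γ s) s := by
  rw [iteratedDeriv_two_eq]
  exact (((hΓ.contDiffOn_deriv.differentiableOn (by simp)) s hs).differentiableAt
    (Ioi_mem_nhds hs)).hasDerivAt

lemma IsGammaU.continuousOn_iteratedDeriv_two (hΓ : IsGammaU Γ) :
    ContinuousOn (iteratedDeriv 2 Γ) (Ioi 0) := by
  rw [iteratedDeriv_two_eq]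
  exact (hΓ.contDiffOn_deriv.deriv_of_isOpen isOpen_Ioi (m := (⊤ : ℕ∞)) (by simp)).continuousOn

lemma IsGammaU.exists_le_mul_deriv (hΓ : IsGammaU Γ) :
    ∃ c > 0, ∀ s, 0 < s → c * Γ s ≤ s * deriv Γ s := by
  obtain ⟨c, hc, h⟩ := hΓ.lower 1 (by simp)
  refine ⟨c, hc, fun s hs => ?_⟩
  have := h s hs
  have h1 := hΓ.pos hs
  have h2 := hΓ.deriv_pos s hs
  rwa [iteratedDeriv_one, pow_one, abs_of_nonneg (by positivity), le_div_iff₀ h1] at this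

lemma IsGammaU.exists_mul_deriv_le (hΓ : IsGammaU Γ) :
    ∃ c > 0, ∀ s, 0 < s → s * deriv Γ s ≤ c * Γ s := by
  obtain ⟨c, hc, h⟩ := hΓ.upper 1 le_rfl
  refine ⟨c, hc, fun s hs => ?_⟩
  have := h s hs
  have h1 := hΓ.pos hs
  have h2 := hΓ.deriv_pos s hs
  rwa [iteratedDeriv_one, pow_one, abs_of_nonneg (by positivity), div_le_iff₀ h1] at this

lemma IsGammaU.exists_sq_mul_iteratedDeriv_two_le (hΓ : IsGammaU Γ) :
    ∃ c > 0, ∀ s, 0 < s → s ^ 2 * |iteratedDeriv 2 Γ s| ≤ c * Γ s := by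
  obtain ⟨c, hc, h⟩ := hΓ.upper 2 (by norm_num)
  refine ⟨c, hc, fun s hs => ?_⟩
  have := h s hs
  have h1 := hΓ.pos hs
  rwa [abs_div, abs_mul, abs_of_pos h1, abs_of_nonneg (sq_nonneg s), div_le_iff₀ h1] at this

lemma IsGammaU.hasDerivAt_mul_rpow (hΓ : IsGammaU Γ) (c : ℝ) {s : ℝ} (hs : 0 < s) :
    HasDerivAt (fun s => Γ s * s ^ (-c)) (s ^ (-c - 1) * (s * deriv Γ s - c * Γ s)) s := by
  refine ((hΓ.hasDerivAt hs).mul (Real.hasDerivAt_rpow_const (p := -c) (Or.inl hs.ne'))).congr_deriv ?_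
  have : s ^ (-c) = s ^ (-c - 1) * s := by
    rw [Real.rpow_sub_one hs.ne', div_mul_cancel₀ _ hs.ne']
  rw [this]
  ring

lemma IsGammaU.exists_doubling (hΓ : IsGammaU Γ) :
    ∃ D : ℝ, 1 ≤ D ∧ ∀ s, 0 < s → Γ (2 * s) ≤ D * Γ s := by
  obtain ⟨c, hc, h⟩ := hΓ.exists_mul_deriv_le
  have anti : AntitoneOn (fun s => Γ s * s ^ (-c)) (Ioi 0) := by
    refine antitoneOn_of_deriv_nonpos (convex_Ioi 0)
      (fun s hs => (hΓ.hasDerivAt_mul_rpow c hs).continuousAt.continuousWithinAt) (fun s hs => ?_)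
      fun s hs => ?_ <;> rw [interior_Ioi] at hs
    · exact (hΓ.hasDerivAt_mul_rpow c hs).differentiableAt.differentiableWithinAt
    · rw [(hΓ.hasDerivAt_mul_rpow c hs).deriv]
      exact mul_nonpos_of_nonneg_of_nonpos (Real.rpow_nonneg (le_of_lt hs) _)
        (by linarith [h s hs])
  refine ⟨2 ^ c, Real.one_le_rpow (by norm_num) hc.le, fun s hs => ?_⟩
  have := anti (mem_Ioi.2 hs) (mem_Ioi.2 (by linarith : 0 < 2 * s)) (by linarith)
  simp only at this
  rw [Real.rpow_neg (by positivity), Real.rpow_neg hs.le, Real.mul_rpow (by norm_num) hs.le] at this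
  have h2 : (0 : ℝ) < 2 ^ c := by positivity
  have h3 : 0 < s ^ c := by positivity
  rw [← div_eq_mul_inv, ← div_eq_mul_inv, div_le_div_iff₀ (by positivity) h3] at this
  have e : s ^ c * Γ (2 * s) ≤ s ^ c * (2 ^ c * Γ s) := by linarith
  exact le_of_mul_le_mul_left e h3

lemma IsGammaU.kstar_spec (hΓ : IsGammaU Γ) (j : ℤ) :
    (2 : ℝ) ^ j * Γ (2 ^ kstar Γ j) ≤ 1 ∧ 1 < (2 : ℝ) ^ j * Γ (2 ^ (kstar Γ j + 1)) := by
  obtain ⟨c, hc, h⟩ := hΓ.exists_le_mul_deriv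
  have mono : MonotoneOn (fun s => Γ s * s ^ (-c)) (Ioi 0) := by
    refine monotoneOn_of_deriv_nonneg (convex_Ioi 0)
      (fun s hs => (hΓ.hasDerivAt_mul_rpow c hs).continuousAt.continuousWithinAt) (fun s hs => ?_)
      fun s hs => ?_ <;> rw [interior_Ioi] at hs
    · exact (hΓ.hasDerivAt_mul_rpow c hs).differentiableAt.differentiableWithinAt
    · rw [(hΓ.hasDerivAt_mul_rpow c hs).deriv]
      exact mul_nonneg (Real.rpow_nonneg (le_of_lt hs) _) (by linarith [h s hs])
  have lo : ∀ s, 0 < s → s ≤ 1 → Γ s ≤ Γ 1 * s ^ c := fun s hs hs1 => by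
    have := mono (mem_Ioi.2 hs) (mem_Ioi.2 zero_lt_one) hs1
    simp only [Real.one_rpow, mul_one] at this
    rwa [Real.rpow_neg hs.le, ← div_eq_mul_inv, div_le_iff₀ (by positivity)] at this
  have hi : ∀ s, 1 ≤ s → Γ 1 * s ^ c ≤ Γ s := fun s hs1 => by
    have hs : 0 < s := by linarith
    have := mono (mem_Ioi.2 zero_lt_one) (mem_Ioi.2 hs) hs1
    simp only [Real.one_rpow, mul_one] at this
    rwa [Real.rpow_neg hs.le, ← div_eq_mul_inv, le_div_iff₀ (by positivity)] at this
  have hΓ1 := hΓ.pos zero_lt_one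
  set y : ℝ := ((2 : ℝ) ^ j * Γ 1)⁻¹ ^ c⁻¹ with hy
  have hy0 : 0 < y := by positivity
  have hyc : y ^ c = ((2 : ℝ) ^ j * Γ 1)⁻¹ := Real.rpow_inv_rpow (by positivity) hc.ne'
  have h2j : (0 : ℝ) < 2 ^ j := by positivity
  set S := {m : ℤ | (2 : ℝ) ^ j * Γ ((2 : ℝ) ^ m) ≤ 1} with hS
  have hne : S.Nonempty := by
    obtain ⟨m, hm, -⟩ := exists_mem_Ico_zpow (lt_min hy0 zero_lt_one) one_lt_two
    refine ⟨m, ?_⟩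
    have h1 := lo (2 ^ m) (by positivity) (hm.trans (min_le_right _ _))
    have h3 : ((2 : ℝ) ^ m) ^ c ≤ y ^ c :=
      Real.rpow_le_rpow (by positivity) (hm.trans (min_le_left _ _)) hc.le
    calc (2 : ℝ) ^ j * Γ (2 ^ m) ≤ 2 ^ j * (Γ 1 * y ^ c) := by gcongr; exact h1.trans (by gcongr)
      _ = 1 := by rw [hyc]; field_simp
  have hbdd : BddAbove S := by
    obtain ⟨M, -, hM⟩ := exists_mem_Ico_zpow hy0 one_lt_two
    refine ⟨max 0 (M + 1), fun m hm => ?_⟩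
    by_contra! hlt
    have hm0 : 0 < m := (le_max_left _ _).trans_lt hlt
    have h1 := hi (2 ^ m) (one_le_zpow₀ (by norm_num) hm0.le)
    have h3 : y < 2 ^ m := hM.trans_le (zpow_le_zpow_right₀ (by norm_num)
      ((le_max_right _ _).trans hlt.le))
    have h4 : y ^ c < ((2 : ℝ) ^ m) ^ c := Real.rpow_lt_rpow hy0.le h3 hc
    have h5 : (2 : ℝ) ^ j * (Γ 1 * y ^ c) < 2 ^ j * Γ (2 ^ m) :=
      mul_lt_mul_of_pos_left ((mul_lt_mul_of_pos_left h4 hΓ1).trans_le h1) h2j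
    have h6 : (2 : ℝ) ^ j * (Γ 1 * y ^ c) = 1 := by rw [hyc]; field_simp
    exact absurd hm (not_le.2 (h6 ▸ h5))
  refine ⟨Int.csSup_mem hne hbdd, ?_⟩
  by_contra! h'
  have : kstar Γ j + 1 ≤ kstar Γ j := le_csSup hbdd h'
  omega

lemma IsGammaU.exists_card_kstar_le (hΓ : IsGammaU Γ) : ∃ N0 : ℕ, ∀ (J : Finset ℤ) (k : ℤ),
    (J.filter fun j => kstar Γ j = k).card ≤ N0 := by
  obtain ⟨D, hD1, hD⟩ := hΓ.exists_doubling
  obtain ⟨M, -, hM⟩ := exists_mem_Ico_zpow (by linarith : 0 < D) one_lt_two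
  refine ⟨(M + 1).toNat, fun J k => ?_⟩
  rcases (J.filter fun j => kstar Γ j = k).eq_empty_or_nonempty with he | hne
  · simp [he]
  obtain ⟨i, hi, hmin⟩ := Finset.exists_min_image _ id hne
  have hik := (Finset.mem_filter.1 hi).2
  have sub : (J.filter fun j => kstar Γ j = k) ⊆ Finset.Ico i (i + (M + 1)) := by
    intro j hj
    have hjk := (Finset.mem_filter.1 hj).2
    refine Finset.mem_Ico.2 ⟨hmin j hj, ?_⟩
    have h1 := (hΓ.kstar_spec j).1
    have h2 := (hΓ.kstar_spec i).2
    rw [hjk] at h1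
    rw [hik, zpow_add_one₀ (by norm_num), mul_comm _ (2 : ℝ)] at h2
    have hp : (0 : ℝ) < 2 ^ k := by positivity
    have h3 := hD _ hp
    have hg := hΓ.pos hp
    have h2i : (0 : ℝ) < 2 ^ i := by positivity
    have h4 : (2 : ℝ) ^ j * Γ (2 ^ k) < (2 ^ i * D) * Γ (2 ^ k) := by
      refine h1.trans_lt (h2.trans_le ?_)
      rw [mul_assoc]
      exact mul_le_mul_of_nonneg_left h3 h2i.le
    have h5 : (2 : ℝ) ^ j < 2 ^ (i + (M + 1)) := by
      rw [zpow_add₀ (by norm_num)]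
      exact (lt_of_mul_lt_mul_right h4 hg.le).trans (mul_lt_mul_of_pos_left hM h2i)
    exact (zpow_lt_zpow_iff_right₀ (by norm_num)).1 h5
  refine (Finset.card_le_card sub).trans ?_
  simp
end

section
variable {θ θ₁ θ₂ a a₁ : ℝ → ℝ} {lam c B : ℝ}

lemma RadData.mono (h : RadData θ θ₁ θ₂ a a₁ lam c B) {B' : ℝ} (hB : B ≤ B') :
    RadData θ θ₁ θ₂ a a₁ lam c B' :=
  { h with
    bdd := fun r => (h.bdd r).trans hB
    abs_phase₂_le := fun r hr => (h.abs_phase₂_le r hr).trans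
      (mul_le_mul_of_nonneg_right hB h.lam_pos.le)
    abs_amp₁_le := fun r hr => (h.abs_amp₁_le r hr).trans hB }

/-- The amplitude `a θ / lam` arising from differentiation in the frequency parameter. -/
lemma RadData.mul_phase (h : RadData θ θ₁ θ₂ a a₁ lam c B) {B' : ℝ}
    (h0 : ∀ r ∈ Icc (1 / 2 : ℝ) 2, |θ r| ≤ B' * lam)
    (h1 : ∀ r ∈ Icc (1 / 2 : ℝ) 2, |θ₁ r| ≤ B' * lam) :
    RadData θ θ₁ θ₂ (fun r => a r * θ r / lam) (fun r => (a₁ r * θ r + a r * θ₁ r) / lam)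
      lam c (B + 2 * B * B') := by
  have hl := h.lam_pos
  have hB := h.B_nonneg
  have hB' : 0 ≤ B' := by
    have h2 := (abs_nonneg _).trans (h0 1 (by norm_num))
    exact nonneg_of_mul_nonneg_left h2 hl
  have hBB := mul_nonneg hB hB'
  refine { h.mono (by linarith : B ≤ B + 2 * B * B') with
    meas_a := (h.meas_a.mul h.meas).div_const _
    supp := fun r hr => h.supp r fun h' => hr (by simp [h'])
    bdd := fun r => ?_
    deriv_amp := fun r hr => ((h.deriv_amp r hr).mul (h.deriv_phase r hr)).div_const _
    cont_amp₁ := ?_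
    abs_amp₁_le := fun r hr => ?_ }
  · by_cases hr : r ∈ Icc (1 / 2 : ℝ) 2
    · rw [abs_div, abs_of_pos hl, div_le_iff₀ hl, abs_mul]
      have := mul_le_mul (h.bdd r) (h0 r hr) (abs_nonneg _) hB
      nlinarith [mul_nonneg hBB hl.le, mul_nonneg hB hl.le]
    · rw [h.amp_eq_zero hr]
      simpa using (by linarith : 0 ≤ B + 2 * B * B')
  · have ca : ContinuousOn a (Icc (1 / 2 : ℝ) 2) := fun r hr =>
      (h.deriv_amp r hr).continuousAt.continuousWithinAt
    have cθ : ContinuousOn θ (Icc (1 / 2 : ℝ) 2) := fun r hr =>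
      (h.deriv_phase r hr).continuousAt.continuousWithinAt
    have cθ₁ : ContinuousOn θ₁ (Icc (1 / 2 : ℝ) 2) := fun r hr =>
      (h.deriv_phase₁ r hr).continuousAt.continuousWithinAt
    exact ((h.cont_amp₁.mul cθ).add (ca.mul cθ₁)).div_const _
  · rw [abs_div, abs_of_pos hl, div_le_iff₀ hl]
    refine (abs_add_le _ _).trans ?_
    rw [abs_mul, abs_mul]
    have e1 := mul_le_mul (h.abs_amp₁_le r hr) (h0 r hr) (abs_nonneg _) hB
    have e2 := mul_le_mul (h.bdd r) (h1 r hr) (abs_nonneg _) hB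
    nlinarith [mul_nonneg hBB hl.le, mul_nonneg hB hl.le]

end

/-- The radial amplitude `ψ(r) / r ^ n`. -/
def radAmp (ψ : ℝ → ℝ) (n : ℕ) (r : ℝ) : ℝ := if 0 < r then ψ r / r ^ n else 0

/-- The derivative of `radAmp ψ n` on `(0, ∞)`. -/
def radAmpDeriv (ψ : ℝ → ℝ) (n : ℕ) (r : ℝ) : ℝ :=
  (deriv ψ r * r ^ n - ψ r * (n * r ^ (n - 1))) / (r ^ n) ^ 2

section
variable {Γ ψ : ℝ → ℝ}

lemma IsLPCutoff.radAmp_ne_zero (hψ : IsLPCutoff ψ) {n : ℕ} {r : ℝ} (h : radAmp ψ n r ≠ 0) :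
    r ∈ Icc (1 / 2 : ℝ) 2 := by
  rw [radAmp] at h
  split_ifs at h with hr
  · have := hψ.2.2.1 r fun h' => h (by simp [h'])
    rwa [abs_of_pos hr] at this
  · exact absurd rfl h

lemma IsLPCutoff.hasDerivAt_radAmp (hψ : IsLPCutoff ψ) (n : ℕ) {r : ℝ} (hr : 0 < r) :
    HasDerivAt (radAmp ψ n) (radAmpDeriv ψ n r) r := by
  have h1 : HasDerivAt ψ (deriv ψ r) r := (hψ.1.differentiable (by simp) r).hasDerivAt
  refine (h1.div (hasDerivAt_pow n r) (by positivity)).congr_of_eventuallyEq ?_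
  filter_upwards [Ioi_mem_nhds hr] with t ht
  exact if_pos ht

lemma IsLPCutoff.continuousOn_radAmpDeriv (hψ : IsLPCutoff ψ) (n : ℕ) :
    ContinuousOn (radAmpDeriv ψ n) (Icc (1 / 2 : ℝ) 2) := by
  have h1 : Continuous (deriv ψ) := hψ.1.continuous_deriv (by simp)
  have h2 : Continuous ψ := hψ.1.continuous
  refine ContinuousOn.div (Continuous.continuousOn (by fun_prop)) (by fun_prop) fun r hr => ?_
  have : 0 < r := by linarith [hr.1]
  positivity

lemma IsLPCutoff.measurable_radAmp (hψ : IsLPCutoff ψ) (n : ℕ) : Measurable (radAmp ψ n) :=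
  Measurable.ite measurableSet_Ioi (hψ.1.continuous.measurable.div (by fun_prop)) measurable_const

lemma IsLPCutoff.exists_abs_radAmp_le (hψ : IsLPCutoff ψ) (n : ℕ) : ∃ B : ℝ,
    (∀ r, |radAmp ψ n r| ≤ B) ∧ ∀ r ∈ Icc (1 / 2 : ℝ) 2, |radAmpDeriv ψ n r| ≤ B := by
  have h1 : ContinuousOn (radAmp ψ n) (Icc (1 / 2 : ℝ) 2) := fun r hr =>
    (hψ.hasDerivAt_radAmp n (by linarith [hr.1] : 0 < r)).continuousAt.continuousWithinAt
  obtain ⟨B₁, hB₁⟩ := isCompact_Icc.exists_bound_of_continuousOn h1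
  obtain ⟨B₂, hB₂⟩ := isCompact_Icc.exists_bound_of_continuousOn (hψ.continuousOn_radAmpDeriv n)
  refine ⟨max B₁ B₂, fun r => ?_, fun r hr => (hB₂ r hr).trans (le_max_right _ _)⟩
  by_cases hr : r ∈ Icc (1 / 2 : ℝ) 2
  · exact (hB₁ r hr).trans (le_max_left _ _)
  · have : radAmp ψ n r = 0 := by
      by_contra h
      exact hr (hψ.radAmp_ne_zero h)
    rw [this, abs_zero]
    exact ((norm_nonneg _).trans (hB₁ 1 (by norm_num))).trans (le_max_left _ _)

lemma IsGammaU.radData (hΓ : IsGammaU Γ) {a a₁ : ℝ → ℝ} {D c₁ c₂ c₃ B lam s b : ℝ}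
    (hD1 : 1 ≤ D) (hD : ∀ s, 0 < s → Γ (2 * s) ≤ D * Γ s)
    (hc₁ : 0 < c₁) (h₁ : ∀ s, 0 < s → c₁ * Γ s ≤ s * deriv Γ s)
    (hc₂ : 0 < c₂) (h₂ : ∀ s, 0 < s → s * deriv Γ s ≤ c₂ * Γ s)
    (hc₃ : 0 < c₃) (h₃ : ∀ s, 0 < s → s ^ 2 * |iteratedDeriv 2 Γ s| ≤ c₃ * Γ s)
    (hs : 0 < s) (hb : 0 < b) (hlam : 1 ≤ lam) (hle : b * Γ s ≤ lam) (hge : lam ≤ 2 * D * (b * Γ s))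
    (ha : Measurable a) (ha_supp : ∀ r, a r ≠ 0 → r ∈ Icc (1 / 2 : ℝ) 2) (haB : ∀ r, |a r| ≤ B)
    (ha_deriv : ∀ r ∈ Icc (1 / 2 : ℝ) 2, HasDerivAt a (a₁ r) r)
    (ha₁ : ContinuousOn a₁ (Icc (1 / 2 : ℝ) 2)) (ha₁B : ∀ r ∈ Icc (1 / 2 : ℝ) 2, |a₁ r| ≤ B) :
    RadData (fun r => b * Γ (s * |r|)) (fun r => b * (s * deriv Γ (s * r)))
        (fun r => b * (s ^ 2 * iteratedDeriv 2 Γ (s * r))) a a₁ lam (c₁ / (4 * D ^ 2))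
        (B + 4 * c₃ * D) ∧
      (∀ r ∈ Icc (1 / 2 : ℝ) 2, |b * Γ (s * |r|)| ≤ (D + 2 * c₂ * D) * lam) ∧
      ∀ r ∈ Icc (1 / 2 : ℝ) 2, |b * (s * deriv Γ (s * r))| ≤ (D + 2 * c₂ * D) * lam := by
  have hpos : ∀ r ∈ Icc (1 / 2 : ℝ) 2, 0 < r := fun r hr => by linarith [hr.1]
  have hDp : 0 < D := by linarith
  have hlp : 0 < lam := by linarith
  have hB : 0 ≤ B := (abs_nonneg _).trans (haB 0)
  have up : ∀ r ∈ Icc (1 / 2 : ℝ) 2, b * Γ (s * r) ≤ D * lam := fun r hr => by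
    have e1 : Γ (s * r) ≤ Γ (2 * s) :=
      hΓ.mono (mul_pos hs (hpos r hr)).le (by nlinarith [hr.2])
    have e2 := mul_le_mul_of_nonneg_left (e1.trans (hD s hs)) hb.le
    nlinarith [mul_le_mul_of_nonneg_left hle hDp.le]
  have low : ∀ r ∈ Icc (1 / 2 : ℝ) 2, lam ≤ 2 * D ^ 2 * (b * Γ (s * r)) := fun r hr => by
    have e1 : Γ s ≤ D * Γ (s * r) := by
      refine le_trans ?_ (hD _ (mul_pos hs (hpos r hr)))
      exact hΓ.mono hs.le (by nlinarith [hr.1])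
    have e2 := mul_le_mul_of_nonneg_left (mul_le_mul_of_nonneg_left e1 hb.le) hDp.le
    nlinarith
  have d1 : ∀ r ∈ Icc (1 / 2 : ℝ) 2, b * (s * deriv Γ (s * r)) ≤ 2 * c₂ * D * lam := fun r hr => by
    have hr0 := hpos r hr
    have e1 := mul_le_mul_of_nonneg_left (h₂ _ (mul_pos hs hr0)) hb.le
    have e2 := mul_le_mul_of_nonneg_left (up r hr) hc₂.le
    have e3 := mul_pos hb (mul_pos hs (hΓ.deriv_pos _ (mul_pos hs hr0)))
    nlinarith [hr.1]
  have d1' : ∀ r ∈ Icc (1 / 2 : ℝ) 2, 0 < b * (s * deriv Γ (s * r)) := fun r hr =>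
    mul_pos hb (mul_pos hs (hΓ.deriv_pos _ (mul_pos hs (hpos r hr))))
  have hlin : ∀ r : ℝ, HasDerivAt (fun r => s * r) s r := fun r => by
    simpa using (hasDerivAt_id r).const_mul s
  refine ⟨⟨by positivity, hlam, ?_, ha, ha_supp, fun r => (haB r).trans ?_, fun r hr => ?_,
    fun r hr => ?_, ?_, fun r hr => ?_, fun r hr => ?_, ha_deriv, ha₁,
    fun r hr => (ha₁B r hr).trans ?_⟩, fun r hr => ?_, fun r hr => ?_⟩
  · refine (Continuous.measurable ?_).const_mul b
    exact hΓ.continuousOn.comp_continuous (by fun_prop) fun r =>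
      mul_nonneg hs.le (abs_nonneg r)
  · have : 0 ≤ 4 * c₃ * D := by positivity
    linarith
  · have hr0 := hpos r hr
    have := ((hΓ.hasDerivAt (mul_pos hs hr0)).comp r (hlin r)).const_mul b
    refine (this.congr_deriv (by ring)).congr_of_eventuallyEq ?_
    filter_upwards [Ioi_mem_nhds hr0] with t ht
    simp [abs_of_pos (mem_Ioi.1 ht)]
  · have hr0 := hpos r hr
    have := (((hΓ.hasDerivAt_deriv (mul_pos hs hr0)).comp r (hlin r)).const_mul s).const_mul b
    exact this.congr_deriv (by ring)
  · refine continuousOn_const.mul (continuousOn_const.mul ?_)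
    exact hΓ.continuousOn_iteratedDeriv_two.comp (by fun_prop) fun r hr => mul_pos hs (hpos r hr)
  · have hr0 := hpos r hr
    have e1 := mul_le_mul_of_nonneg_left (h₁ _ (mul_pos hs hr0)) hb.le
    have e2 := mul_le_mul_of_nonneg_left (low r hr) hc₁.le
    have e3 := d1' r hr
    rw [div_mul_eq_mul_div, div_le_iff₀ (by positivity)]
    have e4 : b * (s * r * deriv Γ (s * r)) ≤ 2 * (b * (s * deriv Γ (s * r))) := by
      nlinarith [hr.2]
    nlinarith [mul_le_mul_of_nonneg_left (e1.trans e4) (sq_nonneg D)]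
  · have hr0 := hpos r hr
    have e1 := mul_le_mul_of_nonneg_left (h₃ _ (mul_pos hs hr0)) hb.le
    have e2 := mul_le_mul_of_nonneg_left (up r hr) hc₃.le
    rw [abs_mul, abs_mul, abs_of_pos hb, abs_of_nonneg (sq_nonneg s)]
    set X := b * (s ^ 2 * |iteratedDeriv 2 Γ (s * r)|) with hX
    have e3 : 0 ≤ X := by positivity
    have e4 : b * ((s * r) ^ 2 * |iteratedDeriv 2 Γ (s * r)|) = r ^ 2 * X := by rw [hX]; ring
    rw [e4] at e1
    have e5 : 1 / 4 * X ≤ r ^ 2 * X := mul_le_mul_of_nonneg_right (by nlinarith [hr.1]) e3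
    nlinarith [mul_nonneg hB hlp.le]
  · have : 0 ≤ 4 * c₃ * D := by positivity
    linarith
  · have hr0 := hpos r hr
    rw [abs_of_pos hr0, abs_of_pos (mul_pos hb (hΓ.pos (mul_pos hs hr0)))]
    have : 0 ≤ 2 * c₂ * D * lam := by positivity
    nlinarith [up r hr]
  · rw [abs_of_pos (d1' r hr)]
    nlinarith [d1 r hr, mul_pos hDp hlp]

lemma IsGammaU.Slm_bounds (hΓ : IsGammaU Γ) {D : ℝ} (hD : ∀ s, 0 < s → Γ (2 * s) ≤ D * Γ s)
    {l m j : ℤ} (hl : 1 ≤ l) (hj : j ∈ Slm Γ l m) :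
    1 ≤ (2 : ℝ) ^ (m + l + 1) ∧
      (2 : ℝ) ^ j * Γ (2 ^ (l + kstar Γ j)) ≤ (2 : ℝ) ^ (m + l + 1) ∧
      (2 : ℝ) ^ (m + l + 1) ≤ 2 * D * ((2 : ℝ) ^ j * Γ (2 ^ (l + kstar Γ j))) := by
  obtain ⟨h1, h2⟩ := hj
  obtain ⟨k1, k2⟩ := hΓ.kstar_spec j
  have hp : (0 : ℝ) < 2 ^ kstar Γ j := by positivity
  have hj0 : (0 : ℝ) < 2 ^ j := by positivity
  have hΓp := hΓ.pos hp
  have k3 : 1 < D * ((2 : ℝ) ^ j * Γ (2 ^ kstar Γ j)) := by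
    rw [zpow_add_one₀ two_ne_zero, mul_comm ((2 : ℝ) ^ kstar Γ j)] at k2
    nlinarith [mul_le_mul_of_nonneg_left (hD _ hp) hj0.le]
  have h3 : Γ (2 ^ kstar Γ j) ≤ Γ (2 ^ (l + kstar Γ j)) :=
    hΓ.mono hp.le (zpow_le_zpow_right₀ one_le_two (by omega))
  rw [div_lt_iff₀ hΓp] at h2
  rw [le_div_iff₀ hΓp] at h1
  have hlp : (0 : ℝ) < 2 ^ (m + l) := by positivity
  rw [zpow_add_one₀ two_ne_zero] at h2 ⊢
  set L := (2 : ℝ) ^ (m + l)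
  refine ⟨?_, ?_, ?_⟩
  · by_contra! hlt
    nlinarith
  · nlinarith [mul_le_mul_of_nonneg_left h2.le hj0.le]
  · have e1 := mul_le_mul_of_nonneg_left h1 hj0.le
    have hDp : 0 < D := by
      by_contra! h
      nlinarith [mul_pos hj0 hΓp]
    have e2 := mul_le_mul_of_nonneg_left e1 hDp.le
    nlinarith [mul_lt_mul_of_pos_left k3 hlp]

end

/-- The rescaled phase `r ↦ 2 ^ j Γ(2 ^ (l + j_*) r)`. -/
def radPhase (Γ : ℝ → ℝ) (l j : ℤ) (r : ℝ) : ℝ :=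
  (2 : ℝ) ^ j * Γ ((2 : ℝ) ^ (l + kstar Γ j) * |r|)

theorem IsGammaU.exists_radData {Γ ψ : ℝ → ℝ} (hΓ : IsGammaU Γ) (hψ : IsLPCutoff ψ) (n : ℕ) :
    ∃ c B : ℝ, ∀ l : ℤ, 1 ≤ l → ∀ m, ∀ j ∈ Slm Γ l m, ∃ θ₁ θ₂ a₁ a₁' : ℝ → ℝ,
      RadData (radPhase Γ l j) θ₁ θ₂ (radAmp ψ n) a₁ ((2 : ℝ) ^ (m + l + 1)) c B ∧
      RadData (radPhase Γ l j) θ₁ θ₂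
        (fun r => radAmp ψ n r * radPhase Γ l j r / (2 : ℝ) ^ (m + l + 1)) a₁'
        ((2 : ℝ) ^ (m + l + 1)) c B := by
  obtain ⟨D, hD1, hD⟩ := hΓ.exists_doubling
  obtain ⟨c₁, hc₁, h₁⟩ := hΓ.exists_le_mul_deriv
  obtain ⟨c₂, hc₂, h₂⟩ := hΓ.exists_mul_deriv_le
  obtain ⟨c₃, hc₃, h₃⟩ := hΓ.exists_sq_mul_iteratedDeriv_two_le
  obtain ⟨B, hB, hB₁⟩ := hψ.exists_abs_radAmp_le n
  refine ⟨c₁ / (4 * D ^ 2), (B + 4 * c₃ * D) + 2 * (B + 4 * c₃ * D) * (D + 2 * c₂ * D),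
    fun l hl m j hj => ?_⟩
  obtain ⟨s1, s2, s3⟩ := hΓ.Slm_bounds hD hl hj
  obtain ⟨r1, r2, r3⟩ := hΓ.radData hD1 hD hc₁ h₁ hc₂ h₂ hc₃ h₃
    (by positivity : (0 : ℝ) < 2 ^ (l + kstar Γ j)) (by positivity : (0 : ℝ) < 2 ^ j) s1 s2 s3
    (hψ.measurable_radAmp n) (fun r hr => hψ.radAmp_ne_zero hr) hB
    (fun r hr => hψ.hasDerivAt_radAmp n (by linarith [hr.1])) (hψ.continuousOn_radAmpDeriv n) hB₁
  have h0 := r1.B_nonneg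
  have : 0 ≤ 2 * (B + 4 * c₃ * D) * (D + 2 * c₂ * D) :=
    mul_nonneg (by linarith) (by nlinarith)
  exact ⟨_, _, _, _, r1.mono (by linarith), r1.mul_phase r2 r3⟩

lemma IsHomCZKernel.exists_sphData {n : ℕ} {K : Rn n → ℝ} (hK : IsHomCZKernel n K) :
    ∃ (Ω : Rn n → ℝ) (B : ℝ), SphData Ω B ∧ ∀ t, t ≠ 0 → K t = Ω t / ‖t‖ ^ n := by
  obtain ⟨Ω, h1, h2, h3, h4⟩ := hK
  have hc := h1.continuousOn
  have hopen : IsOpen {x : Rn n | x ≠ 0} := isOpen_ne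
  have hS : Metric.sphere (0 : Rn n) 1 ⊆ {x : Rn n | x ≠ 0} := fun x hx =>
    norm_ne_zero_iff.1 (by rw [mem_sphere_zero_iff_norm.1 hx]; exact one_ne_zero)
  obtain ⟨B, hB⟩ := (isCompact_sphere (0 : Rn n) 1).exists_bound_of_continuousOn (hc.mono hS)
  refine ⟨({x : Rn n | x ≠ 0}).indicator Ω, max B 0, ⟨?_, fun t => ?_, fun c hcp t => ?_, ?_⟩,
    fun t ht => ?_⟩
  · classical
    rw [← piecewise_eq_indicator]
    exact hc.measurable_piecewise continuousOn_const hopen.measurableSet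
  · by_cases ht : t = 0
    · simp [ht]
    · have hn := norm_pos_iff.2 ht
      rw [indicator_of_mem (show t ∈ {x : Rn n | x ≠ 0} from ht),
        ← h2 ‖t‖⁻¹ (by positivity) t]
      refine (hB _ ?_).trans (le_max_left _ _)
      rw [mem_sphere_zero_iff_norm, norm_smul, norm_inv, norm_norm, inv_mul_cancel₀ hn.ne']
  · by_cases ht : t = 0
    · simp [ht]
    · have hct : c • t ≠ 0 := smul_ne_zero hcp.ne' ht
      rw [indicator_of_mem (show t ∈ {x : Rn n | x ≠ 0} from ht),
        indicator_of_mem (show c • t ∈ {x : Rn n | x ≠ 0} from hct), h2 c hcp]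
  · rw [← h3]
    exact integral_congr_ae (.of_forall fun ω => indicator_of_mem (hS ω.2) _)
  · rw [indicator_of_mem (show t ∈ {x : Rn n | x ≠ 0} from ht), h4 t ht]

lemma Hloc_eq_cv {n : ℕ} (hn : 0 < n) {Γ ψ : ℝ → ℝ} {K Ω : Rn n → ℝ}
    (hΩ : ∀ c : ℝ, 0 < c → ∀ t, Ω (c • t) = Ω t)
    (hK : ∀ t, t ≠ 0 → K t = Ω t / ‖t‖ ^ n) (f : Rn n → ℂ) (l j : ℤ) (u : ℝ) (x : Rn n) :
    Hloc Γ K ψ ((2 : ℝ) ^ j * u) (l + kstar Γ j) f x =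
      cv f (dil ((2 : ℝ) ^ (l + kstar Γ j)) (radKer (radPhase Γ l j) (radAmp ψ n) Ω u)) x := by
  have := nontrivial_Rn hn
  rw [Hloc, cv]
  refine integral_congr_ae ?_
  filter_upwards [compl_mem_ae_iff.2 (measure_singleton (0 : Rn n))] with t ht
  have ht : t ≠ 0 := ht
  have hs : (0 : ℝ) < 2 ^ (l + kstar Γ j) := by positivity
  rw [zpow_neg]
  set s := (2 : ℝ) ^ (l + kstar Γ j) with hsd
  have hn0 : 0 < ‖t‖ := norm_pos_iff.2 ht
  have e1 : ‖s⁻¹ • t‖ = s⁻¹ * ‖t‖ := by rw [norm_smul, norm_inv, Real.norm_of_nonneg hs.le]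
  have e2 : s * |s⁻¹ * ‖t‖| = ‖t‖ := by
    rw [abs_of_pos (by positivity), mul_inv_cancel_left₀ hs.ne']
  rw [dil, radKer, e1, radPhase, ← hsd, e2, hΩ _ (inv_pos.2 hs), hK t ht, radAmp,
    if_pos (by positivity)]
  have e3 : ψ (s⁻¹ * ‖t‖) * (Ω t / ‖t‖ ^ n) =
      (s ^ n)⁻¹ * (ψ (s⁻¹ * ‖t‖) / (s⁻¹ * ‖t‖) ^ n * Ω t) := by
    rw [mul_pow, inv_pow]
    field_simp
  rw [e3, show (2 : ℝ) ^ j * u * Γ ‖t‖ = u * ((2 : ℝ) ^ j * Γ ‖t‖) by ring]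
  push_cast
  ring

/-- The kernels `dil (2 ^ σ j) (radKer (θ j) (a j) Ω u)` form an oscillatory family. -/
lemma oscFamily_dil_radKer {n : ℕ} {θ a : ℤ → ℝ → ℝ} {lam c B B' : ℝ} {Ω : Rn n → ℝ} {A C : ℝ≥0∞}
    {J0 : Finset ℤ} {σ : ℤ → ℤ} {N0 : ℕ}
    (hR : ∀ j ∈ J0, ∃ θ₁ θ₂ a₁ : ℝ → ℝ, RadData (θ j) θ₁ θ₂ (a j) a₁ lam c B) (hΩ : SphData Ω B')
    (hA : ∀ {θ θ₁ θ₂ a a₁ : ℝ → ℝ} {lam : ℝ} {Ω : Rn n → ℝ}, RadData θ θ₁ θ₂ a a₁ lam c B →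
      SphData Ω B' → ∀ s : ℝ, 0 < s → ∀ G, BddInt G → ∀ x,
      ∫⁻ u, ‖cv G (dil s (radKer θ a Ω u)) x‖ₑ ^ 2 ∂(freqMeas lam) ≤
        A * ballAvg (2 * s) (fun y => ‖G y‖ₑ ^ 2) x)
    (hC : ∀ {θ θ₁ θ₂ a a₁ : ℝ → ℝ} {lam : ℝ} {Ω : Rn n → ℝ}, RadData θ θ₁ θ₂ a a₁ lam c B →
      SphData Ω B' → ∀ η : Rn n,
      ∫⁻ u, ‖𝓕 (radKer θ a Ω u) η‖ₑ ^ 2 ∂(freqMeas lam) ≤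
        C * ENNReal.ofReal (lam ^ (-(1 / 8) : ℝ)) * ENNReal.ofReal (mm ‖η‖ ^ (1 / 8 : ℝ)))
    (hN : ∀ s, (J0.filter fun j => σ j = s).card ≤ N0) :
    OscFamily (freqMeas lam) J0 σ
      (fun j u => if j ∈ J0 then dil ((2 : ℝ) ^ σ j) (radKer (θ j) (a j) Ω u) else 0)
      (1 / 8) A (C * ENNReal.ofReal (lam ^ (-(1 / 8) : ℝ))) N0 where
  meas j := by
    by_cases hj : j ∈ J0
    · obtain ⟨θ₁, θ₂, a₁, h⟩ := hR j hj
      simpa only [hj, if_true] using measurable_uncurry_dil (measurable_uncurry_radKer h hΩ.meas)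
    · simp only [hj, if_false]
      exact measurable_const
  bddInt j u := by
    by_cases hj : j ∈ J0
    · obtain ⟨θ₁, θ₂, a₁, h⟩ := hR j hj
      simpa only [hj, if_true] using (bddInt_radKer h hΩ u).dil (by positivity)
    · simp only [hj, if_false]
      exact ⟨measurable_const, ⟨0, by simp⟩, integrable_zero _ _ _⟩
  supp j u t ht := by
    by_cases hj : j ∈ J0
    · obtain ⟨θ₁, θ₂, a₁, h⟩ := hR j hj
      simp only [hj, if_true]
      exact dil_eq_zero (by positivity) (fun t ht => radKer_eq_zero h u fun h' => ht.not_ge h'.2) t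
        (by rwa [mul_comm])
    · simp [hj]
  local_sq j hj G hG x := by
    obtain ⟨θ₁, θ₂, a₁, h⟩ := hR j hj
    simp only [hj, if_true]
    exact hA h hΩ _ (by positivity) G hG x
  multiplier j hj ξ := by
    obtain ⟨θ₁, θ₂, a₁, h⟩ := hR j hj
    have hs : (0 : ℝ) < 2 ^ σ j := by positivity
    simp only [hj, if_true, fourier_dil hs]
    have := hC h hΩ ((2 : ℝ) ^ σ j • ξ)
    rwa [norm_smul, Real.norm_of_nonneg hs.le] at this
  card_fiber := hN

theorem exists_lintegral_rpow_sum_radKer_le {n : ℕ} (hn : 2 ≤ n) {q : ℝ} (hq : 1 < q)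
    (c B B' : ℝ) (N0 : ℕ) : ∃ C : ℝ≥0∞, C ≠ ⊤ ∧ ∀ (θ a : ℤ → ℝ → ℝ) (lam : ℝ) (Ω : Rn n → ℝ)
      (J0 : Finset ℤ) (σ : ℤ → ℤ),
      (∀ j ∈ J0, ∃ θ₁ θ₂ a₁ : ℝ → ℝ, RadData (θ j) θ₁ θ₂ (a j) a₁ lam c B) → SphData Ω B' →
      (∀ s, (J0.filter fun j => σ j = s).card ≤ N0) →
      ∀ f : Rn n → ℂ, BddInt f → UniformContinuous f →
      ∫⁻ x, (∑ j ∈ J0, ∫⁻ u, ‖cv f (dil ((2 : ℝ) ^ σ j) (radKer (θ j) (a j) Ω u)) x‖ₑ ^ 2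
        ∂(freqMeas lam)) ^ q ≤
        C * ENNReal.ofReal (lam ^ (-(1 / 8) : ℝ)) * ∫⁻ x, (‖f x‖ₑ ^ 2) ^ q := by
  obtain ⟨A, hAt, hA⟩ := exists_lintegral_cv_dil_radKer_le (n := n) (by omega) c B B'
  obtain ⟨C₁, hC₁t, hC₁⟩ := exists_lintegral_fourier_radKer_le hn c B B'
  obtain ⟨C₂, hC₂t, hC₂⟩ := exists_lintegral_rpow_oscFamily_le (n := n) (by omega) hq
    (by norm_num : (0 : ℝ) < 1 / 8) (by norm_num) hAt N0
  refine ⟨C₂ * C₁, by finiteness, fun θ a lam Ω J0 σ hR hΩ hN f hf hfu => ?_⟩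
  have H := hC₂ (freqMeas lam) J0 σ _ _ (by finiteness) (oscFamily_dil_radKer hR hΩ hA hC₁ hN) f hf hfu
  rw [mul_assoc C₂]
  refine le_trans (le_of_eq ?_) H
  refine lintegral_congr fun x => congrArg (· ^ q) (Finset.sum_congr rfl fun j hj => ?_)
  simp only [hj, if_true]

lemma lintegral_tsum_rpow_le {α ι : Type*} [MeasurableSpace α] {μ : Measure α} [Countable ι]
    {g : ι → α → ℝ≥0∞} (hg : ∀ i, Measurable (g i)) {q : ℝ} (hq : 0 < q) {C : ℝ≥0∞}
    (h : ∀ s : Finset ι, ∫⁻ x, (∑ i ∈ s, g i x) ^ q ∂μ ≤ C) :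
    ∫⁻ x, (∑' i, g i x) ^ q ∂μ ≤ C := by
  have e : ∀ x, (∑' i, g i x) ^ q = ⨆ s : Finset ι, (∑ i ∈ s, g i x) ^ q := fun x => by
    rw [ENNReal.tsum_eq_iSup_sum]
    exact (ENNReal.orderIsoRpow q hq).map_iSup _
  simp_rw [e]
  rw [lintegral_iSup_directed]
  · exact iSup_le h
  · exact fun s => ((Finset.measurable_sum s fun i _ => hg i).pow_const q).aemeasurable
  · refine Monotone.directed_le fun s t hst x => ?_
    exact ENNReal.rpow_le_rpow (Finset.sum_le_sum_of_subset hst) hq.le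

lemma tsum_rpow_rpow_le_tsum_sq {ι : Type*} {r : ℝ} (hr : 2 ≤ r) (b : ι → ℝ≥0∞) :
    (∑' j, b j ^ r) ^ (1 / r) ≤ (∑' j, b j ^ 2) ^ (1 / 2 : ℝ) := by
  set S := ∑' j, b j ^ 2 with hS
  have e : ∀ y : ℝ≥0∞, y ^ (r / 2) = y * y ^ (r / 2 - 1) := fun y => by
    nth_rewrite 2 [← ENNReal.rpow_one y]
    rw [← ENNReal.rpow_add_of_nonneg _ _ zero_le_one (by linarith)]
    congr 1
    ring
  have h1 : ∀ j, b j ^ r ≤ b j ^ 2 * S ^ (r / 2 - 1) := fun j => by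
    have : b j ^ r = (b j ^ 2) ^ (r / 2) := by
      rw [← ENNReal.rpow_natCast, ← ENNReal.rpow_mul]
      congr 1
      push_cast
      ring
    rw [this, e]
    exact mul_le_mul' le_rfl (ENNReal.rpow_le_rpow (ENNReal.le_tsum j) (by linarith))
  have h2 : ∑' j, b j ^ r ≤ S ^ (r / 2) := by
    rw [e, hS, ← ENNReal.tsum_mul_right]
    exact ENNReal.tsum_le_tsum h1
  refine (ENNReal.rpow_le_rpow h2 (by positivity)).trans (le_of_eq ?_)
  rw [← ENNReal.rpow_mul]
  congr 1
  field_simp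

lemma measurable_lintegral_cv_dil_radKer {n : ℕ} {θ θ₁ θ₂ a a₁ : ℝ → ℝ} {lam c B : ℝ}
    {Ω : Rn n → ℝ} (h : RadData θ θ₁ θ₂ a a₁ lam c B) (hΩ : Measurable Ω) {f : Rn n → ℂ}
    (hf : Measurable f) (s : ℝ) :
    Measurable fun x => ∫⁻ u, ‖cv f (dil s (radKer θ a Ω u)) x‖ₑ ^ 2 ∂(freqMeas lam) :=
  Measurable.lintegral_prod_left' (f := fun z : ℝ × Rn n =>
      ‖cv f (dil s (radKer θ a Ω z.1)) z.2‖ₑ ^ 2)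
    ((measurable_uncurry_cv hf (measurable_uncurry_dil
      (measurable_uncurry_radKer h hΩ))).enorm.pow_const 2)

theorem exists_lintegral_tsum_besovNorm_le {n : ℕ} (hn : 2 ≤ n) {Γ : ℝ → ℝ} (hΓ : IsGammaU Γ)
    {K : Rn n → ℝ} (hK : IsHomCZKernel n K) {ψ χ : ℝ → ℝ} (hψ : IsLPCutoff ψ) (hχ : IsChiCutoff χ)
    {q r : ℝ} (hr : 2 ≤ r) (hq : 1 < q) : ∃ C : ℝ≥0∞, C ≠ ⊤ ∧ ∀ l : ℤ, 1 ≤ l → ∀ m : ℤ,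
      ∀ f : Rn n → ℂ, BddInt f → UniformContinuous f →
      ∫⁻ x, (∑' j : Slm Γ l m, besovNorm ψ r (fun u => Complex.ofReal (χ u) *
          Hloc Γ K ψ ((2 : ℝ) ^ (j : ℤ) * u) (l + kstar Γ (j : ℤ)) f x) ^ 2) ^ q ≤
        C * ENNReal.ofReal (((2 : ℝ) ^ (m + l + 1)) ^ (-(1 / 8) : ℝ)) *
          ∫⁻ x, (‖f x‖ₑ ^ 2) ^ q := by
  obtain ⟨c, B, hR⟩ := hΓ.exists_radData hψ n
  obtain ⟨Ω, B', hΩ, hKΩ⟩ := hK.exists_sphData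
  obtain ⟨N0, hN0⟩ := hΓ.exists_card_kstar_le
  obtain ⟨C₁, hC₁t, hC₁⟩ := exists_lintegral_rpow_sum_radKer_le hn hq c B B' N0
  obtain ⟨C₂, hC₂t, hC₂⟩ := exists_besovNorm_cv_le hψ hχ hr
  have hq0 : 0 < q := by linarith
  refine ⟨C₂ ^ q * (2 ^ (q - 1) * (C₁ + C₁)), by finiteness, fun l hl m f hf hfu => ?_⟩
  set lam : ℝ := (2 : ℝ) ^ (m + l + 1) with hlam
  set E := ENNReal.ofReal (lam ^ (-(1 / 8) : ℝ)) with hE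
  set F := ∫⁻ x, (‖f x‖ₑ ^ 2) ^ q with hF
  set Q : (ℤ → ℝ → ℝ) → ℤ → Rn n → ℝ≥0∞ := fun a j x =>
    ∫⁻ u, ‖cv f (dil ((2 : ℝ) ^ (l + kstar Γ j)) (radKer (radPhase Γ l j) (a j) Ω u)) x‖ₑ ^ 2
      ∂(freqMeas lam) with hQ
  have key : ∀ a : ℤ → ℝ → ℝ, (∀ j ∈ Slm Γ l m, ∃ θ₁ θ₂ a₁ : ℝ → ℝ,
      RadData (radPhase Γ l j) θ₁ θ₂ (a j) a₁ lam c B) →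
      (∀ j : Slm Γ l m, Measurable (Q a j)) ∧
      ∫⁻ x, (∑' j : Slm Γ l m, Q a j x) ^ q ≤ C₁ * E * F := fun a ha => by
    have hm : ∀ j : Slm Γ l m, Measurable (Q a j) := fun j => by
      obtain ⟨θ₁, θ₂, a₁, h⟩ := ha j j.2
      exact measurable_lintegral_cv_dil_radKer h hΩ.meas hf.meas _
    refine ⟨hm, lintegral_tsum_rpow_le hm hq0 fun s => ?_⟩
    have H := hC₁ (radPhase Γ l) a lam Ω (s.map (Function.Embedding.subtype _))
      (fun j => l + kstar Γ j) (fun j hj => ?_) hΩ (fun k => ?_) f hf hfu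
    · simp only [Finset.sum_map] at H
      exact H
    · obtain ⟨i, -, rfl⟩ := Finset.mem_map.1 hj
      exact ha i i.2
    · refine le_trans (Finset.card_le_card fun j hj => ?_)
        (hN0 (s.map (Function.Embedding.subtype _)) (k - l))
      rw [Finset.mem_filter] at hj ⊢
      exact ⟨hj.1, by omega⟩
  obtain ⟨m₁, H₁⟩ := key (fun _ => radAmp ψ n) fun j hj => by
    obtain ⟨θ₁, θ₂, a₁, a₁', h, -⟩ := hR l hl m j hj
    exact ⟨_, _, _, h⟩
  obtain ⟨m₂, H₂⟩ := key (fun j r => radAmp ψ n r * radPhase Γ l j r / lam) fun j hj => by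
    obtain ⟨θ₁, θ₂, a₁, a₁', -, h⟩ := hR l hl m j hj
    exact ⟨_, _, _, h⟩
  set Q₁ := Q fun _ => radAmp ψ n
  set Q₂ := Q fun j r => radAmp ψ n r * radPhase Γ l j r / lam
  have hlam0 : 0 < lam := by positivity
  have pt : ∀ x, (∑' j : Slm Γ l m, besovNorm ψ r (fun u => Complex.ofReal (χ u) *
        Hloc Γ K ψ ((2 : ℝ) ^ (j : ℤ) * u) (l + kstar Γ (j : ℤ)) f x) ^ 2) ^ q ≤
      C₂ ^ q * (2 ^ (q - 1) *
        ((∑' j : Slm Γ l m, Q₁ j x) ^ q + (∑' j : Slm Γ l m, Q₂ j x) ^ q)) := fun x => by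
    have h1 : ∑' j : Slm Γ l m, besovNorm ψ r (fun u => Complex.ofReal (χ u) *
        Hloc Γ K ψ ((2 : ℝ) ^ (j : ℤ) * u) (l + kstar Γ (j : ℤ)) f x) ^ 2 ≤
        C₂ * ((∑' j : Slm Γ l m, Q₁ j x) + ∑' j : Slm Γ l m, Q₂ j x) := by
      rw [← ENNReal.tsum_add, ← ENNReal.tsum_mul_left]
      refine ENNReal.tsum_le_tsum fun j => ?_
      obtain ⟨θ₁, θ₂, a₁, a₁', h, h'⟩ := hR l hl m j j.2
      simp_rw [Hloc_eq_cv (by omega : 0 < n) hΩ.hom hKΩ]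
      exact hC₂ h h' (fun r => div_mul_cancel₀ _ hlam0.ne') hΩ _ (by positivity) f hf x
    refine (ENNReal.rpow_le_rpow h1 hq0.le).trans ?_
    rw [ENNReal.mul_rpow_of_nonneg _ _ hq0.le]
    exact mul_le_mul' le_rfl (ENNReal.rpow_add_le_mul_rpow_add_rpow _ _ hq.le)
  refine (lintegral_mono pt).trans ?_
  rw [lintegral_const_mul' _ _ (by finiteness), lintegral_const_mul' _ _ (by finiteness),
    lintegral_add_left ((Measurable.ennreal_tsum m₁).pow_const q)]
  refine (mul_le_mul' le_rfl (mul_le_mul' le_rfl (add_le_add H₁ H₂))).trans (le_of_eq ?_)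
  ring

lemma SchwartzMap.bddInt {n : ℕ} (f : SchwartzMap (Rn n) ℂ) : BddInt f := by
  obtain ⟨C, hC⟩ := f.decay 0 0
  exact ⟨f.continuous.measurable, ⟨C, fun x => by simpa using hC.2 x⟩, f.integrable⟩

lemma SchwartzMap.uniformContinuous {n : ℕ} (f : SchwartzMap (Rn n) ℂ) : UniformContinuous f :=
  f.continuous.uniformContinuous_of_tendsto_cocompact f.tendsto_cocompact

/-- Proposition 6.2 (large `p`). -/
theorem short_variation_large_p (n : ℕ) (hn : 2 ≤ n) (Γ : ℝ → ℝ) (hΓ : IsGammaU Γ)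
    (K : Rn n → ℝ) (hK : IsHomCZKernel n K) (ψ : ℝ → ℝ) (hψ : IsLPCutoff ψ)
    (χ : ℝ → ℝ) (hχ : IsChiCutoff χ) (p r : ℝ) (hr : 2 ≤ r)
    (hp : 2 * (n + 1) / (n - 1) < p) :
    ∃ ε > (0 : ℝ), ∃ C > (0 : ℝ), ∀ l : ℤ, 1 ≤ l → ∀ m : ℤ, ∀ f : SchwartzMap (Rn n) ℂ,
      lpNormENN p
          (fun x => (∑' j : Slm Γ l m,
            besovNorm ψ r (fun u =>
              Complex.ofReal (χ u) *
                Hloc Γ K ψ ((2 : ℝ) ^ (j : ℤ) * u) (l + kstar Γ (j : ℤ)) (⇑f) x) ^ r)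
              ^ (1 / r)) volume
        ≤ ENNReal.ofReal (C * (2 : ℝ) ^ (-(((m : ℝ) + (l : ℝ)) * ε))) *
            eLpNorm (⇑f) (ENNReal.ofReal p) volume := by
  have hp2 : 2 < p := by
    refine lt_of_lt_of_le ?_ hp.le
    have : (2 : ℝ) ≤ n := by exact_mod_cast hn
    rw [lt_div_iff₀ (by linarith)]
    linarith
  have hp0 : 0 < p := by linarith
  obtain ⟨C, hCt, hC⟩ := exists_lintegral_tsum_besovNorm_le hn hΓ hK hψ hχ hr
    (by linarith : 1 < p / 2)
  refine ⟨1 / (8 * p), by positivity, (C ^ (1 / p)).toReal + 1, by positivity,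
    fun l hl m f => ?_⟩
  have H := hC l hl m f f.bddInt f.uniformContinuous
  have hpow : ∀ y : ℝ≥0∞, (y ^ 2) ^ (p / 2) = y ^ p := fun y => by
    rw [← ENNReal.rpow_natCast, ← ENNReal.rpow_mul]
    congr 1
    push_cast
    ring
  simp_rw [hpow] at H
  have h1 : ∀ x, ((∑' j : Slm Γ l m, besovNorm ψ r (fun u => Complex.ofReal (χ u) *
        Hloc Γ K ψ ((2 : ℝ) ^ (j : ℤ) * u) (l + kstar Γ (j : ℤ)) (⇑f) x) ^ r) ^ (1 / r)) ^ p ≤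
      (∑' j : Slm Γ l m, besovNorm ψ r (fun u => Complex.ofReal (χ u) *
        Hloc Γ K ψ ((2 : ℝ) ^ (j : ℤ) * u) (l + kstar Γ (j : ℤ)) (⇑f) x) ^ 2) ^ (p / 2) := by
    intro x
    refine (ENNReal.rpow_le_rpow (tsum_rpow_rpow_le_tsum_sq hr _) hp0.le).trans (le_of_eq ?_)
    rw [← ENNReal.rpow_mul]
    congr 1
    ring
  rw [lpNormENN, eLpNorm_eq_lintegral_rpow_enorm_toReal (by simpa using hp0) ENNReal.ofReal_ne_top,
    ENNReal.toReal_ofReal hp0.le]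
  refine (ENNReal.rpow_le_rpow ((lintegral_mono h1).trans H) (by positivity)).trans ?_
  rw [ENNReal.mul_rpow_of_nonneg _ _ (by positivity), ENNReal.mul_rpow_of_nonneg _ _ (by positivity)]
  refine mul_le_mul' ?_ le_rfl
  rw [ENNReal.ofReal_mul (by positivity)]
  refine mul_le_mul' ?_ ?_
  · rw [ENNReal.le_ofReal_iff_toReal_le (by finiteness) (by positivity)]
    linarith
  · rw [ENNReal.ofReal_rpow_of_pos (by positivity)]
    refine ENNReal.ofReal_le_ofReal ?_
    rw [← Real.rpow_intCast, ← Real.rpow_mul zero_le_two, ← Real.rpow_mul zero_le_two]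
    refine Real.rpow_le_rpow_of_exponent_le one_le_two ?_
    push_cast
    have : 0 < 1 / (8 * p) := by positivity
    have e : ((m : ℝ) + l + 1) * -(1 / 8) * (1 / p) = -((m + l) * (1 / (8 * p))) - 1 / (8 * p) := by
      field_simp
      ring
    rw [e]
    linarith
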